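/- Let N ≥ 2, s ∈ (0,1), μ ≥ μ_0, and let Ω ⊂ ℝ^N be a bounded C² domain with 0 ∈ Ω. Let f ∈ C^θ_loc(cl(Ω)∖{0}) for some θ ∈ (0,1) with ∫_Ω |f| Γ_μ dx < ∞. Then for every k ∈ ℝ there exists a function u_k ∈ L¹(Ω, Λ_μ dx) ∩ L^∞_loc(ℝ^N∖{0}) ∩ L¹(ℝ^N, dx/(1+|x|^{N+2s})) which is a distributional solution of L^s_μ u = f in Ω∖{0} with u = 0 in ℝ^N∖Ω and which satisfies the distributional identity ∫_Ω u_k (−Δ)^s_{Γ_μ} ξ dx = ∫_Ω f ξ Γ_μ dx + c_{s,μ} k ξ(0) for all ξ ∈ C²(ℝ^N) with compact support contained in Ω. -/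

import Mathlib

open MeasureTheory Filter Set Topology Metric

noncomputable section

/-- Euclidean space `ℝ^N`. -/
abbrev EN (N : ℕ) := EuclideanSpace ℝ (Fin N)

/-- The normalizing constant `C_{N,s}` of the fractional Laplacian. -/
def CNs (N : ℕ) (s : ℝ) : ℝ :=
  2 ^ (2*s) * Real.pi ^ (-(N:ℝ)/2) * s * Real.Gamma ((N + 2*s)/2) / Real.Gamma (1 - s)

/-- The optimal fractional Hardy constant `μ₀`. -/
def mu0 (N : ℕ) (s : ℝ) : ℝ :=
  -(2 ^ (2*s) * Real.Gamma ((N + 2*s)/4) ^ 2 / Real.Gamma ((N - 2*s)/4) ^ 2)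

/-- The function `τ ↦ c_s(τ)`. -/
def csFun (N : ℕ) (s τ : ℝ) : ℝ :=
  2 ^ (2*s) * Real.Gamma ((N + τ)/2) * Real.Gamma ((2*s - τ)/2) /
    (Real.Gamma (-τ/2) * Real.Gamma ((N - 2*s + τ)/2))

/-- `u` has fractional Laplacian `(-Δ)^s u (x) = L` at `x`, as a principal value. -/
def HasFracLap (N : ℕ) (s : ℝ) (u : EN N → ℝ) (x : EN N) (L : ℝ) : Prop :=
  Tendsto (fun ε : ℝ =>
      CNs N s * ∫ z in {z : EN N | ε ≤ dist x z}, (u x - u z) / dist x z ^ ((N:ℝ) + 2*s))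
    (𝓝[>] 0) (𝓝 L)

/-- `v` has weighted fractional Laplacian `(-Δ)^s_{Γ_μ} v (x) = L` at `x`, where the weight
is `Γ_μ(z) = ‖z‖ ^ τp` with `τp = τ₊(s,μ)`. -/
def HasWFracLap (N : ℕ) (s τp : ℝ) (v : EN N → ℝ) (x : EN N) (L : ℝ) : Prop :=
  Tendsto (fun ε : ℝ =>
      CNs N s * ∫ z in {z : EN N | ε ≤ dist x z},
        (v x - v z) * ‖z‖ ^ τp / dist x z ^ ((N:ℝ) + 2*s))
    (𝓝[>] 0) (𝓝 L)

/-- Membership in `L¹(ℝ^N, dx/(1+|x|^{N+2s}))`. -/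
def MemL1w (N : ℕ) (s : ℝ) (u : EN N → ℝ) : Prop :=
  Integrable (fun x : EN N => u x / (1 + ‖x‖ ^ ((N:ℝ) + 2*s)))

/-- Membership in `L^∞_loc(ℝ^N \ {0})`. -/
def LocBddAway (N : ℕ) (u : EN N → ℝ) : Prop :=
  ∀ K : Set (EN N), IsCompact K → (0:EN N) ∉ K → ∃ C : ℝ, ∀ x ∈ K, |u x| ≤ C

/-- Local `θ`-Hölder continuity on compact subsets of `S`, i.e. `C^θ_loc(S)`. -/
def HolderLocOn (N : ℕ) (θ : ℝ) (f : EN N → ℝ) (S : Set (EN N)) : Prop :=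
  ∀ K ⊆ S, IsCompact K → ∃ C : ℝ, ∀ x ∈ K, ∀ y ∈ K, |f x - f y| ≤ C * dist x y ^ θ

/-- Membership in `L^∞_loc(S)`. -/
def LinfLocOn (N : ℕ) (f : EN N → ℝ) (S : Set (EN N)) : Prop :=
  AEMeasurable f ∧ ∀ K ⊆ S, IsCompact K → ∃ C : ℝ, ∀ x ∈ K, |f x| ≤ C

/-- A bounded `C²` domain: open, connected and bounded, whose boundary is the regular zero
level set of a `C²` defining function. -/
structure IsBoundedC2Domain (N : ℕ) (Ω : Set (EN N)) : Prop where
  isOpen : IsOpen Ω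
  isConnected : IsConnected Ω
  isBounded : Bornology.IsBounded Ω
  c2Boundary : ∃ φ : EN N → ℝ, ContDiff ℝ 2 φ ∧ Ω = {x | φ x < 0} ∧
    ∀ x ∈ frontier Ω, fderiv ℝ φ x ≠ 0

/-- A bounded domain: open, connected and bounded. -/
def IsBoundedDomain (N : ℕ) (Ω : Set (EN N)) : Prop :=
  IsOpen Ω ∧ IsConnected Ω ∧ Bornology.IsBounded Ω

/-- The first standard coordinate vector `e₁ ∈ ℝ^N`. -/
def e1 (N : ℕ) : EN N :=
  (EuclideanSpace.equiv (Fin N) ℝ).symm (fun i => if (i:ℕ) = 0 then 1 else 0)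

/-- The surface measure `ω_{N-1}` of the unit sphere in `ℝ^N`. -/
def omegaN (N : ℕ) : ℝ := N * (volume (ball (0 : EN N) 1)).toReal

/-- The normalization constant `c_{s,0}`. -/
def cs0 (N : ℕ) (s : ℝ) : ℝ :=
  CNs N s * omegaN N * ∫ t in Ioo (0:ℝ) 1, ∫ z in ball (0:EN N) t,
    (‖z‖ ^ (2*s - N) - 1) / ‖e1 N - z‖ ^ ((N:ℝ) + 2*s)

/-- The fundamental solution `Φ_μ`, expressed via the exponent `τ = τ₋(s,μ)`:
`Φ_μ(x) = |x|^τ` for `μ ≠ μ₀` and `Φ_{μ₀}(x) = -|x|^τ ln |x|`. -/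
def Phi (N : ℕ) (s μ τ : ℝ) (x : EN N) : ℝ :=
  if μ = mu0 N s then -(‖x‖ ^ τ * Real.log ‖x‖) else ‖x‖ ^ τ

/-- The integrand appearing in the definition of `c_{s,μ}`. -/
def cIntegrand (N : ℕ) (s μ τm τp : ℝ) (z : EN N) : ℝ :=
  if μ = mu0 N s then ‖z‖ ^ ((2*s - N)/2) * (-Real.log ‖z‖) / ‖e1 N - z‖ ^ ((N:ℝ) + 2*s)
  else (‖z‖ ^ τm - ‖z‖ ^ τp) / ‖e1 N - z‖ ^ ((N:ℝ) + 2*s)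

/-- The normalization constant `c_{s,μ}`. -/
def csmu (N : ℕ) (s μ τm τp : ℝ) : ℝ :=
  CNs N s * omegaN N * ∫ t in Ioo (0:ℝ) 1, ∫ z in ball (0:EN N) t, cIntegrand N s μ τm τp z

/-- The weight `Λ_μ`, expressed via `τp = τ₊(s,μ)`. -/
def Lam (N : ℕ) (s τp : ℝ) (x : EN N) : ℝ :=
  if 2*s - 1 < τp then 1
  else if τp < 2*s - 1 then ‖x‖ ^ (1 - 2*s + τp)
  else 1 + max (-Real.log ‖x‖) 0

/-- The quadratic form `E^s(u,v)`. -/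
def Es (N : ℕ) (s : ℝ) (u v : EN N → ℝ) : ℝ :=
  (CNs N s / 2) *
    ∫ p : EN N × EN N, (u p.1 - u p.2) * (v p.1 - v p.2) / dist p.1 p.2 ^ ((N:ℝ) + 2*s)

/-- The quadratic form `E^s_μ(u,v)`. -/
def Esmu (N : ℕ) (s μ : ℝ) (u v : EN N → ℝ) : ℝ :=
  Es N s u v + μ * ∫ x : EN N, u x * v x / ‖x‖ ^ (2*s)

/-- `E^s_{A,B}(u,u) < ∞`. -/
def FiniteEnergyOn (N : ℕ) (s : ℝ) (u : EN N → ℝ) (A B : Set (EN N)) : Prop :=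
  IntegrableOn (fun p : EN N × EN N => (u p.1 - u p.2)^2 / dist p.1 p.2 ^ ((N:ℝ) + 2*s)) (A ×ˢ B)

/-- Membership in `H^s(ℝ^N)`: locally `L²` with finite Gagliardo seminorm. -/
def MemHs (N : ℕ) (s : ℝ) (u : EN N → ℝ) : Prop :=
  (∀ K : Set (EN N), IsCompact K → IntegrableOn (fun x => (u x)^2) K) ∧
  FiniteEnergyOn N s u univ univ

/-- Membership in `H^s_0(Ω)`. -/
def MemHs0 (N : ℕ) (s : ℝ) (Ω : Set (EN N)) (u : EN N → ℝ) : Prop :=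
  MemHs N s u ∧ ∀ᵐ x : EN N, x ∉ Ω → u x = 0

/-- Membership in `W^s(Ω)`. -/
def MemWs (N : ℕ) (s : ℝ) (Ω : Set (EN N)) (u : EN N → ℝ) : Prop :=
  MemL1w N s u ∧ IntegrableOn (fun x => (u x)^2) Ω ∧
  ∃ Ω' : Set (EN N), IsOpen Ω' ∧ IsConnected Ω' ∧ closure Ω ⊆ Ω' ∧ FiniteEnergyOn N s u Ω Ω'

/-- Membership in `W^s_*(Ω)`. -/
def MemWsStar (N : ℕ) (s : ℝ) (Ω : Set (EN N)) (u : EN N → ℝ) : Prop :=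
  MemL1w N s u ∧ ∀ ε : ℝ, 0 < ε → MemWs N s (Ω \ closedBall 0 ε) u

/-- The distributional identity `L^s_μ u = f` in `Ω \ {0}`, tested against `C^∞_c(Ω\{0})`. -/
def DistrEq (N : ℕ) (s μ : ℝ) (Ω : Set (EN N)) (f u : EN N → ℝ) : Prop :=
  ∀ φ : EN N → ℝ, ContDiff ℝ (⊤ : ℕ∞) φ → HasCompactSupport φ → tsupport φ ⊆ Ω \ {0} →
    ∀ g : EN N → ℝ, (∀ x, HasFracLap N s φ x (g x)) →
      (∫ x, u x * g x) + μ * ∫ x, u x * φ x / ‖x‖ ^ (2*s) = ∫ x in Ω, f x * φ x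

/-- A distributional solution of `L^s_μ u = f` in `Ω \ {0}` with `u = 0` in `ℝ^N \ Ω`. -/
def IsDistrSol (N : ℕ) (s μ : ℝ) (Ω : Set (EN N)) (f u : EN N → ℝ) : Prop :=
  LocBddAway N u ∧ MemL1w N s u ∧ (∀ x ∉ Ω, u x = 0) ∧ DistrEq N s μ Ω f u

lemma lip1 (β : ℝ) : ∃ M : ℝ, 0 ≤ M ∧ ∀ a : ℝ, |a| ≤ 1/2 → |(1+a)^β - 1| ≤ M * |a| := by
  have hcont : ContinuousOn (fun a : ℝ => β * (1+a)^(β-1)) (Icc (-(1/2)) (1/2)) := by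
    apply ContinuousOn.mul continuousOn_const
    apply ContinuousOn.rpow_const (by fun_prop)
    intro x hx; left; have := hx.1; intro h; linarith
  obtain ⟨M, hM⟩ := isCompact_Icc.exists_bound_of_continuousOn hcont
  refine ⟨max M 0, le_max_right _ _, fun a ha => ?_⟩
  have h := Convex.norm_image_sub_le_of_norm_hasDerivWithin_le (f := fun a : ℝ => (1+a)^β)
    (f' := fun a : ℝ => β * (1+a)^(β-1)) (C := max M 0) (s := Icc (-(1/2)) (1/2)) (x := 0) (y := a) ?_ ?_
    (convex_Icc _ _) (by constructor <;> norm_num) (by rw [abs_le] at ha; exact ha)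
  · simpa using h
  · intro x hx
    have h1 : HasDerivAt (fun a : ℝ => 1 + a) 1 x := by simpa using (hasDerivAt_id x).const_add 1
    have := h1.rpow_const (p := β) (Or.inl (by have := hx.1; intro h; linarith))
    simpa using this.hasDerivWithinAt
  · intro x hx; exact (hM x hx).trans (le_max_left _ _)

lemma taylor1 (α : ℝ) : ∃ M : ℝ, 0 ≤ M ∧ ∀ a : ℝ, |a| ≤ 1/2 → |(1+a)^α - 1 - α * a| ≤ M * a^2 := by
  obtain ⟨M, hM0, hM⟩ := lip1 (α-1)
  refine ⟨|α| * M, by positivity, fun a ha => ?_⟩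
  have h := Convex.norm_image_sub_le_of_norm_hasDerivWithin_le (f := fun a : ℝ => (1+a)^α - 1 - α * a)
    (f' := fun a : ℝ => α * ((1+a)^(α-1) - 1)) (C := |α| * M * |a|) (s := Icc (-|a|) |a|) (x := 0) (y := a) ?_ ?_
    (convex_Icc _ _) (by constructor <;> simp) (by constructor; exact neg_abs_le a; exact le_abs_self a)
  · rw [← sq_abs a]; simp only [add_zero, Real.one_rpow, sub_self, mul_zero, sub_zero, Real.norm_eq_abs] at h
    calc _ ≤ _ := h
      _ = _ := by ring
  · intro x hx
    have hx2 : |x| ≤ |a| := abs_le.2 hx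
    have h1 : HasDerivAt (fun a : ℝ => 1 + a) 1 x := by simpa using (hasDerivAt_id x).const_add 1
    have := ((h1.rpow_const (p := α) (Or.inl (by have := (abs_le.1 (hx2.trans ha)).1; intro h; linarith))).sub_const 1).sub ((hasDerivAt_id x).const_mul α)
    have h2 : HasDerivAt (fun a : ℝ => (1+a)^α - 1 - α * a) (α * ((1+x)^(α-1) - 1)) x := by
      refine this.congr_deriv ?_
      ring
    exact h2.hasDerivWithinAt
  · intro x hx
    have hx2 : |x| ≤ |a| := abs_le.2 hx
    rw [Real.norm_eq_abs, abs_mul, mul_assoc]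
    gcongr
    exact (hM x (hx2.trans ha)).trans (by gcongr)

lemma nontriv_EN {N : ℕ} (hN : 2 ≤ N) : Nontrivial (EN N) := by
  have : Nonempty (Fin N) := ⟨⟨0, by omega⟩⟩
  infer_instance

lemma int_rpow_tail {N : ℕ} (hN : 2 ≤ N) {a b : ℝ} (ha : -(N:ℝ) < a) (hab : a - b < -(N:ℝ)) :
    Integrable (fun z : EN N => ‖z‖^a * (1+‖z‖)^(-b)) := by
  have := nontriv_EN hN
  have hb : 0 < b := by linarith
  refine (integrable_fun_norm_addHaar (E := EN N) volume (f := fun y : ℝ => y^a * (1+y)^(-b))).2 ?_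
  simp only [finrank_euclideanSpace, Fintype.card_fin, smul_eq_mul]
  have hm : Measurable (fun y : ℝ => y ^ (N-1) * (y^a * (1+y)^(-b))) := by fun_prop
  rw [← Ioc_union_Ioi_eq_Ioi (zero_le_one' ℝ)]
  have hN1 : ((N-1 : ℕ):ℝ) = N - 1 := by push_cast [Nat.cast_sub (show 1 ≤ N by omega)]; ring
  apply IntegrableOn.union
  · have h1 : IntegrableOn (fun y : ℝ => y ^ ((N:ℝ)-1+a)) (Ioc 0 1) := by
      rw [← intervalIntegrable_iff_integrableOn_Ioc_of_le zero_le_one]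
      exact intervalIntegral.intervalIntegrable_rpow' (by linarith)
    refine Integrable.mono' h1 hm.aestronglyMeasurable ?_
    filter_upwards [ae_restrict_mem measurableSet_Ioc] with y hy
    have hy0 := hy.1
    rw [Real.norm_of_nonneg (by positivity), Real.rpow_add hy0, ← hN1, Real.rpow_natCast, ← mul_assoc]
    have : (1+y)^(-b) ≤ 1 := Real.rpow_le_one_of_one_le_of_nonpos (by linarith) (by linarith)
    exact mul_le_of_le_one_right (by positivity) this
  · have h1 : IntegrableOn (fun y : ℝ => y ^ ((N:ℝ)-1+a-b)) (Ioi 1) :=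
      integrableOn_Ioi_rpow_of_lt (by linarith) one_pos
    refine Integrable.mono' h1 hm.aestronglyMeasurable ?_
    filter_upwards [ae_restrict_mem measurableSet_Ioi] with y hy
    have hy0 : 0 < y := lt_trans one_pos hy
    rw [Real.norm_of_nonneg (by positivity), sub_eq_add_neg _ b, Real.rpow_add hy0, Real.rpow_add hy0, ← hN1, Real.rpow_natCast, ← mul_assoc]
    gcongr ?_ * ?_
    exact Real.rpow_le_rpow_of_nonpos hy0 (by linarith) (by linarith)

lemma int_rpow_ball {N : ℕ} (hN : 2 ≤ N) {a : ℝ} (ha : -(N:ℝ) < a) (R : ℝ) :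
    IntegrableOn (fun z : EN N => ‖z‖^a) (ball 0 R) := by
  rcases le_or_gt R 0 with hR | hR
  · simp [ball_eq_empty.2 hR]
  have h := (int_rpow_tail hN ha (b := a + N + 1) (by linarith)).const_mul ((1+R)^(a+N+1))
  refine Integrable.mono' h.integrableOn (Measurable.aestronglyMeasurable (by fun_prop)) ?_
  filter_upwards [ae_restrict_mem measurableSet_ball] with z hz
  have hz : ‖z‖ < R := by simpa using hz
  rw [Real.norm_of_nonneg (by positivity)]
  have h1 : 1 ≤ (1+R)^(a+N+1) * (1+‖z‖)^(-(a+N+1)) := by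
    rw [Real.rpow_neg (by positivity), ← div_eq_mul_inv, one_le_div (by positivity)]
    exact Real.rpow_le_rpow (by positivity) (by linarith) (by linarith)
  calc ‖z‖^a = ‖z‖^a * 1 := by ring
    _ ≤ ‖z‖^a * ((1+R)^(a+N+1) * (1+‖z‖)^(-(a+N+1))) := by gcongr
    _ = _ := by ring

/-- comparison of `dist x z` with `1+‖z‖`. -/
lemma dist_lower {N : ℕ} {x z : EN N} {r R : ℝ} (hr : 0 < r) (hx : ‖x‖ ≤ R) (h : r ≤ dist x z) :
    1 + ‖z‖ ≤ ((1+R)/r+1) * dist x z := by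
  have h1 : ‖z‖ ≤ ‖x‖ + dist x z := by
    have := norm_sub_norm_le z x
    rw [dist_comm, dist_eq_norm]; linarith
  have hR : 0 ≤ R := (norm_nonneg x).trans hx
  have : 1 + R ≤ (1+R)/r * dist x z := by
    rw [div_mul_eq_mul_div, le_div_iff₀ hr]; gcongr
  linarith

lemma ker_bound {N : ℕ} {x z : EN N} {r R b : ℝ} (hb : 0 ≤ b) (hr : 0 < r) (hx : ‖x‖ ≤ R) (h : r ≤ dist x z) (a : ℝ) :
    ‖z‖^a / dist x z ^ b ≤ ((1+R)/r+1)^b * (‖z‖^a * (1+‖z‖)^(-b)) := by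
  have hd : 0 < dist x z := hr.trans_le h
  have hR : 0 ≤ R := (norm_nonneg x).trans hx
  have h1 := Real.rpow_le_rpow (by positivity) (dist_lower hr hx h) hb
  rw [Real.mul_rpow (by positivity) hd.le] at h1
  rw [Real.rpow_neg (by positivity), div_le_iff₀ (by positivity)]
  have : 1 ≤ ((1+R)/r+1)^b * (((1+‖z‖)^b)⁻¹) * dist x z ^ b := by
    rw [mul_right_comm, ← div_eq_mul_inv, le_div_iff₀ (by positivity), one_mul]; exact h1
  calc ‖z‖^a = ‖z‖^a * 1 := by ring
    _ ≤ ‖z‖^a * (((1+R)/r+1)^b * (((1+‖z‖)^b)⁻¹) * dist x z ^ b) := by gcongr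
    _ = _ := by ring

lemma measSet_dist {N : ℕ} (x : EN N) (r : ℝ) : MeasurableSet {z : EN N | r ≤ dist x z} :=
  measurableSet_le measurable_const (by fun_prop)

lemma int_ker {N : ℕ} (hN : 2 ≤ N) {a b : ℝ} (ha : -(N:ℝ) < a) (hab : a - b < -(N:ℝ)) (x : EN N) {r : ℝ} (hr : 0 < r) :
    IntegrableOn (fun z : EN N => ‖z‖^a / dist x z ^ b) {z | r ≤ dist x z} := by
  have h := (int_rpow_tail hN ha hab).const_mul (((1+‖x‖)/r+1)^b)
  refine Integrable.mono' h.integrableOn (Measurable.aestronglyMeasurable (by fun_prop)) ?_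
  filter_upwards [ae_restrict_mem (measSet_dist x r)] with z hz
  rw [Real.norm_of_nonneg (by positivity)]
  exact ker_bound (by linarith) hr le_rfl hz a

lemma int_gamma_exp {q y : ℝ} (hq : -1 < q) (hy : 0 < y) :
    IntegrableOn (fun u : ℝ => u^q * Real.exp (-(u*y))) (Ioi 0) := by
  have := integrableOn_rpow_mul_exp_neg_mul_rpow hq one_pos hy
  refine this.congr_fun (fun u _ => ?_) measurableSet_Ioi
  simp only [Real.rpow_one]; ring_nf

lemma val_gamma_exp {σ y : ℝ} (hσ : σ < 1) (hy : 0 < y) :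
    ∫ u in Ioi (0:ℝ), u^(-σ) * Real.exp (-(u*y)) = Real.Gamma (1-σ) * y^(σ-1) := by
  have := integral_rpow_mul_exp_neg_mul_rpow (p := 1) (q := -σ) (b := y) one_pos (by linarith) hy
  simp only [Real.rpow_one, neg_mul] at this
  rw [show (-(-σ+1)/1) = σ - 1 by ring, show ((-σ+1)/1) = 1 - σ by ring] at this
  rw [one_div_one, mul_one] at this
  rw [mul_comm (Real.Gamma _), ← this]
  simp only [mul_comm y]

/-- Frullani-type identity. -/
lemma frullani {σ a b : ℝ} (hσ : σ < 1) (hσ0 : σ ≠ 0) (hab : a ≤ b) (ha : 0 < a ∨ (0 ≤ a ∧ 0 < σ)) :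
    IntegrableOn (fun u : ℝ => u^(-σ-1) * (Real.exp (-(u*a)) - Real.exp (-(u*b)))) (Ioi 0) ∧
    ∫ u in Ioi (0:ℝ), u^(-σ-1) * (Real.exp (-(u*a)) - Real.exp (-(u*b))) =
      Real.Gamma (-σ) * (a^σ - b^σ) := by
  have ha0 : 0 ≤ a := by rcases ha with h | h; exact h.le; exact h.1
  have hcond : -1 < σ - 1 ∨ (σ - 1 ≠ -1 ∧ (0:ℝ) ∉ uIcc a b) := by
    rcases ha with h | h
    · right; refine ⟨fun h => hσ0 (by linarith), ?_⟩
      rw [uIcc_of_le hab]; intro h'; exact absurd h'.1 (not_le.2 h)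
    · left; linarith [h.2]
  have hii : IntegrableOn (fun y : ℝ => y^(σ-1)) (Ioc a b) := by
    rw [← intervalIntegrable_iff_integrableOn_Ioc_of_le hab]
    rcases hcond with h | h
    · exact intervalIntegral.intervalIntegrable_rpow' h
    · exact intervalIntegral.intervalIntegrable_rpow (Or.inr h.2)
  have hpos : ∀ y ∈ Ioc a b, 0 < y := fun y hy => lt_of_le_of_lt ha0 hy.1
  have hG : Integrable (fun q : ℝ × ℝ => q.1^(-σ) * Real.exp (-(q.1*q.2)))
      ((volume.restrict (Ioi 0)).prod (volume.restrict (Ioc a b))) := by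
    rw [integrable_prod_iff' (Measurable.aestronglyMeasurable (by fun_prop))]
    constructor
    · filter_upwards [ae_restrict_mem measurableSet_Ioc] with y hy
      exact int_gamma_exp (by linarith) (hpos y hy)
    · have : IntegrableOn (fun y => Real.Gamma (1-σ) * y^(σ-1)) (Ioc a b) := hii.const_mul _
      refine this.congr ?_
      filter_upwards [ae_restrict_mem measurableSet_Ioc] with y hy
      rw [← val_gamma_exp hσ (hpos y hy)]
      refine setIntegral_congr_fun measurableSet_Ioi (fun u hu => ?_)
      have hu : 0 < u := hu
      rw [Real.norm_of_nonneg (by positivity)]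
  have hinner : ∀ u ∈ Ioi (0:ℝ), ∫ y in Ioc a b, u^(-σ) * Real.exp (-(u*y)) =
      u^(-σ-1) * (Real.exp (-(u*a)) - Real.exp (-(u*b))) := by
    intro u hu
    have hu : 0 < u := hu
    rw [integral_const_mul, ← intervalIntegral.integral_of_le hab]
    have : ∫ y in a..b, Real.exp (-(u*y)) = u⁻¹ * (Real.exp (-(u*a)) - Real.exp (-(u*b))) := by
      have h := intervalIntegral.integral_eq_sub_of_hasDerivAt (a := a) (b := b) (f := fun y => -u⁻¹ * Real.exp (-(u*y)))
        (f' := fun y => Real.exp (-(u*y))) (fun y _ => by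
          have h1 : HasDerivAt (fun y => -(u*y)) (-u) y := by
            refine (((hasDerivAt_id y).const_mul u).neg).congr_deriv ?_
            simp
          refine ((h1.exp).const_mul (-u⁻¹)).congr_deriv ?_
          field_simp) (Continuous.intervalIntegrable (by fun_prop) _ _)
      rw [h]; ring
    rw [this, Real.rpow_sub_one hu.ne']; ring
  constructor
  · refine hG.integral_prod_left.congr ?_
    filter_upwards [ae_restrict_mem measurableSet_Ioi] with u hu
    exact hinner u hu
  · rw [← setIntegral_congr_fun measurableSet_Ioi hinner, integral_integral_swap hG]
    rw [setIntegral_congr_fun measurableSet_Ioc (fun y hy => val_gamma_exp hσ (hpos y hy)), integral_const_mul,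
      ← intervalIntegral.integral_of_le hab, integral_rpow hcond]
    have : Real.Gamma (1-σ) = -σ * Real.Gamma (-σ) := by
      rw [← Real.Gamma_add_one (neg_ne_zero.2 hσ0)]; ring_nf
    rw [this]; simp only [sub_add_cancel]; field_simp; ring

lemma beta_Ioi {α β : ℝ} (hα : 0 < α) (hβ : 0 < β) :
    IntegrableOn (fun u : ℝ => u^(α-1) * (1+u)^(-(α+β))) (Ioi 0) ∧
    ∫ u in Ioi (0:ℝ), u^(α-1) * (1+u)^(-(α+β)) = Real.Gamma α * Real.Gamma β / Real.Gamma (α+β) := by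
  have hΓ : 0 < Real.Gamma (α+β) := Real.Gamma_pos_of_pos (by linarith)
  have h1 : ∀ v ∈ Ioi (0:ℝ), ∫ u in Ioi (0:ℝ), (v^(α+β-1) * Real.exp (-v)) * (u^(α-1) * Real.exp (-(u*v))) = Real.Gamma α * (Real.exp (-v) * v^(β-1)) := by
    intro v hv
    have hv : 0 < v := hv
    have := val_gamma_exp (σ := 1-α) (y := v) (by linarith) hv
    rw [show -(1-α) = α - 1 by ring, show 1-(1-α) = α by ring, show 1-α-1 = -α by ring] at this
    rw [integral_const_mul, this, show α+β-1 = α+(β-1) by ring, Real.rpow_add hv, Real.rpow_neg hv.le]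
    field_simp
  have h2 : ∀ u ∈ Ioi (0:ℝ), ∫ v in Ioi (0:ℝ), (v^(α+β-1) * Real.exp (-v)) * (u^(α-1) * Real.exp (-(u*v))) = Real.Gamma (α+β) * (u^(α-1) * (1+u)^(-(α+β))) := by
    intro u hu
    have hu : 0 < u := hu
    have := val_gamma_exp (σ := 1-(α+β)) (y := 1+u) (by linarith) (by linarith)
    rw [show -(1-(α+β)) = α+β - 1 by ring, show 1-(1-(α+β)) = α+β by ring, show 1-(α+β)-1 = -(α+β) by ring] at this
    rw [mul_left_comm, ← this, ← integral_const_mul]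
    congr 1; ext v
    rw [show -(v*(1+u)) = -v + -(u*v) by ring, Real.exp_add]; ring
  have hG : Integrable (fun q : ℝ × ℝ => (q.2^(α+β-1) * Real.exp (-q.2)) * (q.1^(α-1) * Real.exp (-(q.1*q.2))))
      ((volume.restrict (Ioi 0)).prod (volume.restrict (Ioi 0))) := by
    rw [integrable_prod_iff' (Measurable.aestronglyMeasurable (by fun_prop))]
    constructor
    · filter_upwards [ae_restrict_mem measurableSet_Ioi] with y hy
      exact (int_gamma_exp (by linarith) hy).const_mul _
    · refine ((Real.GammaIntegral_convergent hβ).const_mul (Real.Gamma α)).congr ?_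
      filter_upwards [ae_restrict_mem measurableSet_Ioi] with y hy
      rw [← h1 y hy]
      refine setIntegral_congr_fun measurableSet_Ioi (fun u hu => ?_)
      have hu : 0 < u := hu
      have hy : 0 < y := hy
      rw [Real.norm_of_nonneg (by positivity)]
  constructor
  · refine (hG.integral_prod_left.const_mul ((Real.Gamma (α+β))⁻¹)).congr ?_
    filter_upwards [ae_restrict_mem measurableSet_Ioi] with u hu
    rw [h2 u hu]; field_simp
  · rw [eq_div_iff hΓ.ne', mul_comm, ← integral_const_mul, ← setIntegral_congr_fun measurableSet_Ioi h2, integral_integral_swap hG,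
      setIntegral_congr_fun measurableSet_Ioi h1, integral_const_mul, ← Real.Gamma_eq_integral hβ]

/-- the (unnormalised) radial constant -/
def rad (N : ℕ) : ℝ := N * (volume : Measure (EN N)).real (ball 0 1)

lemma rad_pos {N : ℕ} (hN : 2 ≤ N) : 0 < rad N := by
  have : (0:ℝ) < N := by exact_mod_cast (by omega : 0 < N)
  have : 0 < (volume : Measure (EN N)).real (ball 0 1) :=
    ENNReal.toReal_pos (measure_ball_pos _ _ one_pos).ne' measure_ball_lt_top.ne
  unfold rad; positivity

lemma polar {N : ℕ} (hN : 2 ≤ N) (f : ℝ → ℝ) :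
    ∫ x : EN N, f ‖x‖ = rad N * ∫ y in Ioi (0:ℝ), y^((N:ℝ)-1) * f y := by
  have := nontriv_EN hN
  rw [integral_fun_norm_addHaar volume f]
  simp only [finrank_euclideanSpace, Fintype.card_fin, smul_eq_mul, nsmul_eq_mul, rad]
  rw [mul_assoc]; congr 2
  refine setIntegral_congr_fun measurableSet_Ioi (fun y hy => ?_)
  have hN1 : ((N-1 : ℕ):ℝ) = N - 1 := by push_cast [Nat.cast_sub (show 1 ≤ N by omega)]; ring
  simp only [← hN1, Real.rpow_natCast]

lemma polar_int {N : ℕ} (hN : 2 ≤ N) (f : ℝ → ℝ) :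
    Integrable (fun x : EN N => f ‖x‖) ↔ IntegrableOn (fun y : ℝ => y^((N:ℝ)-1) * f y) (Ioi 0) := by
  have := nontriv_EN hN
  rw [integrable_fun_norm_addHaar volume (f := f)]
  apply integrableOn_congr_fun _ measurableSet_Ioi
  intro y hy
  have hN1 : ((N-1 : ℕ):ℝ) = N - 1 := by push_cast [Nat.cast_sub (show 1 ≤ N by omega)]; ring
  simp only [← hN1, Real.rpow_natCast, finrank_euclideanSpace, Fintype.card_fin, smul_eq_mul]

/-- Gaussian moment. -/
lemma gauss_moment {N : ℕ} (hN : 2 ≤ N) {a : ℝ} (ha : -(N:ℝ) < a) :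
    Integrable (fun x : EN N => Real.exp (-‖x‖^2) * ‖x‖^a) ∧
    ∫ x : EN N, Real.exp (-‖x‖^2) * ‖x‖^a = rad N / 2 * Real.Gamma ((N+a)/2) := by
  have key : ∀ y ∈ Ioi (0:ℝ), y^((N:ℝ)-1) * (Real.exp (-y^2) * y^a) = y^((N:ℝ)-1+a) * Real.exp (- y^(2:ℝ)) := by
    intro y hy
    have hy : 0 < y := hy
    rw [Real.rpow_add hy, Real.rpow_two]; ring
  constructor
  · refine (polar_int hN (fun y => Real.exp (-y^2) * y^a)).2 ?_
    rw [integrableOn_congr_fun key measurableSet_Ioi]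
    exact integrableOn_rpow_mul_exp_neg_rpow (by linarith) two_pos
  · rw [polar hN (fun y => Real.exp (-y^2) * y^a), setIntegral_congr_fun measurableSet_Ioi key,
      integral_rpow_mul_exp_neg_rpow two_pos (by linarith)]
    rw [show (N:ℝ)-1+a+1 = N + a by ring]; ring

/-- Singular radial integral. -/
lemma sing_moment {N : ℕ} (hN : 2 ≤ N) {s b : ℝ} (hs : s ∈ Ioo (0:ℝ) 1) (hb : 0 ≤ b) :
    Integrable (fun x : EN N => (1 - Real.exp (-(b * ‖x‖^2))) / ‖x‖^((N:ℝ)+2*s)) ∧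
    ∫ x : EN N, (1 - Real.exp (-(b * ‖x‖^2))) / ‖x‖^((N:ℝ)+2*s) = rad N / 2 * (-Real.Gamma (-s)) * b^s := by
  obtain ⟨hi, hv⟩ := frullani (σ := s) (a := 0) (b := b) hs.2 hs.1.ne' hb (Or.inr ⟨le_rfl, hs.1⟩)
  have key : ∀ y ∈ Ioi (0:ℝ), y^((N:ℝ)-1) * ((1 - Real.exp (-(b * y^2))) / y^((N:ℝ)+2*s)) =
      2⁻¹ * ((|2| * y^((2:ℝ)-1)) • ((y^(2:ℝ))^(-s-1) * (Real.exp (-(y^(2:ℝ)*0)) - Real.exp (-(y^(2:ℝ)*b))))) := by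
    intro y hy
    have hy : 0 < y := hy
    rw [← Real.rpow_mul hy.le]
    have h1 : y^((N:ℝ)-1) / y^((N:ℝ)+2*s) = y^((2:ℝ)-1) * y^(2*(-s-1)) := by
      rw [← Real.rpow_sub hy, ← Real.rpow_add hy]; congr 1; ring
    have h2 : y^(2:ℝ) = y^2 := Real.rpow_two y
    rw [h2, mul_zero, neg_zero, Real.exp_zero, smul_eq_mul, abs_two]
    calc _ = y^((N:ℝ)-1) / y^((N:ℝ)+2*s) * (1 - Real.exp (-(b * y^2))) := by ring
      _ = _ := by rw [h1, mul_comm b]; ring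
  constructor
  · refine (polar_int hN (fun y => (1 - Real.exp (-(b * y^2))) / y^((N:ℝ)+2*s))).2 ?_
    rw [integrableOn_congr_fun key measurableSet_Ioi]
    exact ((integrableOn_Ioi_comp_rpow_iff _ two_ne_zero).2 hi).const_mul _
  · rw [polar hN (fun y => (1 - Real.exp (-(b * y^2))) / y^((N:ℝ)+2*s)), setIntegral_congr_fun measurableSet_Ioi key,
      integral_const_mul, integral_comp_rpow_Ioi (fun y => y^(-s-1) * (Real.exp (-(y*0)) - Real.exp (-(y*b)))) two_ne_zero, hv,
      Real.zero_rpow hs.1.ne']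
    ring

lemma ae_ne_zero {N : ℕ} (hN : 2 ≤ N) : ∀ᵐ h : EN N, h ≠ 0 := by
  have := nontriv_EN hN
  exact compl_mem_ae_iff.2 (measure_singleton (0:EN N))

/-- Symmetric second difference of the power function. -/
def D2 {N : ℕ} (τ : ℝ) (x h : EN N) : ℝ := 2*‖x‖^τ - ‖x+h‖^τ - ‖x-h‖^τ

/-- Truncated radial kernel. -/
def kr (p ε r : ℝ) : ℝ := if ε ≤ r then (r^p)⁻¹ else 0

lemma kr_nonneg {p ε r : ℝ} (hε : 0 < ε) : 0 ≤ kr p ε r := by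
  unfold kr; split_ifs with h
  · have : 0 ≤ r := hε.le.trans h
    positivity
  · exact le_rfl

lemma kr_le {p ε r : ℝ} (hr : 0 ≤ r) : kr p ε r ≤ (r^p)⁻¹ := by
  unfold kr; split_ifs with h
  · exact le_rfl
  · positivity

lemma kr_meas (p ε : ℝ) : Measurable (kr p ε) := by
  unfold kr
  exact Measurable.ite (measurableSet_le measurable_const measurable_id) (by fun_prop) measurable_const

lemma norm_pow_expand {N : ℕ} {x : EN N} (hx : x ≠ 0) (h : EN N) (τ : ℝ) :
    ‖x+h‖^τ = ‖x‖^τ * (1 + (2*inner ℝ x h + ‖h‖^2)/‖x‖^2)^(τ/2) := by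
  have hx0 : 0 < ‖x‖ := norm_pos_iff.2 hx
  have h1 : 1 + (2*inner ℝ x h + ‖h‖^2)/‖x‖^2 = (‖x+h‖/‖x‖)^2 := by
    rw [div_pow, norm_add_sq_real]; field_simp; ring
  rw [h1, ← Real.rpow_natCast, ← Real.rpow_mul (by positivity), Real.div_rpow (norm_nonneg _) hx0.le]
  push_cast
  rw [show (2:ℝ)*(τ/2) = τ by ring]
  have : 0 < ‖x‖^τ := by positivity
  field_simp

lemma expand_small {N : ℕ} {x h : EN N} (hx : x ≠ 0) (hh : ‖h‖ ≤ ‖x‖/5) :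
    |(2*inner ℝ x h + ‖h‖^2)/‖x‖^2| ≤ 11/5 * (‖h‖/‖x‖) ∧ 11/5 * (‖h‖/‖x‖) ≤ 1/2 := by
  have hx0 : 0 < ‖x‖ := norm_pos_iff.2 hx
  have h1 : |inner ℝ x h| ≤ ‖x‖*‖h‖ := abs_real_inner_le_norm x h
  have h0 := norm_nonneg h
  constructor
  · rw [abs_div, abs_of_nonneg (sq_nonneg ‖x‖), div_le_iff₀ (by positivity)]
    have : 11/5 * (‖h‖/‖x‖) * ‖x‖^2 = 11/5 * (‖h‖ * ‖x‖) := by field_simp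
    rw [this, abs_le]
    obtain ⟨h2, h3⟩ := abs_le.1 h1
    constructor <;> nlinarith
  · rw [← mul_div_assoc, div_le_iff₀ hx0]; linarith

lemma D1_bound (N : ℕ) (τ : ℝ) : ∃ M : ℝ, 0 ≤ M ∧ ∀ x h : EN N, x ≠ 0 → ‖h‖ ≤ ‖x‖/5 →
    |‖x+h‖^τ - ‖x‖^τ| ≤ M * ‖x‖^(τ-1) * ‖h‖ := by
  obtain ⟨M, hM0, hM⟩ := lip1 (τ/2)
  refine ⟨M * (11/5), by positivity, fun x h hx hh => ?_⟩
  have hx0 : 0 < ‖x‖ := norm_pos_iff.2 hx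
  obtain ⟨h1, h2⟩ := expand_small hx hh
  have h3 := hM _ (h1.trans h2)
  rw [norm_pow_expand hx h τ, ← mul_sub_one, abs_mul, abs_of_nonneg (by positivity), Real.rpow_sub_one hx0.ne']
  calc _ ≤ ‖x‖^τ * (M * (11/5 * (‖h‖/‖x‖))) := by gcongr; exact h3.trans (by gcongr)
    _ = _ := by field_simp

lemma D2_bound (N : ℕ) (τ : ℝ) : ∃ M : ℝ, 0 ≤ M ∧ ∀ x h : EN N, x ≠ 0 → ‖h‖ ≤ ‖x‖/5 →
    |D2 τ x h| ≤ M * ‖x‖^(τ-2) * ‖h‖^2 := by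
  obtain ⟨M, hM0, hM⟩ := taylor1 (τ/2)
  refine ⟨M * (11/5)^2 * 2 + |τ|, by positivity, fun x h hx hh => ?_⟩
  have hx0 : 0 < ‖x‖ := norm_pos_iff.2 hx
  obtain ⟨h1, h2⟩ := expand_small hx hh
  obtain ⟨h1', h2'⟩ := expand_small (h := -h) hx (by rwa [norm_neg])
  have h3 := hM _ (h1.trans h2)
  have h3' := hM _ (h1'.trans h2')
  rw [D2, norm_pow_expand hx h τ, sub_eq_add_neg x h, norm_pow_expand hx (-h) τ]
  set a := (2*inner ℝ x h + ‖h‖^2)/‖x‖^2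
  set b := (2*inner ℝ x (-h) + ‖-h‖^2)/‖x‖^2 with hb
  have hab : a + b = 2*‖h‖^2/‖x‖^2 := by
    simp only [a, b, inner_neg_right, norm_neg]; field_simp; ring
  have e1 : 2*‖x‖^τ - ‖x‖^τ * (1+a)^(τ/2) - ‖x‖^τ * (1+b)^(τ/2) =
     -(‖x‖^τ * (((1+a)^(τ/2) - 1 - τ/2*a) + ((1+b)^(τ/2) - 1 - τ/2*b) + τ/2*(a+b))) := by ring
  rw [e1, abs_neg, abs_mul, abs_of_nonneg (by positivity : 0 ≤ ‖x‖^τ)]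
  have ha2 : a^2 ≤ (11/5 * (‖h‖/‖x‖))^2 := by rw [← sq_abs a]; gcongr
  have hb2 : b^2 ≤ (11/5 * (‖h‖/‖x‖))^2 := by rw [← sq_abs b]; rw [norm_neg] at h1'; gcongr
  have h4 : |((1+a)^(τ/2) - 1 - τ/2*a) + ((1+b)^(τ/2) - 1 - τ/2*b) + τ/2*(a+b)| ≤
      M * (11/5 * (‖h‖/‖x‖))^2 + M * (11/5 * (‖h‖/‖x‖))^2 + |τ| * (‖h‖^2/‖x‖^2) := by
    refine (abs_add_le _ _).trans (add_le_add ((abs_add_le _ _).trans (add_le_add (h3.trans (by gcongr)) (h3'.trans (by gcongr)))) ?_)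
    rw [hab, abs_mul, abs_div, abs_two, abs_of_nonneg (by positivity : 0 ≤ 2*‖h‖^2/‖x‖^2)]
    apply le_of_eq; ring
  calc _ ≤ ‖x‖^τ * (M * (11/5 * (‖h‖/‖x‖))^2 + M * (11/5 * (‖h‖/‖x‖))^2 + |τ| * (‖h‖^2/‖x‖^2)) := by gcongr
    _ = _ := by
      rw [show τ - 2 = τ - 1 - 1 by ring, Real.rpow_sub_one hx0.ne', Real.rpow_sub_one hx0.ne']
      field_simp; ring

lemma kr_int {N : ℕ} (hN : 2 ≤ N) {a p ε : ℝ} (ha : -(N:ℝ) < a) (hab : a - p < -(N:ℝ)) (x : EN N) (hε : 0 < ε) :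
    Integrable (fun z : EN N => ‖z‖^a * kr p ε (dist x z)) := by
  have := (integrable_indicator_iff (measSet_dist x ε)).2 (int_ker hN ha hab x hε)
  refine this.congr (Eventually.of_forall fun z => ?_)
  simp only [indicator, kr, mem_ofPred_eq]
  split_ifs <;> simp [div_eq_mul_inv]

lemma kr_int0 {N : ℕ} (hN : 2 ≤ N) {a p ε : ℝ} (ha : -(N:ℝ) < a) (hab : a - p < -(N:ℝ)) (x : EN N) (hε : 0 < ε) :
    Integrable (fun h : EN N => ‖x+h‖^a * kr p ε ‖h‖) := by
  refine ((kr_int hN ha hab x hε).comp_add_left x).congr (Eventually.of_forall fun z => ?_)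
  simp

lemma kr_int1 {N : ℕ} (hN : 2 ≤ N) {p ε : ℝ} (hp : (N:ℝ) < p) (hε : 0 < ε) :
    Integrable (fun h : EN N => kr p ε ‖h‖) := by
  have hN0 : (0:ℝ) < N := by exact_mod_cast (by omega : 0 < N)
  refine ((kr_int0 hN (a := 0) (p := p) (by linarith) (by linarith) 0 hε)).congr (Eventually.of_forall fun z => ?_)
  simp

lemma D2_meas {N : ℕ} (τ : ℝ) : Measurable (fun q : EN N × EN N => D2 τ q.1 q.2) := by
  unfold D2; fun_prop

lemma D2_meas' {N : ℕ} (τ : ℝ) (x : EN N) : Measurable (fun h : EN N => D2 τ x h) := by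
  unfold D2; fun_prop

lemma D2_trunc_int {N : ℕ} (hN : 2 ≤ N) {τ p ε : ℝ} (hτ : -(N:ℝ) < τ) (hτp : τ - p < -(N:ℝ)) (hp : (N:ℝ) < p) (x : EN N) (hε : 0 < ε) :
    Integrable (fun h : EN N => D2 τ x h * kr p ε ‖h‖) := by
  have h1 := kr_int0 hN hτ hτp x hε
  have h2 : Integrable (fun h : EN N => ‖x-h‖^τ * kr p ε ‖h‖) := by
    refine h1.comp_neg.congr (Eventually.of_forall fun z => ?_)
    simp [sub_eq_add_neg]
  have h3 := (kr_int1 hN hp hε).const_mul (2*‖x‖^τ)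
  refine ((h3.sub h1).sub h2).congr (Eventually.of_forall fun z => ?_)
  simp only [D2, Pi.sub_apply]; ring

lemma D2_int {N : ℕ} (hN : 2 ≤ N) {τ s : ℝ} (hs : s ∈ Ioo (0:ℝ) 1) (hτ : -(N:ℝ) < τ) (hτs : τ < 2*s) {x : EN N} (hx : x ≠ 0) :
    Integrable (fun h : EN N => D2 τ x h / ‖h‖^((N:ℝ)+2*s)) := by
  have hx0 : 0 < ‖x‖ := norm_pos_iff.2 hx
  obtain ⟨M, hM0, hM⟩ := D2_bound N τ
  have h1 := D2_trunc_int hN (p := N+2*s) hτ (by linarith) (by linarith [hs.1]) x (show 0 < ‖x‖/5 by positivity)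
  have h2 : Integrable ((ball (0:EN N) (‖x‖/5)).indicator fun h : EN N => M * ‖x‖^(τ-2) * ‖h‖^(2-((N:ℝ)+2*s))) :=
    (integrable_indicator_iff measurableSet_ball).2 ((int_rpow_ball hN (by linarith [hs.2]) _).const_mul _)
  refine (h1.norm.add h2).mono' ((D2_meas' τ x).div (by fun_prop)).aestronglyMeasurable ?_
  filter_upwards [ae_ne_zero hN] with h hh
  have hh0 : 0 < ‖h‖ := norm_pos_iff.2 hh
  simp only [Pi.add_apply]
  by_cases hc : ‖x‖/5 ≤ ‖h‖
  · rw [indicator_of_notMem (by simpa using hc), add_zero, kr, if_pos hc, div_eq_mul_inv]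
  · rw [kr, if_neg hc, mul_zero, norm_zero, zero_add, indicator_of_mem (by simpa using hc), Real.norm_eq_abs, abs_div,
      abs_of_nonneg (by positivity : 0 ≤ ‖h‖^((N:ℝ)+2*s)), Real.rpow_sub hh0, Real.rpow_two, ← mul_div_assoc]
    gcongr
    exact hM x h hx (not_le.1 hc).le

lemma trunc_tendsto {N : ℕ} (hN : 2 ≤ N) {τ s : ℝ} (hs : s ∈ Ioo (0:ℝ) 1) (hτ : -(N:ℝ) < τ) (hτs : τ < 2*s) {x : EN N} (hx : x ≠ 0) :
    Tendsto (fun ε => ∫ h : EN N, D2 τ x h * kr (N+2*s) ε ‖h‖) (𝓝[>] 0) (𝓝 (∫ h : EN N, D2 τ x h / ‖h‖^((N:ℝ)+2*s))) := by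
  refine tendsto_integral_filter_of_dominated_convergence _ ?_ ?_ (D2_int hN hs hτ hτs hx).norm ?_
  · exact Eventually.of_forall fun ε => ((D2_meas' τ x).mul ((kr_meas _ _).comp measurable_norm)).aestronglyMeasurable
  · filter_upwards [self_mem_nhdsWithin] with ε hε
    refine Eventually.of_forall fun h => ?_
    rw [norm_mul, norm_div, div_eq_mul_inv, Real.norm_of_nonneg (kr_nonneg hε), Real.norm_of_nonneg (by positivity : 0 ≤ ‖h‖^((N:ℝ)+2*s))]
    gcongr
    exact kr_le (norm_nonneg _)
  · filter_upwards [ae_ne_zero hN] with h hh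
    have hh0 : 0 < ‖h‖ := norm_pos_iff.2 hh
    refine tendsto_const_nhds.congr' ?_
    have : Iio ‖h‖ ∈ 𝓝[>] (0:ℝ) := mem_nhdsWithin_of_mem_nhds (Iio_mem_nhds hh0)
    filter_upwards [this] with ε hε
    rw [kr, if_pos (le_of_lt hε), div_eq_mul_inv]

/-- truncated fractional Laplacian of the power -/
def JJ (N : ℕ) (p ε τ : ℝ) (x : EN N) : ℝ := ∫ z : EN N, (‖x‖^τ - ‖z‖^τ) * kr p ε (dist x z)

lemma JJ_eq {N : ℕ} (hN : 2 ≤ N) {τ p ε : ℝ} (hτ : -(N:ℝ) < τ) (hτp : τ - p < -(N:ℝ)) (hp : (N:ℝ) < p) (x : EN N) (hε : 0 < ε) :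
    JJ N p ε τ x = 2⁻¹ * ∫ h : EN N, D2 τ x h * kr p ε ‖h‖ := by
  have h1 := kr_int0 hN hτ hτp x hε
  have h3 := (kr_int1 hN hp hε).const_mul (‖x‖^τ)
  have h4 : Integrable (fun h : EN N => (‖x‖^τ - ‖x+h‖^τ) * kr p ε ‖h‖) := by
    refine (h3.sub h1).congr (Eventually.of_forall fun z => ?_)
    simp only [Pi.sub_apply]; ring
  have h5 := h4.comp_neg
  have e1 : JJ N p ε τ x = ∫ h : EN N, (‖x‖^τ - ‖x+h‖^τ) * kr p ε ‖h‖ := by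
    rw [JJ, ← integral_add_left_eq_self _ x]; simp
  have e2 : JJ N p ε τ x = ∫ h : EN N, (‖x‖^τ - ‖x+(-h)‖^τ) * kr p ε ‖-h‖ := by
    rw [e1, ← integral_neg_eq_self]
  have : 2 * JJ N p ε τ x = ∫ h : EN N, D2 τ x h * kr p ε ‖h‖ := by
    rw [two_mul]; nth_rw 1 [e1]; rw [e2, ← integral_add h4 h5]
    congr 1; ext h; rw [norm_neg, D2, sub_eq_add_neg x h]; ring
  rw [← this]; ring

/-- generic homogeneity -/
lemma homog {N : ℕ} (hN : 2 ≤ N) (W : EN N → EN N → ℝ) (q : ℝ)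
    (hL : ∀ (L : EN N ≃ₗᵢ[ℝ] EN N) x h, W (L x) (L h) = W x h)
    (hS : ∀ (l : ℝ) x h, 0 < l → W (l • x) (l • h) = l^q * W x h) {x e : EN N} (hx : x ≠ 0) (he : ‖e‖ = 1) :
    ∫ h, W x h = ‖x‖^(q+N) * ∫ h, W e h := by
  have hx0 : 0 < ‖x‖ := norm_pos_iff.2 hx
  set y : EN N := ‖x‖ • e
  have hy : ‖y‖ = ‖x‖ := by simp [y, norm_smul, he]
  have h1 : ∫ h, W x h = ∫ h, W y h := by
    set L : EN N ≃ₗᵢ[ℝ] EN N := Submodule.reflection (Submodule.span ℝ {x - y})ᗮ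
    have hLx : L x = y := Submodule.reflection_sub hy.symm
    rw [← (L.measurePreserving).integral_comp L.toHomeomorph.measurableEmbedding (fun h => W y h)]
    congr 1; ext h; rw [← hLx, hL]
  have h2 := Measure.integral_comp_smul (volume : Measure (EN N)) (fun h => W y h) ‖x‖
  have h3 : (fun h => W y (‖x‖ • h)) = fun h => ‖x‖^q * W e h := by ext h; exact hS _ _ _ hx0
  rw [h3, integral_const_mul] at h2
  rw [h1, Real.rpow_add hx0, Real.rpow_natCast]
  simp only [finrank_euclideanSpace, Fintype.card_fin, smul_eq_mul] at h2
  rw [abs_of_pos (by positivity)] at h2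
  rw [mul_right_comm, h2]
  field_simp

lemma kr_smul {p a r l : ℝ} (hl : 0 < l) (hr : 0 ≤ r) : kr p (l*a) (l*r) = l^(-p) * kr p a r := by
  unfold kr
  simp only [mul_le_mul_iff_right₀ hl]
  split_ifs
  · rw [Real.mul_rpow hl.le hr, mul_inv, Real.rpow_neg hl.le]
  · simp

lemma D2_rot {N : ℕ} (τ : ℝ) (L : EN N ≃ₗᵢ[ℝ] EN N) (x h : EN N) : D2 τ (L x) (L h) = D2 τ x h := by
  unfold D2; rw [← map_add, ← map_sub]; simp only [LinearIsometryEquiv.norm_map]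

lemma D2_smul {N : ℕ} (τ : ℝ) {l : ℝ} (hl : 0 < l) (x h : EN N) : D2 τ (l • x) (l • h) = l^τ * D2 τ x h := by
  unfold D2; rw [← smul_add, ← smul_sub]
  simp only [norm_smul, Real.norm_of_nonneg hl.le]
  rw [Real.mul_rpow hl.le (norm_nonneg _), Real.mul_rpow hl.le (norm_nonneg _), Real.mul_rpow hl.le (norm_nonneg _)]; ring

lemma KJ_homog {N : ℕ} (hN : 2 ≤ N) (τ s : ℝ) {x e : EN N} (hx : x ≠ 0) (he : ‖e‖ = 1) :
    ∫ h, D2 τ x h / ‖h‖^((N:ℝ)+2*s) = ‖x‖^(τ-2*s) * ∫ h, D2 τ e h / ‖h‖^((N:ℝ)+2*s) := by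
  have := homog hN (fun x h => D2 τ x h / ‖h‖^((N:ℝ)+2*s)) (τ - (N+2*s)) ?_ ?_ hx he
  · rw [show τ - ((N:ℝ)+2*s) + N = τ - 2*s by ring] at this; exact this
  · intro L x h; rw [D2_rot]; simp
  · intro l x h hl
    rw [D2_smul _ hl, norm_smul, Real.norm_of_nonneg hl.le, Real.mul_rpow hl.le (norm_nonneg _), Real.rpow_sub hl]; field_simp

lemma KJ_homog_abs {N : ℕ} (hN : 2 ≤ N) (τ s : ℝ) {x e : EN N} (hx : x ≠ 0) (he : ‖e‖ = 1) :
    ∫ h, |D2 τ x h / ‖h‖^((N:ℝ)+2*s)| = ‖x‖^(τ-2*s) * ∫ h, |D2 τ e h / ‖h‖^((N:ℝ)+2*s)| := by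
  have := homog hN (fun x h => |D2 τ x h / ‖h‖^((N:ℝ)+2*s)|) (τ - (N+2*s)) ?_ ?_ hx he
  · rw [show τ - ((N:ℝ)+2*s) + N = τ - 2*s by ring] at this; exact this
  · intro L x h; rw [D2_rot]; simp
  · intro l x h hl
    have h1 : 0 < l^(τ - (N+2*s)) := by positivity
    rw [← abs_of_pos h1, ← abs_mul]; congr 1
    rw [D2_smul _ hl, norm_smul, Real.norm_of_nonneg hl.le, Real.mul_rpow hl.le (norm_nonneg _), Real.rpow_sub hl]; field_simp

lemma JJ_homog {N : ℕ} (hN : 2 ≤ N) {τ s ε : ℝ} (hs : s ∈ Ioo (0:ℝ) 1) (hτ : -(N:ℝ) < τ) (hτs : τ < 2*s) (hε : 0 < ε) {x e : EN N} (hx : x ≠ 0) (he : ‖e‖ = 1) :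
    JJ N (N+2*s) ε τ x = ‖x‖^(τ-2*s) * JJ N (N+2*s) (ε/‖x‖) τ e := by
  have hx0 : 0 < ‖x‖ := norm_pos_iff.2 hx
  rw [JJ_eq hN hτ (by linarith) (by linarith [hs.1]) x hε, JJ_eq hN hτ (by linarith) (by linarith [hs.1]) e (by positivity)]
  have := homog hN (fun y h => D2 τ y h * kr (N+2*s) (‖y‖*(ε/‖x‖)) ‖h‖) (τ - (N+2*s)) ?_ ?_ hx he
  · rw [show τ - ((N:ℝ)+2*s) + N = τ - 2*s by ring] at this
    rw [mul_div_cancel₀ _ hx0.ne', he, one_mul] at this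
    rw [this]; ring
  · intro L x h; simp only [D2_rot]; simp
  · intro l y h hl
    rw [D2_smul _ hl, norm_smul, norm_smul, Real.norm_of_nonneg hl.le, mul_assoc l, kr_smul hl (norm_nonneg _), Real.rpow_sub hl, Real.rpow_neg hl.le]; ring

lemma gauss_half {N : ℕ} (hN : 2 ≤ N) {a : ℝ} (ha : -(N:ℝ) < a) :
    Integrable (fun x : EN N => Real.exp (-(1/2)*‖x‖^2) * ‖x‖^a) := by
  refine (polar_int hN (fun y => Real.exp (-(1/2)*y^2) * y^a)).2 ?_
  have := integrableOn_rpow_mul_exp_neg_mul_rpow (s := (N:ℝ)-1+a) (p := 2) (b := 1/2) (by linarith) two_pos (by norm_num)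
  refine this.congr_fun (fun y hy => ?_) measurableSet_Ioi
  have hy : 0 < y := hy
  show y^((N:ℝ)-1+a) * Real.exp (-(1/2)*y^(2:ℝ)) = _
  rw [Real.rpow_add hy, Real.rpow_two]; ring

lemma gauss_shift {N : ℕ} (hN : 2 ≤ N) {a : ℝ} (ha : -(N:ℝ) < a) (h : EN N) :
    Integrable (fun x : EN N => Real.exp (-‖x‖^2) * ‖x+h‖^a) := by
  have h1 := (((gauss_half hN ha).comp_add_right h).const_mul (Real.exp (‖h‖^2)))
  refine h1.mono' (Measurable.aestronglyMeasurable (by fun_prop)) (Eventually.of_forall fun x => ?_)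
  rw [Real.norm_of_nonneg (by positivity), ← mul_assoc, ← Real.exp_add]
  gcongr
  have : ‖x+h‖ ≤ ‖x‖+‖h‖ := norm_add_le x h
  nlinarith [sq_nonneg (‖x‖-‖h‖), norm_nonneg (x+h), norm_nonneg x, norm_nonneg h]

lemma gauss_sq {N : ℕ} {u : ℝ} (hu : 0 < u) (h : EN N) :
    ∫ x : EN N, Real.exp (-‖x‖^2) * Real.exp (-(u*‖x+h‖^2)) = (Real.pi/(1+u))^((N:ℝ)/2) * Real.exp (-(u/(1+u)*‖h‖^2)) := by
  have h1 := GaussianFourier.integral_rexp_neg_mul_sq_norm (V := EN N) (b := 1+u) (by positivity)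
  rw [← integral_add_right_eq_self _ ((u/(1+u)) • h)] at h1
  simp only [finrank_euclideanSpace, Fintype.card_fin] at h1
  rw [← h1, ← integral_mul_const]
  congr 1; ext x
  rw [← Real.exp_add, ← Real.exp_add]; congr 1
  rw [norm_add_sq_real, norm_add_sq_real, inner_smul_right, norm_smul, Real.norm_of_nonneg (by positivity)]
  field_simp; ring

lemma frullani' {σ a b : ℝ} (hσ : σ < 1) (hσ0 : σ ≠ 0) (ha : 0 < a) (hb : 0 < b) :
    IntegrableOn (fun u : ℝ => u^(-σ-1) * (Real.exp (-(u*a)) - Real.exp (-(u*b)))) (Ioi 0) ∧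
    ∫ u in Ioi (0:ℝ), u^(-σ-1) * (Real.exp (-(u*a)) - Real.exp (-(u*b))) = Real.Gamma (-σ) * (a^σ - b^σ) ∧
    ∫ u in Ioi (0:ℝ), ‖u^(-σ-1) * (Real.exp (-(u*a)) - Real.exp (-(u*b)))‖ = |Real.Gamma (-σ)| * |a^σ - b^σ| := by
  have key : ∀ a b : ℝ, 0 < a → 0 < b → a ≤ b → IntegrableOn (fun u : ℝ => u^(-σ-1) * (Real.exp (-(u*a)) - Real.exp (-(u*b)))) (Ioi 0) ∧
    ∫ u in Ioi (0:ℝ), u^(-σ-1) * (Real.exp (-(u*a)) - Real.exp (-(u*b))) = Real.Gamma (-σ) * (a^σ - b^σ) ∧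
    ∫ u in Ioi (0:ℝ), ‖u^(-σ-1) * (Real.exp (-(u*a)) - Real.exp (-(u*b)))‖ = |Real.Gamma (-σ)| * |a^σ - b^σ| := by
    intro a b ha hb hab
    obtain ⟨h1, h2⟩ := frullani hσ hσ0 hab (Or.inl ha)
    have hnn : ∀ u ∈ Ioi (0:ℝ), 0 ≤ u^(-σ-1) * (Real.exp (-(u*a)) - Real.exp (-(u*b))) := by
      intro u hu
      have hu : 0 < u := hu
      have : Real.exp (-(u*b)) ≤ Real.exp (-(u*a)) := by gcongr
      have : 0 ≤ Real.exp (-(u*a)) - Real.exp (-(u*b)) := by linarith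
      positivity
    refine ⟨h1, h2, ?_⟩
    rw [setIntegral_congr_fun measurableSet_Ioi (fun u hu => Real.norm_of_nonneg (hnn u hu)), ← abs_mul, ← h2,
      abs_of_nonneg (setIntegral_nonneg measurableSet_Ioi hnn)]
  rcases le_total a b with hab | hab
  · exact key a b ha hb hab
  · obtain ⟨h1, h2, h3⟩ := key b a hb ha hab
    have e : ∀ u : ℝ, u^(-σ-1) * (Real.exp (-(u*a)) - Real.exp (-(u*b))) = -(u^(-σ-1) * (Real.exp (-(u*b)) - Real.exp (-(u*a)))) := fun u => by ring
    simp only [e, norm_neg]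
    refine ⟨h1.neg, ?_, ?_⟩
    · rw [integral_neg, h2]; ring
    · rw [h3, abs_sub_comm]

lemma PG {N : ℕ} (hN : 2 ≤ N) {τ : ℝ} (hτ : -(N:ℝ) < τ) (hτ2 : τ < 2) (hτ0 : τ ≠ 0) (h : EN N) :
    Real.Gamma (-(τ/2)) * ∫ x : EN N, Real.exp (-‖x‖^2) * (‖x‖^τ - ‖x+h‖^τ) =
      ∫ u in Ioi (0:ℝ), u^(-(τ/2)-1) * ((Real.pi/(1+u))^((N:ℝ)/2) * (1 - Real.exp (-(u/(1+u)*‖h‖^2)))) := by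
  set σ := τ/2
  have hσ : σ < 1 := by simp only [σ]; linarith
  have hσ0 : σ ≠ 0 := by simp only [σ]; simpa using hτ0
  have hpow : ∀ z : EN N, (‖z‖^2)^σ = ‖z‖^τ := by
    intro z; rw [← Real.rpow_natCast, ← Real.rpow_mul (norm_nonneg _)]; congr 1; simp only [σ]; push_cast; ring
  have hae : ∀ᵐ x : EN N, x + h ≠ 0 := by
    have := nontriv_EN hN
    have := compl_mem_ae_iff.2 (measure_singleton (μ := (volume : Measure (EN N))) (-h))
    filter_upwards [this] with x hx hx2
    exact hx (eq_neg_of_add_eq_zero_left hx2)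
  have hinteg : Integrable (fun x : EN N => Real.exp (-‖x‖^2) * (‖x‖^τ - ‖x+h‖^τ)) := by
    refine ((gauss_moment hN hτ).1.sub (gauss_shift hN hτ h)).congr (Eventually.of_forall fun x => ?_)
    simp only [Pi.sub_apply]; ring
  have hG : Integrable (fun q : EN N × ℝ => Real.exp (-‖q.1‖^2) * (q.2^(-σ-1) * (Real.exp (-(q.2*‖q.1‖^2)) - Real.exp (-(q.2*‖q.1+h‖^2)))))
      ((volume : Measure (EN N)).prod (volume.restrict (Ioi 0))) := by
    rw [integrable_prod_iff (Measurable.aestronglyMeasurable (by fun_prop))]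
    constructor
    · filter_upwards [hae, ae_ne_zero hN] with x hx hx0
      exact (frullani' hσ hσ0 (by positivity) (by positivity)).1.const_mul _
    · refine (hinteg.norm.const_mul (|Real.Gamma (-σ)|)).congr ?_
      filter_upwards [hae, ae_ne_zero hN] with x hx hx0
      have := (frullani' hσ hσ0 (a := ‖x‖^2) (b := ‖x+h‖^2) (by positivity) (by positivity)).2.2
      simp only [norm_mul (Real.exp _)]
      rw [integral_const_mul, this, hpow, hpow, Real.norm_eq_abs (_ - _)]; ring
  have e1 : Real.Gamma (-σ) * ∫ x : EN N, Real.exp (-‖x‖^2) * (‖x‖^τ - ‖x+h‖^τ) =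
      ∫ x : EN N, ∫ u in Ioi (0:ℝ), Real.exp (-‖x‖^2) * (u^(-σ-1) * (Real.exp (-(u*‖x‖^2)) - Real.exp (-(u*‖x+h‖^2)))) := by
    rw [← integral_const_mul]
    refine integral_congr_ae ?_
    filter_upwards [hae, ae_ne_zero hN] with x hx hx0
    have := (frullani' hσ hσ0 (a := ‖x‖^2) (b := ‖x+h‖^2) (by positivity) (by positivity)).2.1
    rw [integral_const_mul, this, hpow, hpow]; ring
  rw [e1, integral_integral_swap hG]
  refine setIntegral_congr_fun measurableSet_Ioi (fun u hu => ?_)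
  have hu : 0 < u := hu
  have hi : ∀ k : EN N, Integrable (fun x : EN N => Real.exp (-‖x‖^2) * Real.exp (-(u*‖x+k‖^2))) := by
    intro k
    have := (gauss_moment hN (a := 0) (by linarith [show (0:ℝ) < N by exact_mod_cast (by omega : 0 < N)])).1
    refine this.mono' (Measurable.aestronglyMeasurable (by fun_prop)) (Eventually.of_forall fun x => ?_)
    rw [Real.norm_of_nonneg (by positivity), Real.rpow_zero]
    gcongr
    rw [Real.exp_le_one_iff]; have : 0 ≤ u*‖x+k‖^2 := by positivity
    linarith
  have g1 := gauss_sq hu h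
  have g0 := gauss_sq hu (0 : EN N)
  have i0 := hi 0
  simp only [add_zero, norm_zero] at g0 i0
  calc _ = ∫ x : EN N, u^(-σ-1) * (Real.exp (-‖x‖^2) * Real.exp (-(u*‖x‖^2)) - Real.exp (-‖x‖^2) * Real.exp (-(u*‖x+h‖^2))) := by
        congr 1; ext x; ring
    _ = _ := by
        rw [integral_const_mul, integral_sub i0 (hi h), g0, g1]
        simp; left; ring

lemma Gamma_ne {σ : ℝ} (hσ : σ < 1) (hσ0 : σ ≠ 0) : Real.Gamma (-σ) ≠ 0 := by
  refine Real.Gamma_ne_zero (fun m hm => ?_)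
  have h1 : σ = m := by linarith
  rw [h1] at hσ hσ0
  have : m < 1 := by exact_mod_cast hσ
  have : m ≠ 0 := by exact_mod_cast hσ0
  omega

lemma KJ_value {N : ℕ} (hN : 2 ≤ N) {τ s : ℝ} (hs : s ∈ Ioo (0:ℝ) 1) (hτ : 2*s-(N:ℝ) < τ) (hτs : τ < 2*s) {e : EN N} (he : ‖e‖ = 1) :
    CNs N s * (2⁻¹ * ∫ h, D2 τ e h / ‖h‖^((N:ℝ)+2*s)) = csFun N s τ := by
  have hs1 := hs.1
  have hs2 := hs.2
  have he0 : e ≠ 0 := by intro h; rw [h, norm_zero] at he; norm_num at he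
  rcases eq_or_ne τ 0 with h0 | hτ0
  · subst h0; simp [D2, csFun, Real.Gamma_zero, show (2:ℝ)-1-1 = 0 by norm_num]
  set σ := τ/2 with hσdef
  have hσ : σ < 1 := by simp only [σ]; linarith
  have hσ0 : σ ≠ 0 := by simp only [σ]; simpa using hτ0
  have hG0 := Gamma_ne hσ hσ0
  have hτN : -(N:ℝ) < τ := by linarith
  set K := ∫ h, D2 τ e h / ‖h‖^((N:ℝ)+2*s) with hK
  -- first Fubini
  have hF1 : Integrable (fun q : EN N × EN N => Real.exp (-‖q.1‖^2) * (D2 τ q.1 q.2 / ‖q.2‖^((N:ℝ)+2*s))) ((volume : Measure (EN N)).prod (volume : Measure (EN N))) := by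
    have hm : Measurable (fun q : EN N × EN N => Real.exp (-‖q.1‖^2) * (D2 τ q.1 q.2 / ‖q.2‖^((N:ℝ)+2*s))) := by
      unfold D2; fun_prop
    rw [integrable_prod_iff hm.aestronglyMeasurable]
    constructor
    · filter_upwards [ae_ne_zero hN] with x hx
      exact (D2_int hN hs hτN hτs hx).const_mul _
    · refine ((gauss_moment hN (a := τ-2*s) (by linarith)).1.mul_const (∫ h, |D2 τ e h / ‖h‖^((N:ℝ)+2*s)|)).congr ?_
      filter_upwards [ae_ne_zero hN] with x hx
      simp only [norm_mul, Real.norm_of_nonneg (Real.exp_nonneg _)]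
      rw [integral_const_mul]
      simp only [Real.norm_eq_abs]
      rw [KJ_homog_abs hN τ s hx he]; ring
  have e1 : K * (rad N / 2 * Real.Gamma ((N+(τ-2*s))/2)) = ∫ h : EN N, ∫ x : EN N, Real.exp (-‖x‖^2) * (D2 τ x h / ‖h‖^((N:ℝ)+2*s)) := by
    rw [← integral_integral_swap hF1, ← (gauss_moment hN (a := τ-2*s) (by linarith)).2, mul_comm, ← integral_mul_const]
    refine integral_congr_ae ?_
    filter_upwards [ae_ne_zero hN] with x hx
    rw [integral_const_mul, KJ_homog hN τ s hx he]; ring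
  have e2 : ∀ h : EN N, ∫ x : EN N, Real.exp (-‖x‖^2) * (D2 τ x h / ‖h‖^((N:ℝ)+2*s)) =
      2 * (∫ x : EN N, Real.exp (-‖x‖^2) * (‖x‖^τ - ‖x+h‖^τ)) / ‖h‖^((N:ℝ)+2*s) := by
    intro h
    have i1 : Integrable (fun x : EN N => Real.exp (-‖x‖^2) * (‖x‖^τ - ‖x+h‖^τ)) := by
      refine ((gauss_moment hN hτN).1.sub (gauss_shift hN hτN h)).congr (Eventually.of_forall fun x => ?_)
      simp only [Pi.sub_apply]; ring
    have i2 := i1.comp_neg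
    have e3 : ∫ x : EN N, Real.exp (-‖-x‖^2) * (‖-x‖^τ - ‖-x+h‖^τ) = ∫ x : EN N, Real.exp (-‖x‖^2) * (‖x‖^τ - ‖x+h‖^τ) :=
      integral_neg_eq_self (fun x : EN N => Real.exp (-‖x‖^2) * (‖x‖^τ - ‖x+h‖^τ)) volume
    rw [two_mul (∫ x : EN N, Real.exp (-‖x‖^2) * (‖x‖^τ - ‖x+h‖^τ))]; nth_rw 2 [← e3]
    rw [← integral_add i1 i2, div_eq_mul_inv, ← integral_mul_const]
    congr 1; ext x
    rw [show -x+h = -(x-h) by abel, norm_neg, norm_neg, D2]; ring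
  have e3 : Real.Gamma (-σ) * (K * (rad N / 2 * Real.Gamma ((N+(τ-2*s))/2))) =
      2 * ∫ h : EN N, ∫ u in Ioi (0:ℝ), (u^(-σ-1) * (Real.pi/(1+u))^((N:ℝ)/2)) * ((1 - Real.exp (-(u/(1+u)*‖h‖^2))) / ‖h‖^((N:ℝ)+2*s)) := by
    rw [e1, ← integral_const_mul, ← integral_const_mul]
    congr 1; ext h
    rw [e2]
    have := PG hN hτN (by linarith) hτ0 h
    calc _ = 2 * (Real.Gamma (-σ) * ∫ x : EN N, Real.exp (-‖x‖^2) * (‖x‖^τ - ‖x+h‖^τ)) * (‖h‖^((N:ℝ)+2*s))⁻¹ := by ring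
      _ = _ := by
        rw [this, mul_assoc, ← integral_mul_const]; congr 2; ext u; ring
  have hb : ∀ u : ℝ, 0 < u → 0 ≤ u/(1+u) := fun u hu => by positivity
  have hB : ∀ u ∈ Ioi (0:ℝ), (u^(-σ-1) * (Real.pi/(1+u))^((N:ℝ)/2)) * (rad N / 2 * (-Real.Gamma (-s)) * (u/(1+u))^s) =
      (Real.pi^((N:ℝ)/2) * (rad N / 2 * (-Real.Gamma (-s)))) * (u^((s-σ)-1) * (1+u)^(-((s-σ)+(N/2+σ)))) := by
    intro u hu
    have hu : 0 < u := hu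
    have h1 : (0:ℝ) < 1+u := by positivity
    rw [Real.div_rpow Real.pi_pos.le h1.le, Real.div_rpow hu.le h1.le, show s-σ-1 = -σ-1+s by ring, Real.rpow_add hu,
      show -((s-σ)+((N:ℝ)/2+σ)) = -(N/2) - s by ring, Real.rpow_sub h1, Real.rpow_neg h1.le]
    field_simp
  obtain ⟨b1, b2⟩ := beta_Ioi (α := s-σ) (β := N/2+σ) (by simp only [σ]; linarith) (by simp only [σ]; linarith)
  have hF2 : Integrable (fun q : EN N × ℝ => (q.2^(-σ-1) * (Real.pi/(1+q.2))^((N:ℝ)/2)) * ((1 - Real.exp (-(q.2/(1+q.2)*‖q.1‖^2))) / ‖q.1‖^((N:ℝ)+2*s)))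
      ((volume : Measure (EN N)).prod (volume.restrict (Ioi 0))) := by
    rw [integrable_prod_iff' (Measurable.aestronglyMeasurable (by fun_prop))]
    constructor
    · filter_upwards [ae_restrict_mem measurableSet_Ioi] with u hu
      exact (sing_moment hN hs (hb u hu)).1.const_mul _
    · refine (b1.const_mul (Real.pi^((N:ℝ)/2) * (rad N / 2 * (-Real.Gamma (-s))))).congr ?_
      filter_upwards [ae_restrict_mem measurableSet_Ioi] with u hu
      rw [← hB u hu, ← (sing_moment hN hs (hb u hu)).2, ← integral_const_mul]
      have hu' : 0 < u := hu
      congr 1; ext h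
      rw [Real.norm_of_nonneg]
      have : Real.exp (-(u/(1+u)*‖h‖^2)) ≤ 1 := by
        rw [Real.exp_le_one_iff]; have : 0 ≤ u/(1+u)*‖h‖^2 := by positivity
        linarith
      have : 0 ≤ 1 - Real.exp (-(u/(1+u)*‖h‖^2)) := by linarith
      positivity
  have e4 : ∫ h : EN N, ∫ u in Ioi (0:ℝ), (u^(-σ-1) * (Real.pi/(1+u))^((N:ℝ)/2)) * ((1 - Real.exp (-(u/(1+u)*‖h‖^2))) / ‖h‖^((N:ℝ)+2*s)) =
      (Real.pi^((N:ℝ)/2) * (rad N / 2 * (-Real.Gamma (-s)))) * (Real.Gamma (s-σ) * Real.Gamma (N/2+σ) / Real.Gamma (s-σ+(N/2+σ))) := by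
    rw [integral_integral_swap hF2, ← b2, ← integral_const_mul]
    refine setIntegral_congr_fun measurableSet_Ioi (fun u hu => ?_)
    rw [← hB u hu, integral_const_mul, (sing_moment hN hs (hb u hu)).2]
  rw [e4] at e3
  have hr := rad_pos hN
  have g1 : Real.Gamma (1-s) = -s * Real.Gamma (-s) := by
    rw [← Real.Gamma_add_one (neg_ne_zero.2 hs1.ne')]; ring_nf
  have g1' := Gamma_ne hs2 hs1.ne'
  have g2 : 0 < Real.Gamma ((N+(τ-2*s))/2) := Real.Gamma_pos_of_pos (by linarith)
  have g3 : 0 < Real.Gamma ((N + 2*s)/2) := Real.Gamma_pos_of_pos (by positivity)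
  rw [show s-σ+((N:ℝ)/2+σ) = (N+2*s)/2 by ring, show s-σ = (2*s-τ)/2 by simp only [σ]; ring, show (N:ℝ)/2+σ = (N+τ)/2 by simp only [σ]; ring] at e3
  rw [csFun, CNs, show (N:ℝ)-2*s+τ = N+(τ-2*s) by ring, show -τ/2 = -σ by simp only [σ]; ring, g1, show -(N:ℝ)/2 = -(N/2) by ring, Real.rpow_neg Real.pi_pos.le]
  have hpi : 0 < Real.pi^((N:ℝ)/2) := by positivity
  rw [eq_div_iff (mul_ne_zero hG0 g2.ne')]
  field_simp
  field_simp at e3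
  linear_combination (-1) * e3

lemma CNs_pos {N : ℕ} {s : ℝ} (hs : s ∈ Ioo (0:ℝ) 1) : 0 < CNs N s := by
  have h1 := hs.1
  have h2 : 0 < Real.Gamma ((N+2*s)/2) := Real.Gamma_pos_of_pos (by positivity)
  have h3 : 0 < Real.Gamma (1-s) := Real.Gamma_pos_of_pos (by linarith [hs.2])
  have := Real.pi_pos
  unfold CNs; positivity

lemma csFun_symm (N : ℕ) (s τ : ℝ) : csFun N s (2*s-N-τ) = csFun N s τ := by
  unfold csFun
  rw [show (N:ℝ)+(2*s-N-τ) = 2*s-τ by ring, show 2*s-(2*s-N-τ) = N+τ by ring, show -(2*s-N-τ) = N-2*s+τ by ring,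
    show (N:ℝ)-2*s+(2*s-N-τ) = -τ by ring]
  ring

lemma rpow_convex_le {y a b c : ℝ} (hy : 0 < y) {l m : ℝ} (hl : 0 ≤ l) (hm : 0 ≤ m) (hlm : l + m = 1) (hc : c = l*a+m*b) :
    y^c ≤ l*y^a + m*y^b := by
  have := convexOn_exp.2 (mem_univ (Real.log y * a)) (mem_univ (Real.log y * b)) hl hm hlm
  simp only [smul_eq_mul] at this
  rw [Real.rpow_def_of_pos hy, Real.rpow_def_of_pos hy, Real.rpow_def_of_pos hy, hc]
  refine le_trans (le_of_eq ?_) this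
  congr 1; ring

lemma rpow_convex_lt {y a b c : ℝ} (hy : 1 < y) {l m : ℝ} (hl : 0 < l) (hm : 0 < m) (hlm : l + m = 1) (hab : a ≠ b) (hc : c = l*a+m*b) :
    y^c < l*y^a + m*y^b := by
  have hy0 : 0 < y := by linarith
  have hlog : 0 < Real.log y := Real.log_pos hy
  have := strictConvexOn_exp.2 (mem_univ (Real.log y * a)) (mem_univ (Real.log y * b)) (by
    intro h; exact hab (mul_left_cancel₀ hlog.ne' h)) hl hm hlm
  simp only [smul_eq_mul] at this
  rw [Real.rpow_def_of_pos hy0, Real.rpow_def_of_pos hy0, Real.rpow_def_of_pos hy0, hc]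
  refine lt_of_le_of_lt (le_of_eq ?_) this
  congr 1; ring

lemma KJ_concave {N : ℕ} (hN : 2 ≤ N) {a b c l m s : ℝ} (hs : s ∈ Ioo (0:ℝ) 1) (ha : -(N:ℝ) < a) (hab : a < b) (hb : b < 2*s)
    (hl0 : 0 < l) (hm0 : 0 < m) (hlm : l + m = 1) (hc : c = l*a+m*b) {e : EN N} (he : ‖e‖ = 1) :
    l * (∫ h, D2 a e h / ‖h‖^((N:ℝ)+2*s)) + m * (∫ h, D2 b e h / ‖h‖^((N:ℝ)+2*s)) < ∫ h, D2 c e h / ‖h‖^((N:ℝ)+2*s) := by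
  have he0 : e ≠ 0 := by intro h; rw [h, norm_zero] at he; norm_num at he
  have hca : a < c := by
    have : c = a + m*(b-a) := by rw [hc, show l = 1 - m by linarith]; ring
    have : 0 < m*(b-a) := mul_pos hm0 (by linarith)
    linarith
  have hcb : c < b := by
    have : c = b - l*(b-a) := by rw [hc, show l = 1 - m by linarith]; ring
    have : 0 < l*(b-a) := mul_pos hl0 (by linarith)
    linarith
  have i1 := (D2_int hN (τ := b) hs (by linarith) hb he0).const_mul m
  have i2 := (D2_int hN (τ := a) hs (by linarith) (by linarith) he0).const_mul l
  have i0 := D2_int hN (τ := c) hs (by linarith) (by linarith) he0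
  have i3 : Integrable (fun h => l * (D2 a e h / ‖h‖^((N:ℝ)+2*s)) + m * (D2 b e h / ‖h‖^((N:ℝ)+2*s))) := i2.add i1
  have i4 : Integrable (fun h => D2 c e h / ‖h‖^((N:ℝ)+2*s) - (l * (D2 a e h / ‖h‖^((N:ℝ)+2*s)) + m * (D2 b e h / ‖h‖^((N:ℝ)+2*s)))) := i0.sub i3
  have hpos : 0 < ∫ h, (D2 c e h / ‖h‖^((N:ℝ)+2*s) - (l * (D2 a e h / ‖h‖^((N:ℝ)+2*s)) + m * (D2 b e h / ‖h‖^((N:ℝ)+2*s)))) := by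
    have hae : ∀ᵐ h : EN N, e + h ≠ 0 ∧ e - h ≠ 0 := by
      have := nontriv_EN hN
      have h1 := compl_mem_ae_iff.2 (measure_singleton (μ := (volume : Measure (EN N))) (-e))
      have h2 := compl_mem_ae_iff.2 (measure_singleton (μ := (volume : Measure (EN N))) e)
      filter_upwards [h1, h2] with x hx hx2
      refine ⟨fun h => hx (eq_neg_of_add_eq_zero_right h), fun h => hx2 (sub_eq_zero.1 h).symm⟩
    have hform : ∀ h : EN N, D2 c e h / ‖h‖^((N:ℝ)+2*s) - (l * (D2 a e h / ‖h‖^((N:ℝ)+2*s)) + m * (D2 b e h / ‖h‖^((N:ℝ)+2*s))) =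
        ((l*‖e+h‖^a+m*‖e+h‖^b - ‖e+h‖^c) + (l*‖e-h‖^a+m*‖e-h‖^b - ‖e-h‖^c)) / ‖h‖^((N:ℝ)+2*s) := by
      intro h; simp only [D2, he, Real.one_rpow]
      have : m = 1 - l := by linarith
      rw [this]; ring
    refine (integral_pos_iff_support_of_nonneg_ae ?_ i4).2 ?_
    · filter_upwards [hae] with h hh
      rw [hform]
      have h1 := rpow_convex_le (norm_pos_iff.2 hh.1) hl0.le hm0.le hlm hc
      have h2 := rpow_convex_le (norm_pos_iff.2 hh.2) hl0.le hm0.le hlm hc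
      apply div_nonneg _ (by positivity)
      linarith
    · have hb : 0 < volume (ball e (1/2)) := measure_ball_pos _ _ (by norm_num)
      have hsub : ball e (1/2) \ {e} ⊆ Function.support (fun h => D2 c e h / ‖h‖^((N:ℝ)+2*s) - (l * (D2 a e h / ‖h‖^((N:ℝ)+2*s)) + m * (D2 b e h / ‖h‖^((N:ℝ)+2*s)))) := by
        intro h hh
        have hne : e - h ≠ 0 := fun h' => hh.2 (sub_eq_zero.1 h').symm
        have hd : ‖h - e‖ < 1/2 := by rw [← dist_eq_norm]; exact hh.1
        have h1 : 1 < ‖e+h‖ := by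
          have : ‖(2:ℝ)•e‖ ≤ ‖e+h‖ + ‖h-e‖ := by
            have := norm_sub_le (e+h) (h-e)
            rwa [show e+h-(h-e) = (2:ℝ)•e by rw [two_smul]; abel] at this
          rw [norm_smul, he] at this; norm_num at this; linarith
        have hh0 : 0 < ‖h‖ := by
          have := norm_sub_norm_le e h
          rw [norm_sub_rev] at this; linarith
        rw [Function.mem_support, hform]
        have h1 := rpow_convex_lt h1 hl0 hm0 hlm hab.ne hc
        have h2 := rpow_convex_le (norm_pos_iff.2 hne) hl0.le hm0.le hlm hc
        exact (div_pos (by linarith) (by positivity)).ne'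
      refine lt_of_lt_of_le ?_ (measure_mono hsub)
      have := nontriv_EN hN
      rwa [measure_sdiff_null (measure_singleton _)]
  rw [integral_sub i0 i3, integral_add i2 i1, integral_const_mul, integral_const_mul] at hpos
  linarith

lemma KJ_strict {N : ℕ} (hN : 2 ≤ N) {t t' s : ℝ} (hs : s ∈ Ioo (0:ℝ) 1) (ht : (2*s-N)/2 ≤ t) (htt : t < t') (hts : t' < 2*s) {e : EN N} (he : ‖e‖ = 1) :
    (2⁻¹ * ∫ h, D2 t' e h / ‖h‖^((N:ℝ)+2*s)) < 2⁻¹ * ∫ h, D2 t e h / ‖h‖^((N:ℝ)+2*s) := by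
  have hs2 := hs.2
  have hs1 := hs.1
  have hN2 : (2:ℝ) ≤ N := by exact_mod_cast hN
  have hC := CNs_pos (N := N) hs
  set d := min t' ((2*s-N)/4) with hd
  have hd1 : d ≤ t' := min_le_left _ _
  have hd2 : d ≤ (2*s-N)/4 := min_le_right _ _
  have hd3 : (2*s-N)/2 < d := lt_min (by linarith) (by linarith)
  obtain ⟨c, hc⟩ : ∃ c, c = 2*s-N-d := ⟨_, rfl⟩
  have e1 := KJ_value hN (τ := d) hs (by linarith) (by linarith) he
  have e2 := KJ_value hN (τ := c) hs (by linarith) (by linarith) he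
  rw [show csFun N s c = csFun N s d by rw [hc, csFun_symm], ← e1] at e2
  have e3 := mul_left_cancel₀ hC.ne' e2
  set F : ℝ → ℝ := fun τ => ∫ h, D2 τ e h / ‖h‖^((N:ℝ)+2*s) with hF
  have e4 : F c = F d := by simp only [hF]; linarith
  have conc : ∀ y, c < y → y < t' → (t'-y)/(t'-c) * F c + (y-c)/(t'-c) * F t' < F y := by
    intro y h1 h2
    have h3 : 0 < t'-c := by linarith
    exact KJ_concave hN (a := c) (b := t') hs (by linarith) (by linarith) hts (div_pos (by linarith) h3) (div_pos (by linarith) h3)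
      (by field_simp; ring) (by field_simp; ring) he
  have e5 : F t' ≤ F c := by
    rcases eq_or_lt_of_le hd1 with h | h
    · rw [e4, h]
    · have h4 := conc d (by linarith) h
      have h3 : 0 < t'-c := by linarith
      rw [← e4] at h4
      have h5 : (d-c)/(t'-c) * (F t' - F c) < 0 := by
        have : (t'-d)/(t'-c) = 1 - (d-c)/(t'-c) := by field_simp; ring
        rw [this] at h4; linarith
      have h6 : 0 < (d-c)/(t'-c) := div_pos (by linarith) h3
      by_contra hcon
      have : 0 ≤ (d-c)/(t'-c) * (F t' - F c) := mul_nonneg h6.le (by linarith)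
      linarith
  have h4 := conc t (by linarith) htt
  have h3 : 0 < t'-c := by linarith
  have : (t'-t)/(t'-c) = 1 - (t-c)/(t'-c) := by field_simp; ring
  have h6 : 0 < (t'-t)/(t'-c) := div_pos (by linarith) h3
  have h7 : 0 ≤ (t'-t)/(t'-c) * (F c - F t') := mul_nonneg h6.le (by linarith)
  have h8 : F t' < F t := by
    have : (t-c)/(t'-c) = 1 - (t'-t)/(t'-c) := by field_simp; ring
    rw [this] at h4; linarith
  simp only [hF] at h8
  linarith

lemma exists_unit {N : ℕ} (hN : 2 ≤ N) : ∃ e : EN N, ‖e‖ = 1 := by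
  have := nontriv_EN hN
  exact exists_norm_eq (EN N) zero_le_one

/-- the sign estimate (S) -/
lemma sign_est {N : ℕ} (hN : 2 ≤ N) {t δ s : ℝ} (hs : s ∈ Ioo (0:ℝ) 1) (ht : (2*s-N)/2 ≤ t) (hδ : 0 < δ) (hts : t + δ < 2*s) :
    ∃ R c : ℝ, 1 ≤ R ∧ 0 < c ∧ ∀ ε : ℝ, 0 < ε → ∀ x : EN N, R * ε ≤ ‖x‖ →
      c * ‖x‖^(t+δ-2*s) ≤ ‖x‖^δ * JJ N (N+2*s) ε t x - JJ N (N+2*s) ε (t+δ) x := by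
  have hs2 := hs.2
  have hs1 := hs.1
  have hN2 : (2:ℝ) ≤ N := by exact_mod_cast hN
  obtain ⟨e, he⟩ := exists_unit hN
  have he0 : e ≠ 0 := by intro h; rw [h, norm_zero] at he; norm_num at he
  have h1 := KJ_strict hN hs ht (by linarith : t < t + δ) hts he
  have l1 := (trunc_tendsto hN (τ := t) hs (by linarith) (by linarith) he0).const_mul 2⁻¹
  have l2 := (trunc_tendsto hN (τ := t+δ) hs (by linarith) hts he0).const_mul 2⁻¹
  set A := 2⁻¹ * ∫ h, D2 t e h / ‖h‖^((N:ℝ)+2*s)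
  set B := 2⁻¹ * ∫ h, D2 (t+δ) e h / ‖h‖^((N:ℝ)+2*s)
  have l3 := (l1.sub l2).eventually (lt_mem_nhds (show (A-B)/2 < A - B by linarith))
  obtain ⟨η, hη, hη2⟩ := mem_nhdsGT_iff_exists_Ioo_subset.1 l3
  have hη : 0 < η := hη
  refine ⟨max 1 (2/η), (A-B)/2, le_max_left _ _, by linarith, fun ε hε x hx => ?_⟩
  have hx0 : 0 < ‖x‖ := lt_of_lt_of_le (by positivity) hx
  have hxne : x ≠ 0 := norm_pos_iff.1 hx0
  have hr : ε/‖x‖ ∈ Ioo 0 η := by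
    refine ⟨by positivity, ?_⟩
    rw [div_lt_iff₀ hx0]
    have : 2/η*ε ≤ ‖x‖ := le_trans (by gcongr; exact le_max_right _ _) hx
    have h3 : η * (2/η*ε) ≤ η*‖x‖ := by gcongr
    have h4 : η * (2/η*ε) = 2*ε := by field_simp
    linarith
  have h2 := hη2 hr
  simp only [mem_ofPred_eq] at h2
  rw [JJ_homog hN (τ := t) hs (by linarith) (by linarith) hε hxne he, JJ_homog hN (τ := t+δ) hs (by linarith) hts hε hxne he,
    JJ_eq hN (by linarith) (by linarith) (by linarith) e hr.1, JJ_eq hN (by linarith) (by linarith) (by linarith) e hr.1,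
    ← mul_assoc, ← Real.rpow_add hx0, show δ + (t-2*s) = t+δ-2*s by ring]
  have h3 := mul_le_mul_of_nonneg_left h2.le (Real.rpow_nonneg (norm_nonneg x) (t+δ-2*s))
  linarith

/-- weighted truncated kernel -/
def wk {N : ℕ} (p ε t : ℝ) (x z : EN N) : ℝ := ‖z‖^t * kr p ε (dist x z)

def aa {N : ℕ} (p ε t : ℝ) (x : EN N) : ℝ := ∫ z : EN N, wk p ε t x z

def Iop {N : ℕ} (p ε t : ℝ) (b : EN N → ℝ) (x : EN N) : ℝ := ∫ z : EN N, (b x - b z) * wk p ε t x z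

lemma wk_nonneg {N : ℕ} {p ε t : ℝ} (hε : 0 < ε) (x z : EN N) : 0 ≤ wk p ε t x z :=
  mul_nonneg (Real.rpow_nonneg (norm_nonneg _) _) (kr_nonneg hε)

lemma wk_meas {N : ℕ} (p ε t : ℝ) : Measurable (fun q : EN N × EN N => wk p ε t q.1 q.2) := by
  unfold wk
  exact (by fun_prop : Measurable fun q : EN N × EN N => ‖q.2‖^t).mul ((kr_meas p ε).comp (by fun_prop))

lemma wk_meas' {N : ℕ} (p ε t : ℝ) (x : EN N) : Measurable (wk p ε t x) := by
  unfold wk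
  exact (by fun_prop : Measurable fun z : EN N => ‖z‖^t).mul ((kr_meas p ε).comp (by fun_prop))

lemma wk_int {N : ℕ} (hN : 2 ≤ N) {p ε t : ℝ} (ht : -(N:ℝ) < t) (htp : t - p < -(N:ℝ)) (hε : 0 < ε) (x : EN N) :
    Integrable (wk p ε t x) := kr_int hN ht htp x hε

lemma bwk_int {N : ℕ} (hN : 2 ≤ N) {p ε t : ℝ} (ht : -(N:ℝ) < t) (htp : t - p < -(N:ℝ)) (hε : 0 < ε) (x : EN N)
    {b : EN N → ℝ} (hb : Measurable b) {B : ℝ} (hB : ∀ x, |b x| ≤ B) :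
    Integrable (fun z => b z * wk p ε t x z) :=
  (wk_int hN ht htp hε x).bdd_mul hb.aestronglyMeasurable (Eventually.of_forall hB)

lemma Iop_int {N : ℕ} (hN : 2 ≤ N) {p ε t : ℝ} (ht : -(N:ℝ) < t) (htp : t - p < -(N:ℝ)) (hε : 0 < ε) (x : EN N)
    {b : EN N → ℝ} (hb : Measurable b) {B : ℝ} (hB : ∀ x, |b x| ≤ B) :
    Integrable (fun z => (b x - b z) * wk p ε t x z) := by
  refine (((wk_int hN ht htp hε x).const_mul (b x)).sub (bwk_int hN ht htp hε x hb hB)).congr (Eventually.of_forall fun z => ?_)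
  simp only [Pi.sub_apply]; ring

lemma Iop_eq {N : ℕ} (hN : 2 ≤ N) {p ε t : ℝ} (ht : -(N:ℝ) < t) (htp : t - p < -(N:ℝ)) (hε : 0 < ε) (x : EN N)
    {b : EN N → ℝ} (hb : Measurable b) {B : ℝ} (hB : ∀ x, |b x| ≤ B) :
    Iop p ε t b x = b x * aa p ε t x - ∫ z, b z * wk p ε t x z := by
  rw [Iop, aa, ← integral_const_mul, ← integral_sub ((wk_int hN ht htp hε x).const_mul (b x)) (bwk_int hN ht htp hε x hb hB)]
  congr 1; ext z; ring

lemma Iop_sub {N : ℕ} (hN : 2 ≤ N) {p ε t : ℝ} (ht : -(N:ℝ) < t) (htp : t - p < -(N:ℝ)) (hε : 0 < ε) (x : EN N)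
    {b c : EN N → ℝ} (hb : Measurable b) {B : ℝ} (hB : ∀ x, |b x| ≤ B) (hc : Measurable c) {C : ℝ} (hC : ∀ x, |c x| ≤ C) :
    Iop p ε t (fun x => b x - c x) x = Iop p ε t b x - Iop p ε t c x := by
  rw [Iop, Iop, Iop, ← integral_sub (Iop_int hN ht htp hε x hb hB) (Iop_int hN ht htp hε x hc hC)]
  congr 1; ext z; ring

lemma kr_le_eps {p ε r : ℝ} (hp : 0 ≤ p) (hε : 0 < ε) : kr p ε r ≤ (ε^p)⁻¹ := by
  unfold kr; split_ifs with h
  · gcongr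
  · positivity

lemma aa_le {N : ℕ} (hN : 2 ≤ N) {p ε t : ℝ} (hp : 0 ≤ p) (ht : -(N:ℝ) < t) (htp : t - p < -(N:ℝ)) (hε : 0 < ε) (R : ℝ) :
    ∃ A : ℝ, ∀ x : EN N, ‖x‖ ≤ R → aa p ε t x ≤ A := by
  refine ⟨∫ z : EN N, ((1+R)/ε+1)^p * (‖z‖^t * (1+‖z‖)^(-p)), fun x hx => ?_⟩
  have hR : 0 ≤ R := (norm_nonneg x).trans hx
  refine integral_mono (wk_int hN ht htp hε x) ((int_rpow_tail hN ht htp).const_mul _) (fun z => ?_)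
  show wk p ε t x z ≤ _
  unfold wk kr
  split_ifs with h
  · rw [← div_eq_mul_inv]; exact ker_bound hp hε hx h t
  · rw [mul_zero]; positivity

/-- the exterior annulus -/
def ann (N : ℕ) (R : ℝ) : Set (EN N) := {z | 2*R ≤ ‖z‖ ∧ ‖z‖ ≤ 3*R}

lemma ann_meas (N : ℕ) (R : ℝ) : MeasurableSet (ann N R) :=
  (measurableSet_le measurable_const measurable_norm).inter (measurableSet_le measurable_norm measurable_const)

lemma ann_int {N : ℕ} (R t : ℝ) (hR : 0 < R) : IntegrableOn (fun z : EN N => ‖z‖^t) (ann N R) := by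
  have hc : IsCompact (ann N R) := by
    refine Metric.isCompact_of_isClosed_isBounded ?_ ?_
    · exact (isClosed_le continuous_const continuous_norm).inter (isClosed_le continuous_norm continuous_const)
    · refine (isBounded_iff_forall_norm_le.2 ⟨3*R, fun x hx => hx.2⟩)
  refine ContinuousOn.integrableOn_compact hc (continuous_norm.continuousOn.rpow_const fun z hz => Or.inl ?_)
  have := hz.1; intro h; rw [h] at this; linarith

lemma ann_vol_pos {N : ℕ} (hN : 2 ≤ N) {R : ℝ} (hR : 0 < R) : 0 < volume (ann N R) := by
  obtain ⟨e, he⟩ := exists_unit hN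
  have h1 : ball ((5/2*R) • e) (R/2) ⊆ ann N R := by
    intro z hz
    have h2 : ‖z - (5/2*R) • e‖ < R/2 := by rw [← dist_eq_norm]; exact hz
    have h3 : ‖(5/2*R) • e‖ = 5/2*R := by rw [norm_smul, he, Real.norm_of_nonneg (by positivity), mul_one]
    have h4 := abs_le.1 ((abs_norm_sub_norm_le z ((5/2*R) • e)).trans h2.le)
    rw [h3] at h4
    constructor <;> linarith [h4.1, h4.2]
  exact lt_of_lt_of_le (measure_ball_pos _ _ (by positivity)) (measure_mono h1)

lemma ann_integral_pos {N : ℕ} (hN : 2 ≤ N) (t : ℝ) {R : ℝ} (hR : 0 < R) : 0 < ∫ z in ann N R, ‖z‖^t := by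
  rw [setIntegral_pos_iff_support_of_nonneg_ae]
  · refine lt_of_lt_of_le (ann_vol_pos hN hR) (measure_mono fun z hz => ⟨?_, hz⟩)
    have : 0 < ‖z‖ := lt_of_lt_of_le (by positivity) hz.1
    exact (by positivity : 0 < ‖z‖^t).ne'
  · exact Eventually.of_forall fun z => Real.rpow_nonneg (norm_nonneg _) _
  · exact ann_int R t hR

/-- uniform killing -/
lemma kappa {N : ℕ} (hN : 2 ≤ N) {p t R : ℝ} (hp : 0 ≤ p) (ht : -(N:ℝ) < t) (htp : t - p < -(N:ℝ)) (hR : 1 ≤ R) :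
    ∃ κ : ℝ, 0 < κ ∧ ∀ ε : ℝ, 0 < ε → ε ≤ 1 → ∀ x : EN N, ‖x‖ ≤ R → κ ≤ ∫ z in ann N R, wk p ε t x z := by
  refine ⟨∫ z in ann N R, ‖z‖^t * ((4*R)^p)⁻¹, ?_, fun ε hε hε1 x hx => ?_⟩
  · rw [integral_mul_const]; have := ann_integral_pos hN t (by linarith : 0 < R); positivity
  · refine setIntegral_mono_on ((ann_int R t (by linarith)).mul_const _) (wk_int hN ht htp hε x).integrableOn (ann_meas N R) (fun z hz => ?_)
    have h1 : dist x z ≤ 4*R := by rw [dist_eq_norm]; linarith [norm_sub_le x z, hz.2]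
    have h2 : R ≤ dist x z := by
      rw [dist_comm, dist_eq_norm]; linarith [norm_sub_norm_le z x, hz.1]
    unfold wk kr
    rw [if_pos (by linarith)]
    have : 0 < dist x z := by linarith
    gcongr

lemma wk_integral_meas {N : ℕ} (p ε t : ℝ) {b : EN N → ℝ} (hb : Measurable b) :
    Measurable (fun x => ∫ z, b z * wk p ε t x z) := by
  have : Measurable (fun q : EN N × EN N => b q.2 * wk p ε t q.1 q.2) := (hb.comp measurable_snd).mul (wk_meas p ε t)
  exact (this.stronglyMeasurable.integral_prod_right (ν := volume)).measurable

lemma aa_meas {N : ℕ} (p ε t : ℝ) : Measurable (fun x : EN N => aa p ε t x) := by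
  have := wk_integral_meas (N := N) p ε t (b := fun _ => 1) measurable_const
  simpa [aa] using this

/-- the domain misses the annulus: comparison of integrals -/
lemma int_dom_le {N : ℕ} (hN : 2 ≤ N) {p ε t R κ : ℝ} (ht : -(N:ℝ) < t) (htp : t - p < -(N:ℝ)) (hε : 0 < ε)
    {Ω : Set (EN N)} (hΩ : Ω ⊆ ball 0 R) (hR : 1 ≤ R) (x : EN N) (hκ : κ ≤ ∫ z in ann N R, wk p ε t x z)
    {b : EN N → ℝ} (hb : Measurable b) {B : ℝ} (hB : ∀ x, |b x| ≤ B) {W : ℝ} (hW : 0 ≤ W) (hbW : ∀ x, b x ≤ W) (hb0 : ∀ x ∉ Ω, b x ≤ 0) :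
    ∫ z, b z * wk p ε t x z ≤ W * (aa p ε t x - κ) := by
  have i1 := wk_int hN ht htp hε x
  have i2 : Integrable ((ann N R).indicator (wk p ε t x)) := i1.indicator (ann_meas N R)
  have h1 : ∫ z, b z * wk p ε t x z ≤ ∫ z, (W * wk p ε t x z - W * (ann N R).indicator (wk p ε t x) z) := by
    refine integral_mono (bwk_int hN ht htp hε x hb hB) ((i1.const_mul W).sub (i2.const_mul W)) (fun z => ?_)
    have h0 := wk_nonneg (p := p) (t := t) hε x z
    by_cases hz : z ∈ ann N R
    · simp only [indicator_of_mem hz, sub_self]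
      refine mul_nonpos_of_nonpos_of_nonneg (hb0 z (fun hzΩ => ?_)) h0
      have := hΩ hzΩ; rw [mem_ball_zero_iff] at this; linarith [hz.1]
    · simp only [indicator_of_notMem hz, mul_zero, sub_zero]
      exact mul_le_mul_of_nonneg_right (hbW z) h0
  rw [integral_sub (i1.const_mul W) (i2.const_mul W), integral_const_mul, integral_const_mul, integral_indicator (ann_meas N R)] at h1
  have : W * κ ≤ W * ∫ z in ann N R, wk p ε t x z := by gcongr
  simp only [aa]; linarith

lemma max_princ {N : ℕ} (hN : 2 ≤ N) {p ε t R κ : ℝ} (hp : 0 ≤ p) (ht : -(N:ℝ) < t) (htp : t - p < -(N:ℝ)) (hε : 0 < ε)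
    {Ω : Set (EN N)} (hΩ : Ω ⊆ ball 0 R) (hR : 1 ≤ R) (hκ0 : 0 < κ) (hκ : ∀ x : EN N, ‖x‖ ≤ R → κ ≤ ∫ z in ann N R, wk p ε t x z)
    {w : EN N → ℝ} (hw : Measurable w) {B : ℝ} (hB : ∀ x, |w x| ≤ B) (hw0 : ∀ x ∉ Ω, w x ≤ 0) (hI : ∀ x ∈ Ω, Iop p ε t w x ≤ 0) :
    ∀ x, w x ≤ 0 := by
  obtain ⟨A, hA⟩ := aa_le hN hp ht htp hε R
  set W := ⨆ x, max (w x) 0 with hWdef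
  have hbdd : BddAbove (range fun x => max (w x) 0) := by
    refine ⟨max B 0, ?_⟩
    rintro _ ⟨x, rfl⟩
    exact max_le_max_right 0 ((le_abs_self _).trans (hB x))
  have hle : ∀ x, w x ≤ W := fun x => (le_max_left _ _).trans (le_ciSup hbdd x)
  have hW0 : 0 ≤ W := (le_max_right _ _).trans (le_ciSup hbdd 0)
  have haΩ : ∀ x : EN N, ‖x‖ ≤ R → κ ≤ aa p ε t x := fun x hx => (hκ x hx).trans
    (setIntegral_le_integral (wk_int hN ht htp hε x) (Eventually.of_forall fun z => wk_nonneg hε x z))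
  have hAκ : κ ≤ A := (haΩ 0 (by simp; linarith)).trans (hA 0 (by simp; linarith))
  have hA0 : 0 < A := by linarith
  have key : W ≤ W * (1 - κ/A) := by
    refine ciSup_le (fun x => max_le ?_ ?_)
    · by_cases hx : x ∈ Ω
      · have hxR : ‖x‖ ≤ R := by have := hΩ hx; rw [mem_ball_zero_iff] at this; exact this.le
        have h1 := hI x hx
        rw [Iop_eq hN ht htp hε x hw hB] at h1
        have h2 := int_dom_le hN ht htp hε hΩ hR x (hκ x hxR) hw hB hW0 hle hw0
        have ha := haΩ x hxR
        have ha2 := hA x hxR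
        have ha0 : 0 < aa p ε t x := by linarith
        have h3 : w x ≤ W * (1 - κ/aa p ε t x) := by
          have : w x * aa p ε t x ≤ W * (1 - κ/aa p ε t x) * aa p ε t x := by
            have e : W * (1 - κ/aa p ε t x) * aa p ε t x = W * (aa p ε t x - κ) := by field_simp
            rw [e]; linarith
          exact le_of_mul_le_mul_right this ha0
        refine h3.trans (mul_le_mul_of_nonneg_left ?_ hW0)
        have : κ/A ≤ κ/aa p ε t x := by gcongr
        linarith
      · refine (hw0 x hx).trans (mul_nonneg hW0 ?_)
        have : κ/A ≤ 1 := by rw [div_le_one hA0]; exact hAκ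
        linarith
    · refine mul_nonneg hW0 ?_
      have : κ/A ≤ 1 := by rw [div_le_one hA0]; exact hAκ
      linarith
  have : 0 < κ/A := by positivity
  have hWz : W ≤ 0 := by
    by_contra h
    have : 0 < W * (κ/A) := mul_pos (not_le.1 h) this
    linarith
  exact fun x => (hle x).trans hWz

/-- iteration -/
def itS {N : ℕ} (p ε t : ℝ) (Ω : Set (EN N)) (f : EN N → ℝ) : ℕ → EN N → ℝ
  | 0 => fun _ => 0
  | n+1 => Ω.indicator fun x => (f x + ∫ z, itS p ε t Ω f n z * wk p ε t x z) / aa p ε t x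

lemma exist_discrete {N : ℕ} (hN : 2 ≤ N) {p ε t R κ : ℝ} (ht : -(N:ℝ) < t) (htp : t - p < -(N:ℝ)) (hε : 0 < ε)
    {Ω : Set (EN N)} (hΩm : MeasurableSet Ω) (hΩ : Ω ⊆ ball 0 R) (hR : 1 ≤ R) (hκ0 : 0 < κ) (hκ : ∀ x : EN N, ‖x‖ ≤ R → κ ≤ ∫ z in ann N R, wk p ε t x z)
    {f : EN N → ℝ} (hf : Measurable f) (hf0 : ∀ x, 0 ≤ f x) {F : ℝ} (hF : ∀ x, f x ≤ F) :
    ∃ S : EN N → ℝ, Measurable S ∧ (∀ x, 0 ≤ S x) ∧ (∀ x, S x ≤ F/κ) ∧ (∀ x ∉ Ω, S x = 0) ∧ ∀ x ∈ Ω, Iop p ε t S x = f x := by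
  have hF0 : 0 ≤ F := (hf0 0).trans (hF 0)
  have haΩ : ∀ x ∈ Ω, κ ≤ aa p ε t x := fun x hx => by
    have hxR : ‖x‖ ≤ R := by have := hΩ hx; rw [mem_ball_zero_iff] at this; exact this.le
    exact (hκ x hxR).trans (setIntegral_le_integral (wk_int hN ht htp hε x) (Eventually.of_forall fun z => wk_nonneg hε x z))
  have hm : ∀ n, Measurable (itS p ε t Ω f n) := by
    intro n
    induction n with
    | zero => exact measurable_const
    | succ n ih => exact ((hf.add (wk_integral_meas p ε t ih)).div (aa_meas p ε t)).indicator hΩm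
  have hoff : ∀ n, ∀ x ∉ Ω, itS p ε t Ω f n x = 0 := by
    intro n x hx
    cases n with
    | zero => rfl
    | succ n => exact indicator_of_notMem hx _
  have hbd : ∀ n x, 0 ≤ itS p ε t Ω f n x ∧ itS p ε t Ω f n x ≤ F/κ := by
    intro n
    induction n with
    | zero => intro x; exact ⟨le_rfl, by show 0 ≤ _; positivity⟩
    | succ n ih =>
      intro x
      by_cases hx : x ∈ Ω
      · have hxR : ‖x‖ ≤ R := by have := hΩ hx; rw [mem_ball_zero_iff] at this; exact this.le
        have ha := haΩ x hx
        have ha0 : 0 < aa p ε t x := by linarith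
        simp only [itS, indicator_of_mem hx]
        have h1 : 0 ≤ ∫ z, itS p ε t Ω f n z * wk p ε t x z := integral_nonneg fun z => mul_nonneg (ih z).1 (wk_nonneg hε x z)
        have h2 := int_dom_le hN ht htp hε hΩ hR x (hκ x hxR) (hm n) (B := F/κ) (fun x => by rw [abs_of_nonneg (ih x).1]; exact (ih x).2) (by positivity : 0 ≤ F/κ) (fun x => (ih x).2) (fun x hx => (hoff n x hx).le)
        refine ⟨div_nonneg (add_nonneg (hf0 x) h1) ha0.le, ?_⟩
        rw [div_le_iff₀ ha0]
        have : F/κ * (aa p ε t x - κ) = F/κ * aa p ε t x - F := by field_simp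
        linarith [hF x]
      · rw [hoff _ x hx]; exact ⟨le_rfl, by positivity⟩
  have habs : ∀ n x, |itS p ε t Ω f n x| ≤ F/κ := fun n x => by rw [abs_of_nonneg (hbd n x).1]; exact (hbd n x).2
  have hmono : ∀ n x, itS p ε t Ω f n x ≤ itS p ε t Ω f (n+1) x := by
    intro n
    induction n with
    | zero => intro x; exact (hbd 1 x).1
    | succ n ih =>
      intro x
      by_cases hx : x ∈ Ω
      · have ha := haΩ x hx
        have ha0 : 0 < aa p ε t x := by linarith
        rw [itS, itS, indicator_of_mem hx, indicator_of_mem hx]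
        have : ∫ z, itS p ε t Ω f n z * wk p ε t x z ≤ ∫ z, itS p ε t Ω f (n+1) z * wk p ε t x z :=
          integral_mono (bwk_int hN ht htp hε x (hm n) (habs n)) (bwk_int hN ht htp hε x (hm (n+1)) (habs (n+1)))
            (fun z => mul_le_mul_of_nonneg_right (ih z) (wk_nonneg hε x z))
        gcongr
      · rw [hoff _ x hx, hoff _ x hx]
  have hMono : ∀ x, Monotone fun n => itS p ε t Ω f n x := fun x => monotone_nat_of_le_succ fun n => hmono n x
  have hBA : ∀ x, BddAbove (range fun n => itS p ε t Ω f n x) := fun x => ⟨F/κ, by rintro _ ⟨n, rfl⟩; exact (hbd n x).2⟩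
  have hlim : ∀ x, Tendsto (fun n => itS p ε t Ω f n x) atTop (𝓝 (⨆ n, itS p ε t Ω f n x)) := fun x => tendsto_atTop_ciSup (hMono x) (hBA x)
  have hSm : Measurable fun x => ⨆ n, itS p ε t Ω f n x := measurable_of_tendsto_metrizable hm (tendsto_pi_nhds.2 hlim)
  have hS0 : ∀ x, 0 ≤ ⨆ n, itS p ε t Ω f n x := fun x => (hbd 0 x).1.trans (le_ciSup (hBA x) 0)
  have hS1 : ∀ x, ⨆ n, itS p ε t Ω f n x ≤ F/κ := fun x => ciSup_le fun n => (hbd n x).2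
  refine ⟨_, hSm, hS0, hS1, fun x hx => ?_, fun x hx => ?_⟩
  · simp only [fun n => hoff n x hx, ciSup_const]
  · have ha := haΩ x hx
    have ha0 : 0 < aa p ε t x := by linarith
    rw [Iop_eq hN ht htp hε x hSm (B := F/κ) (fun x => by rw [abs_of_nonneg (hS0 x)]; exact hS1 x)]
    have l1 : Tendsto (fun n => ∫ z, itS p ε t Ω f n z * wk p ε t x z) atTop (𝓝 (∫ z, (⨆ n, itS p ε t Ω f n z) * wk p ε t x z)) := by
      refine tendsto_integral_of_dominated_convergence (fun z => F/κ * wk p ε t x z) (fun n => ((hm n).mul (wk_meas' p ε t x)).aestronglyMeasurable)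
        ((wk_int hN ht htp hε x).const_mul _) (fun n => Eventually.of_forall fun z => ?_) (Eventually.of_forall fun z => (hlim z).mul_const _)
      rw [norm_mul, Real.norm_of_nonneg (wk_nonneg hε x z)]
      exact mul_le_mul_of_nonneg_right (habs n z) (wk_nonneg hε x z)
    have l2 := (hlim x).comp (tendsto_add_atTop_nat 1)
    have l3 : Tendsto (fun n => itS p ε t Ω f (n+1) x) atTop (𝓝 ((f x + ∫ z, (⨆ n, itS p ε t Ω f n z) * wk p ε t x z) / aa p ε t x)) := by
      simp only [itS, indicator_of_mem hx]
      exact (l1.const_add _).div_const _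
    have h4 := tendsto_nhds_unique l2 l3
    rw [h4]; field_simp; ring

lemma symm_discrete {N : ℕ} (hN : 2 ≤ N) {p ε t R : ℝ} (hp : 0 ≤ p) (ht : -(N:ℝ) < t) (htp : t - p < -(N:ℝ)) (hε : 0 < ε)
    {Ω : Set (EN N)} (hR : 0 ≤ R) (hΩ : Ω ⊆ ball 0 R)
    {u v : EN N → ℝ} (hu : Measurable u) {U : ℝ} (hU : ∀ x, |u x| ≤ U) (hv : Measurable v) {V : ℝ} (hV : ∀ x, |v x| ≤ V)
    (hu0 : ∀ x ∉ Ω, u x = 0) (hv0 : ∀ x ∉ Ω, v x = 0) :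
    ∫ x, Iop p ε t u x * v x * ‖x‖^t = ∫ x, u x * Iop p ε t v x * ‖x‖^t := by
  have hball : ∀ {w : EN N → ℝ} {W : ℝ}, Measurable w → (∀ x, |w x| ≤ W) → (∀ x ∉ Ω, w x = 0) → Integrable (fun x => w x * ‖x‖^t) := by
    intro w W hw hW hw0
    have h1 : Integrable ((ball (0:EN N) R).indicator fun x => ‖x‖^t) := (integrable_indicator_iff measurableSet_ball).2 (int_rpow_ball hN ht R)
    refine (h1.bdd_mul hw.aestronglyMeasurable (Eventually.of_forall hW)).congr (Eventually.of_forall fun x => ?_)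
    by_cases hx : x ∈ ball (0:EN N) R
    · simp only [indicator_of_mem hx]
    · simp only [hw0 x (fun h => hx (hΩ h)), zero_mul]
  have iu := hball hu hU hu0
  have iv := hball hv hV hv0
  have hkm : Measurable fun q : EN N × EN N => kr p ε (dist q.1 q.2) := (kr_meas p ε).comp (by fun_prop)
  have iuv : Integrable (fun q : EN N × EN N => kr p ε (dist q.1 q.2) * ((v q.1 * ‖q.1‖^t) * (u q.2 * ‖q.2‖^t))) ((volume : Measure (EN N)).prod volume) := by
    refine (iv.mul_prod iu).bdd_mul (c := (ε^p)⁻¹) hkm.aestronglyMeasurable (Eventually.of_forall fun q => ?_)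
    rw [Real.norm_of_nonneg (kr_nonneg hε)]
    exact kr_le_eps hp hε
  have ivu : Integrable (fun q : EN N × EN N => kr p ε (dist q.1 q.2) * ((u q.1 * ‖q.1‖^t) * (v q.2 * ‖q.2‖^t))) ((volume : Measure (EN N)).prod volume) := by
    refine (iu.mul_prod iv).bdd_mul (c := (ε^p)⁻¹) hkm.aestronglyMeasurable (Eventually.of_forall fun q => ?_)
    rw [Real.norm_of_nonneg (kr_nonneg hε)]
    exact kr_le_eps hp hε
  obtain ⟨A, hA⟩ := aa_le hN hp ht htp hε R
  have iuva : Integrable (fun x => u x * v x * aa p ε t x * ‖x‖^t) := by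
    refine hball (W := U*(V*A)) ((hu.mul hv).mul (aa_meas p ε t)) (fun x => ?_) (fun x hx => by rw [hu0 x hx]; ring)
    have hU0 : 0 ≤ U := (abs_nonneg _).trans (hU x)
    have hV0 : 0 ≤ V := (abs_nonneg _).trans (hV x)
    have haa : ∀ x : EN N, 0 ≤ aa p ε t x := fun x => integral_nonneg fun z => wk_nonneg hε x z
    by_cases hx : x ∈ Ω
    · have hxR : ‖x‖ ≤ R := by have := hΩ hx; rw [mem_ball_zero_iff] at this; exact this.le
      rw [mul_assoc, abs_mul, abs_mul, abs_of_nonneg (haa x)]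
      have := hA x hxR
      have := haa x
      exact mul_le_mul (hU x) (mul_le_mul (hV x) (by assumption) (haa x) hV0) (mul_nonneg (abs_nonneg _) (haa x)) hU0
    · have hA0 : 0 ≤ A := (haa 0).trans (hA 0 (by simpa using hR))
      rw [hu0 x hx]; simp only [zero_mul, abs_zero]
      positivity
  have e1 : ∀ x, Iop p ε t u x * v x * ‖x‖^t = u x * v x * aa p ε t x * ‖x‖^t - ∫ z, kr p ε (dist x z) * ((v x * ‖x‖^t) * (u z * ‖z‖^t)) := by
    intro x
    rw [Iop_eq hN ht htp hε x hu hU, sub_mul, sub_mul, mul_assoc (∫ z, _), ← integral_mul_const]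
    congr 1
    · ring
    · congr 1; ext z; unfold wk; ring
  have e2 : ∀ x, u x * Iop p ε t v x * ‖x‖^t = u x * v x * aa p ε t x * ‖x‖^t - ∫ z, kr p ε (dist x z) * ((u x * ‖x‖^t) * (v z * ‖z‖^t)) := by
    intro x
    rw [Iop_eq hN ht htp hε x hv hV, mul_comm (u x), mul_assoc, sub_mul, ← integral_mul_const]
    congr 1
    · ring
    · congr 1; ext z; unfold wk; ring
  simp only [e1, e2]
  rw [integral_sub iuva iuv.integral_prod_left, integral_sub iuva ivu.integral_prod_left, integral_integral_swap iuv]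
  congr 1
  congr 1; ext x; congr 1; ext z; rw [dist_comm]; ring

lemma ann_scale {N : ℕ} (t R : ℝ) {l : ℝ} (hl : 0 < l) :
    ∫ z in ann N (l*R), ‖z‖^t = l^((N:ℝ)+t) * ∫ z in ann N R, ‖z‖^t := by
  have h1 := Measure.integral_comp_smul (volume : Measure (EN N)) ((ann N (l*R)).indicator fun z => ‖z‖^t) l
  rw [integral_indicator (ann_meas N _)] at h1
  have h2 : (fun x : EN N => (ann N (l*R)).indicator (fun z => ‖z‖^t) (l • x)) = fun x => l^t * (ann N R).indicator (fun z => ‖z‖^t) x := by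
    ext x
    have hiff : l • x ∈ ann N (l*R) ↔ x ∈ ann N R := by
      have hn : ‖l • x‖ = l * ‖x‖ := by rw [norm_smul, Real.norm_of_nonneg hl.le]
      show (2*(l*R) ≤ ‖l • x‖ ∧ ‖l • x‖ ≤ 3*(l*R)) ↔ (2*R ≤ ‖x‖ ∧ ‖x‖ ≤ 3*R)
      rw [hn, show 2*(l*R) = l*(2*R) by ring, show 3*(l*R) = l*(3*R) by ring, mul_le_mul_iff_right₀ hl, mul_le_mul_iff_right₀ hl]
    by_cases hx : x ∈ ann N R
    · rw [indicator_of_mem hx, indicator_of_mem (hiff.2 hx), norm_smul, Real.norm_of_nonneg hl.le, Real.mul_rpow hl.le (norm_nonneg _)]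
    · rw [indicator_of_notMem hx, indicator_of_notMem (fun h => hx (hiff.1 h)), mul_zero]
  rw [h2, integral_const_mul, integral_indicator (ann_meas N _)] at h1
  rw [finrank_euclideanSpace_fin, smul_eq_mul, abs_of_pos (by positivity)] at h1
  rw [Real.rpow_add hl, Real.rpow_natCast, mul_assoc, h1]
  field_simp

lemma mdel_int {N : ℕ} (hN : 2 ≤ N) {p ε t δ ρ : ℝ} (ht : -(N:ℝ) < t) (hδ : 0 < δ) (htp : t + δ - p < -(N:ℝ)) (hε : 0 < ε) (hρ : 0 ≤ ρ) (x : EN N) :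
    Integrable (fun z : EN N => (max ‖z‖ ρ)^δ * wk p ε t x z) := by
  have i1 : Integrable (fun z : EN N => ‖z‖^(t+δ) * kr p ε (dist x z) + ρ^δ * wk p ε t x z) :=
    (kr_int hN (by linarith) htp x hε).add ((wk_int hN ht (by linarith) hε x).const_mul _)
  refine i1.mono' ?_ ?_
  · exact ((by fun_prop : Measurable fun z : EN N => (max ‖z‖ ρ)^δ).mul (wk_meas' p ε t x)).aestronglyMeasurable
  · filter_upwards [ae_ne_zero hN] with z hz
    have hz : 0 < ‖z‖ := norm_pos_iff.2 hz
    have hw := wk_nonneg (p := p) (t := t) hε x z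
    rw [Real.norm_of_nonneg (by positivity)]
    have h1 : ‖z‖^(t+δ) * kr p ε (dist x z) = ‖z‖^δ * wk p ε t x z := by
      rw [Real.rpow_add hz, wk]; ring
    rw [h1, ← add_mul]
    refine mul_le_mul_of_nonneg_right ?_ hw
    rcases le_total ‖z‖ ρ with h | h
    · rw [max_eq_right h]; have := Real.rpow_nonneg hz.le δ; linarith
    · rw [max_eq_left h]; have := Real.rpow_nonneg hρ δ; linarith

lemma first_part {N : ℕ} (hN : 2 ≤ N) {s t δ : ℝ} (hs : s ∈ Ioo (0:ℝ) 1) (ht : (2*s-N)/2 ≤ t) (hδ : 0 < δ) (hts : t + δ < 2*s) :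
    ∃ R c : ℝ, 1 ≤ R ∧ 0 < c ∧ ∀ ε > 0, ∀ x : EN N,
      c * (max ‖x‖ (R*ε))^(t+δ-2*s) ≤ ∫ z : EN N, ((max ‖z‖ (R*ε))^δ - (max ‖x‖ (R*ε))^δ) * wk ((N:ℝ)+2*s) ε t x z := by
  obtain ⟨R, c, hR, hc, hsign⟩ := sign_est hN hs ht hδ hts
  have hN2 : (2:ℝ) ≤ N := by exact_mod_cast hN
  have hs0 := hs.1
  have hs1 := hs.2
  have ht' : -(N:ℝ) < t := by linarith
  set p : ℝ := (N:ℝ)+2*s with hp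
  have hA := ann_integral_pos hN t (R := 3/2) (by norm_num)
  set A := ∫ z in ann N (3/2), ‖z‖^t with hAdef
  have h3 : (1:ℝ) < 3^δ := Real.one_lt_rpow (by norm_num) hδ
  have h31 : 0 < (3:ℝ)^δ-1 := by linarith
  refine ⟨R, min c ((3^δ-1) * ((6:ℝ)^p)⁻¹ * A), hR, lt_min hc (by positivity), fun ε hε x => ?_⟩
  set ρ := R*ε with hρ
  have hρ0 : 0 < ρ := by positivity
  have i1 := mdel_int (p := p) hN ht' hδ (by linarith) hε hρ0.le x
  have i2 := wk_int (p := p) hN ht' (by linarith) hε x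
  have i3 : Integrable fun z : EN N => ((max ‖z‖ ρ)^δ - (max ‖x‖ ρ)^δ) * wk p ε t x z := by
    refine (i1.sub (i2.const_mul ((max ‖x‖ ρ)^δ))).congr (Eventually.of_forall fun z => ?_)
    simp only [Pi.sub_apply]; ring
  have hm : 0 < max ‖x‖ ρ := lt_max_of_lt_right hρ0
  rcases le_or_gt ρ ‖x‖ with hx | hx
  · have hx0 : 0 < ‖x‖ := hρ0.trans_le hx
    refine (mul_le_mul_of_nonneg_right (min_le_left _ _) (by positivity)).trans ?_
    have h1 := hsign ε hε x hx
    rw [max_eq_left hx] at i3 ⊢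
    refine h1.trans ?_
    have ik := kr_int1 (N := N) hN (p := p) (by linarith) hε
    have j1 : Integrable fun z : EN N => (‖x‖^t-‖z‖^t)*kr p ε (dist x z) := by
      have e : Integrable fun z : EN N => kr p ε (dist x z) := by
        have := kr_int (a := 0) hN (p := p) (by linarith) (by linarith) x hε
        simpa using this
      refine ((e.const_mul (‖x‖^t)).sub i2).congr (Eventually.of_forall fun z => ?_)
      simp only [Pi.sub_apply, wk]; ring
    have j2 : Integrable fun z : EN N => (‖x‖^(t+δ)-‖z‖^(t+δ))*kr p ε (dist x z) := by
      have e : Integrable fun z : EN N => kr p ε (dist x z) := by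
        have := kr_int (a := 0) hN (p := p) (by linarith) (by linarith) x hε
        simpa using this
      refine ((e.const_mul (‖x‖^(t+δ))).sub (kr_int hN (a := t+δ) (p := p) (by linarith) (by linarith) x hε)).congr (Eventually.of_forall fun z => ?_)
      simp only [Pi.sub_apply]; ring
    unfold JJ
    rw [← integral_const_mul, ← integral_sub (j1.const_mul _) j2]
    refine integral_mono_ae ((j1.const_mul _).sub j2) i3 ?_
    filter_upwards [ae_ne_zero hN] with z hz
    have hz : 0 < ‖z‖ := norm_pos_iff.2 hz
    have hw := wk_nonneg (p := p) (t := t) hε x z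
    have hk := kr_nonneg (p := p) (r := dist x z) hε
    have h2 : ‖x‖^δ*((‖x‖^t-‖z‖^t)*kr p ε (dist x z)) - (‖x‖^(t+δ)-‖z‖^(t+δ))*kr p ε (dist x z) = (‖z‖^δ-‖x‖^δ) * wk p ε t x z := by
      rw [Real.rpow_add hz, Real.rpow_add hx0, wk]; ring
    rw [h2]
    refine mul_le_mul_of_nonneg_right ?_ hw
    have : ‖z‖^δ ≤ (max ‖z‖ ρ)^δ := Real.rpow_le_rpow hz.le (le_max_left _ _) hδ.le
    linarith
  · rw [max_eq_right hx.le] at i3 ⊢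
    refine (mul_le_mul_of_nonneg_right (min_le_right _ _) (by positivity)).trans ?_
    have hpos : ∀ z : EN N, 0 ≤ ((max ‖z‖ ρ)^δ - ρ^δ) * wk p ε t x z := fun z => by
      refine mul_nonneg ?_ (wk_nonneg hε x z)
      have : ρ^δ ≤ (max ‖z‖ ρ)^δ := Real.rpow_le_rpow hρ0.le (le_max_right _ _) hδ.le
      linarith
    refine le_trans ?_ (setIntegral_le_integral (s := ann N (ρ*(3/2))) i3 (Eventually.of_forall hpos))
    have h1 : ∫ z in ann N (ρ*(3/2)), ((3^δ-1)*ρ^δ*((6*ρ)^p)⁻¹) * ‖z‖^t = ((3^δ-1) * ((6:ℝ)^p)⁻¹ * A) * ρ^(t+δ-2*s) := by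
      rw [integral_const_mul, ann_scale t _ hρ0, Real.mul_rpow (by norm_num) hρ0.le, show t+δ-2*s = δ + (N+t) - p by rw [hp]; ring,
        Real.rpow_sub hρ0, Real.rpow_add hρ0 δ]
      field_simp
      exact hAdef.symm
    rw [← h1]
    refine setIntegral_mono_on ((ann_int _ t (by positivity)).const_mul _) i3.integrableOn (ann_meas N _) (fun z hz => ?_)
    have hz1 : 3*ρ ≤ ‖z‖ := by linarith [hz.1]
    have hz2 : ‖z‖ ≤ 9/2*ρ := by linarith [hz.2]
    have hd1 : dist x z ≤ 6*ρ := by rw [dist_eq_norm]; linarith [norm_sub_le x z]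
    have hd2 : ε ≤ dist x z := by
      rw [dist_comm, dist_eq_norm]
      have : ε ≤ ρ := by rw [hρ]; nlinarith
      linarith [norm_sub_norm_le z x]
    have hd3 : 0 < dist x z := hε.trans_le hd2
    unfold wk kr
    rw [if_pos hd2, max_eq_left (by linarith)]
    have h5 : (3:ℝ)^δ*ρ^δ ≤ ‖z‖^δ := by
      rw [← Real.mul_rpow (by norm_num) hρ0.le]; exact Real.rpow_le_rpow (by positivity) hz1 hδ.le
    have h6 : ((6*ρ)^p)⁻¹ ≤ (dist x z^p)⁻¹ := by
      have : 0 ≤ p := by linarith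
      gcongr
    have h7 : (3^δ-1)*ρ^δ ≤ ‖z‖^δ-ρ^δ := by linarith
    have h8 : 0 ≤ (3^δ-1)*ρ^δ := mul_nonneg (by linarith) (by positivity)
    calc (3^δ-1)*ρ^δ*((6*ρ)^p)⁻¹ * ‖z‖^t ≤ (‖z‖^δ-ρ^δ)*(dist x z^p)⁻¹ * ‖z‖^t := by
          gcongr
          exact h8.trans h7
      _ = _ := by ring

lemma barrier1 {N : ℕ} (hN : 2 ≤ N) {s t δ R0 : ℝ} (hs : s ∈ Ioo (0:ℝ) 1) (ht : (2*s-N)/2 ≤ t) (hδ : 0 < δ) (hts : t + δ < 2*s) (hR0 : 1 ≤ R0) :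
    ∃ R c K : ℝ, 1 ≤ R ∧ 0 < c ∧ 0 ≤ K ∧ ∀ ε > 0, ε ≤ 1 → R*ε ≤ 1 → ∀ Ω : Set (EN N), MeasurableSet Ω → Ω ⊆ ball 0 R0 →
      ∃ b : EN N → ℝ, Measurable b ∧ (∀ x, 0 ≤ b x) ∧ (∀ x, b x ≤ K) ∧ (∀ x ∉ Ω, b x = 0) ∧
        ∀ x ∈ Ω, c * (max ‖x‖ (R*ε))^(t+δ-2*s) ≤ Iop ((N:ℝ)+2*s) ε t b x := by
  obtain ⟨R, c, hR, hc, hfirst⟩ := first_part hN hs ht hδ hts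
  have hN2 : (2:ℝ) ≤ N := by exact_mod_cast hN
  have hs0 := hs.1
  have hs1 := hs.2
  have ht' : -(N:ℝ) < t := by linarith
  set p : ℝ := (N:ℝ)+2*s with hp
  have hp0 : 0 ≤ p := by linarith
  obtain ⟨κ, hκ0, hκ⟩ := kappa hN (p := p) (t := t) hp0 ht' (by linarith) hR0
  have iH : Integrable fun z : EN N => ((1+R0)/1+1)^p*(‖z‖^(t+δ)*(1+‖z‖)^(-p)) := (int_rpow_tail hN (by linarith) (by linarith)).const_mul _
  set H : EN N → ℝ := fun z => ((1+R0)/1+1)^p*(‖z‖^(t+δ)*(1+‖z‖)^(-p)) with hH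
  have hH0 : ∀ z, 0 ≤ H z := fun z => by
    simp only [hH]; positivity
  set Q := ∫ z, H z with hQ
  have hQ0 : 0 ≤ Q := integral_nonneg hH0
  set K := (2*R0)^δ + Q/κ with hK
  have hK0 : 0 ≤ K := by positivity
  refine ⟨R, c, K, hR, hc, hK0, fun ε hε hε1 hRε Ω hΩm hΩ => ?_⟩
  set ρ := R*ε with hρ
  have hρ0 : 0 < ρ := by positivity
  have hmK : ∀ x : EN N, ‖x‖ ≤ 2*R0 → (max ‖x‖ ρ)^δ ≤ (2*R0)^δ := fun x hx =>
    Real.rpow_le_rpow (by positivity) (max_le hx (by linarith)) hδ.le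
  have hQκ : 0 ≤ Q/κ := by positivity
  have hnn : ∀ x ∈ Ω, ‖x‖ ≤ R0 := fun x hx => by have := hΩ hx; rw [mem_ball_zero_iff] at this; exact this.le
  have hbm : Measurable (Ω.indicator fun x : EN N => K - (max ‖x‖ ρ)^δ) := (by fun_prop : Measurable fun x : EN N => K - (max ‖x‖ ρ)^δ).indicator hΩm
  have hb0 : ∀ x, 0 ≤ Ω.indicator (fun x : EN N => K - (max ‖x‖ ρ)^δ) x := fun x => by
    refine indicator_nonneg (fun x hx => ?_) x
    have := hmK x (by linarith [hnn x hx]); linarith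
  have hbK : ∀ x, Ω.indicator (fun x : EN N => K - (max ‖x‖ ρ)^δ) x ≤ K := fun x => by
    refine indicator_apply_le' (fun _ => ?_) (fun _ => hK0)
    have : 0 ≤ (max ‖x‖ ρ)^δ := by positivity
    linarith
  refine ⟨_, hbm, hb0, hbK, fun x hx => indicator_of_notMem hx _, fun x hx => (hfirst ε hε x).trans ?_⟩
  set b := Ω.indicator (fun x : EN N => K - (max ‖x‖ ρ)^δ) with hb
  have i1 := mdel_int (p := p) hN ht' hδ (by linarith) hε hρ0.le x
  have i2 := wk_int (p := p) hN ht' (by linarith) hε x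
  have i3 : Integrable fun z : EN N => ((max ‖z‖ ρ)^δ - (max ‖x‖ ρ)^δ) * wk p ε t x z := by
    refine (i1.sub (i2.const_mul ((max ‖x‖ ρ)^δ))).congr (Eventually.of_forall fun z => ?_)
    simp only [Pi.sub_apply]; ring
  have i4 : Integrable ((ann N R0).indicator (wk p ε t x)) := i2.indicator (ann_meas N R0)
  have ib := Iop_int (p := p) hN ht' (by linarith) hε x hbm (B := K) (fun x => by rw [abs_of_nonneg (hb0 x)]; exact hbK x)
  have hx1 := hnn x hx
  have key : ∫ z : EN N, (((max ‖z‖ ρ)^δ - (max ‖x‖ ρ)^δ) * wk p ε t x z + (Q/κ) * (ann N R0).indicator (wk p ε t x) z - H z) ≤ Iop p ε t b x := by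
    refine integral_mono_ae ((i3.add (i4.const_mul _)).sub iH) ib ?_
    filter_upwards [ae_ne_zero hN] with z hz
    have hz : 0 < ‖z‖ := norm_pos_iff.2 hz
    have hw := wk_nonneg (p := p) (t := t) hε x z
    have hbx : b x = K - (max ‖x‖ ρ)^δ := indicator_of_mem hx _
    by_cases hzΩ : z ∈ Ω
    · have hbz : b z = K - (max ‖z‖ ρ)^δ := indicator_of_mem hzΩ _
      have hza : z ∉ ann N R0 := fun h => by linarith [h.1, hnn z hzΩ]
      rw [indicator_of_notMem hza, hbx, hbz]
      linarith [hH0 z]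
    · have hbz : b z = 0 := indicator_of_notMem hzΩ _
      rw [hbx, hbz]
      rcases lt_or_ge ‖z‖ (2*R0) with h | h
      · have hza : z ∉ ann N R0 := fun h' => by linarith [h'.1]
        rw [indicator_of_notMem hza]
        have := mul_nonneg (by linarith [hmK z h.le] : 0 ≤ K - (max ‖z‖ ρ)^δ) hw
        linarith [hH0 z]
      · have h1 : (Q/κ) * (ann N R0).indicator (wk p ε t x) z ≤ K * wk p ε t x z := by
          refine mul_le_mul ?_ (indicator_le_self' (fun _ _ => wk_nonneg hε _ _) z) (indicator_nonneg (fun _ _ => wk_nonneg hε _ _) z) hK0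
          have : 0 ≤ (2*R0)^δ := by positivity
          linarith
        have hd : 1 ≤ dist x z := by
          rw [dist_comm, dist_eq_norm]; linarith [norm_sub_norm_le z x]
        have h2 : ‖z‖^δ * wk p ε t x z ≤ H z := by
          have := ker_bound hp0 one_pos hx1 hd (t+δ)
          refine le_trans (le_of_eq ?_) this
          unfold wk kr
          rw [if_pos (hε1.trans hd), Real.rpow_add hz]
          field_simp
        rw [max_eq_left (by linarith : ρ ≤ ‖z‖)]
        linarith
  refine le_trans ?_ key
  have i34 : Integrable fun z : EN N => ((max ‖z‖ ρ)^δ - (max ‖x‖ ρ)^δ) * wk p ε t x z + (Q/κ) * (ann N R0).indicator (wk p ε t x) z := i3.add (i4.const_mul _)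
  rw [integral_sub i34 iH, integral_add i3 (i4.const_mul _), integral_const_mul, integral_indicator (ann_meas N R0)]
  have := mul_le_mul_of_nonneg_left (hκ ε hε hε1 x hx1) hQκ
  rw [div_mul_cancel₀ _ hκ0.ne'] at this
  linarith

lemma energy1 {N : ℕ} (hN : 2 ≤ N) {s t δ R0 : ℝ} (hs : s ∈ Ioo (0:ℝ) 1) (ht : (2*s-N)/2 ≤ t) (hδ : 0 < δ) (hts : t + δ < 2*s) (hR0 : 1 ≤ R0) :
    ∃ R C : ℝ, 1 ≤ R ∧ 0 ≤ C ∧ ∀ ε > 0, ε ≤ 1 → R*ε ≤ 1 → ∀ Ω : Set (EN N), MeasurableSet Ω → Ω ⊆ ball 0 R0 →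
      ∀ (S f : EN N → ℝ) (B : ℝ), Measurable S → (∀ x, 0 ≤ S x) → (∀ x, S x ≤ B) → (∀ x ∉ Ω, S x = 0) → (∀ x, 0 ≤ f x) →
        IntegrableOn (fun x => f x * ‖x‖^t) Ω → (∀ x ∈ Ω, Iop ((N:ℝ)+2*s) ε t S x = f x) →
        Integrable (fun x => S x * ‖x‖^t * (max ‖x‖ (R*ε))^(t+δ-2*s)) ∧
        ∫ x, S x * ‖x‖^t * (max ‖x‖ (R*ε))^(t+δ-2*s) ≤ C * ∫ x in Ω, f x * ‖x‖^t := by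
  obtain ⟨R, c, K, hR, hc, hK, hbar⟩ := barrier1 hN hs ht hδ hts hR0
  have hN2 : (2:ℝ) ≤ N := by exact_mod_cast hN
  have hs0 := hs.1
  have hs1 := hs.2
  have ht' : -(N:ℝ) < t := by linarith
  set p : ℝ := (N:ℝ)+2*s with hp
  have hp0 : 0 ≤ p := by linarith
  refine ⟨R, K/c, hR, by positivity, fun ε hε hε1 hRε Ω hΩm hΩ S f B hSm hS0 hSB hSΩ hf0 hfi hI => ?_⟩
  obtain ⟨b, hbm, hb0, hbK, hbΩ, hbI⟩ := hbar ε hε hε1 hRε Ω hΩm hΩ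
  set ρ := R*ε with hρ
  have hρ0 : 0 < ρ := by positivity
  have hball : ∀ {w : EN N → ℝ} {W : ℝ}, Measurable w → (∀ x, |w x| ≤ W) → (∀ x ∉ Ω, w x = 0) → Integrable (fun x => w x * ‖x‖^t) := by
    intro w W hw hW hw0
    have h1 : Integrable ((ball (0:EN N) R0).indicator fun x => ‖x‖^t) := (integrable_indicator_iff measurableSet_ball).2 (int_rpow_ball hN ht' R0)
    refine (h1.bdd_mul hw.aestronglyMeasurable (Eventually.of_forall hW)).congr (Eventually.of_forall fun x => ?_)
    by_cases hx : x ∈ ball (0:EN N) R0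
    · simp only [indicator_of_mem hx]
    · simp only [hw0 x (fun h => hx (hΩ h)), zero_mul]
  have hBn : 0 ≤ B := (hS0 0).trans (hSB 0)
  have hSa : ∀ x, |S x| ≤ B := fun x => by rw [abs_of_nonneg (hS0 x)]; exact hSB x
  have hba : ∀ x, |b x| ≤ K := fun x => by rw [abs_of_nonneg (hb0 x)]; exact hbK x
  have hmb : ∀ x : EN N, (max ‖x‖ ρ)^(t+δ-2*s) ≤ ρ^(t+δ-2*s) := fun x =>
    Real.rpow_le_rpow_of_nonpos hρ0 (le_max_right _ _) (by linarith)
  have hmp : ∀ x : EN N, 0 ≤ (max ‖x‖ ρ)^(t+δ-2*s) := fun x => by positivity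
  have iS : Integrable (fun x => S x * ‖x‖^t * (max ‖x‖ ρ)^(t+δ-2*s)) := by
    have := hball (w := fun x => S x * (max ‖x‖ ρ)^(t+δ-2*s)) (W := B * ρ^(t+δ-2*s)) (hSm.mul (by fun_prop)) (fun x => ?_) (fun x hx => by rw [hSΩ x hx, zero_mul])
    · refine this.congr (Eventually.of_forall fun x => ?_)
      simp only; ring
    · rw [abs_of_nonneg (mul_nonneg (hS0 x) (hmp x))]
      exact mul_le_mul (hSB x) (hmb x) (hmp x) hBn
  refine ⟨iS, ?_⟩
  have hsym := symm_discrete hN hp0 ht' (by linarith : t - p < -(N:ℝ)) hε (by linarith : 0 ≤ R0) hΩ hSm hSa hbm hba hSΩ hbΩ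
  have hL : ∫ x, Iop p ε t S x * b x * ‖x‖^t ≤ K * ∫ x in Ω, f x * ‖x‖^t := by
    rw [← integral_const_mul, ← integral_indicator hΩm]
    refine integral_mono_of_nonneg (Eventually.of_forall fun x => ?_) ((integrable_indicator_iff hΩm).2 (hfi.const_mul K)) (Eventually.of_forall fun x => ?_)
    · by_cases hx : x ∈ Ω
      · simp only [hI x hx, Pi.zero_apply]; have := hf0 x; have := hb0 x; positivity
      · simp only [hbΩ x hx, Pi.zero_apply]; simp
    · by_cases hx : x ∈ Ω
      · simp only [hI x hx, indicator_of_mem hx]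
        have h1 := hf0 x; have h2 := hbK x
        calc f x * b x * ‖x‖^t ≤ f x * K * ‖x‖^t := by gcongr
          _ = _ := by ring
      · simp only [hbΩ x hx, indicator_of_notMem hx]; simp
  have hRi : Integrable fun x => S x * Iop p ε t b x * ‖x‖^t := by
    obtain ⟨A, hA⟩ := aa_le hN hp0 ht' (by linarith : t - p < -(N:ℝ)) hε R0
    have haa : ∀ x : EN N, 0 ≤ aa p ε t x := fun x => integral_nonneg fun z => wk_nonneg hε x z
    have hA0 : 0 ≤ A := (haa 0).trans (hA 0 (by simp; linarith))
    have hmeas : Measurable fun x => Iop p ε t b x := by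
      have : (fun x => Iop p ε t b x) = fun x => b x * aa p ε t x - ∫ z, b z * wk p ε t x z := by
        ext x; exact Iop_eq hN ht' (by linarith) hε x hbm hba
      rw [this]
      exact (hbm.mul (aa_meas p ε t)).sub (wk_integral_meas p ε t hbm)
    refine hball (w := fun x => S x * Iop p ε t b x) (W := B * (K*A)) (hSm.mul hmeas) (fun x => ?_) (fun x hx => by rw [hSΩ x hx, zero_mul])
    by_cases hx : x ∈ Ω
    · have hx1 : ‖x‖ ≤ R0 := by have := hΩ hx; rw [mem_ball_zero_iff] at this; exact this.le
      rw [abs_mul]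
      refine mul_le_mul (hSa x) ?_ (abs_nonneg _) hBn
      unfold Iop
      refine (abs_integral_le_integral_abs).trans ?_
      calc ∫ z, |(b x - b z) * wk p ε t x z| ≤ ∫ z, K * wk p ε t x z := by
            refine integral_mono_of_nonneg (Eventually.of_forall fun z => abs_nonneg _) ((wk_int hN ht' (by linarith) hε x).const_mul K) (Eventually.of_forall fun z => ?_)
            simp only
            rw [abs_mul, abs_of_nonneg (wk_nonneg hε x z)]
            refine mul_le_mul_of_nonneg_right ?_ (wk_nonneg hε x z)
            rw [abs_le]; constructor <;> linarith [hb0 x, hb0 z, hbK x, hbK z]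
        _ = K * aa p ε t x := by rw [integral_const_mul, aa]
        _ ≤ K * A := by gcongr; exact hA x hx1
    · rw [hSΩ x hx, zero_mul, abs_zero]; positivity
  have hlow : c * ∫ x, S x * ‖x‖^t * (max ‖x‖ ρ)^(t+δ-2*s) ≤ ∫ x, S x * Iop p ε t b x * ‖x‖^t := by
    rw [← integral_const_mul]
    refine integral_mono (iS.const_mul c) hRi (fun x => ?_)
    by_cases hx : x ∈ Ω
    · have := hbI x hx
      have h1 : 0 ≤ S x * ‖x‖^t := mul_nonneg (hS0 x) (by positivity)
      have := mul_le_mul_of_nonneg_left this h1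
      simp only
      linarith
    · simp only [hSΩ x hx]; simp
  rw [div_mul_eq_mul_div, le_div_iff₀ hc]
  linarith

lemma pow_bd (a : ℝ) {r R : ℝ} (hr : 0 < r) (hrR : r ≤ R) : ∃ lo hi : ℝ, 0 < lo ∧ 0 ≤ hi ∧ ∀ y, r ≤ y → y ≤ R → lo ≤ y^a ∧ y^a ≤ hi := by
  have hR : 0 < R := hr.trans_le hrR
  rcases le_total 0 a with ha | ha
  · refine ⟨r^a, R^a, by positivity, by positivity, fun y h1 h2 => ⟨?_, ?_⟩⟩
    · exact Real.rpow_le_rpow hr.le h1 ha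
    · exact Real.rpow_le_rpow (hr.le.trans h1) h2 ha
  · refine ⟨R^a, r^a, by positivity, by positivity, fun y h1 h2 => ⟨?_, ?_⟩⟩
    · exact Real.rpow_le_rpow_of_nonpos (hr.trans_le h1) h2 ha
    · exact Real.rpow_le_rpow_of_nonpos hr h1 ha

lemma ball_scale {N : ℕ} (t : ℝ) {l : ℝ} (hl : 0 < l) :
    ∫ z in ball (0:EN N) l, ‖z‖^t = l^((N:ℝ)+t) * ∫ z in ball (0:EN N) 1, ‖z‖^t := by
  have h1 := Measure.integral_comp_smul (volume : Measure (EN N)) ((ball (0:EN N) l).indicator fun z => ‖z‖^t) l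
  rw [integral_indicator measurableSet_ball] at h1
  have h2 : (fun x : EN N => (ball (0:EN N) l).indicator (fun z => ‖z‖^t) (l • x)) = fun x => l^t * (ball (0:EN N) 1).indicator (fun z => ‖z‖^t) x := by
    ext x
    have hiff : l • x ∈ ball (0:EN N) l ↔ x ∈ ball (0:EN N) 1 := by
      have hn : ‖l • x‖ = l * ‖x‖ := by rw [norm_smul, Real.norm_of_nonneg hl.le]
      rw [mem_ball_zero_iff, mem_ball_zero_iff, hn]
      constructor <;> intro h <;> nlinarith
    by_cases hx : x ∈ ball (0:EN N) 1
    · rw [indicator_of_mem hx, indicator_of_mem (hiff.2 hx), norm_smul, Real.norm_of_nonneg hl.le, Real.mul_rpow hl.le (norm_nonneg _)]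
    · rw [indicator_of_notMem hx, indicator_of_notMem (fun h => hx (hiff.1 h)), mul_zero]
  rw [h2, integral_const_mul, integral_indicator measurableSet_ball] at h1
  rw [finrank_euclideanSpace_fin, smul_eq_mul, abs_of_pos (by positivity)] at h1
  rw [Real.rpow_add hl, Real.rpow_natCast, mul_assoc, h1]
  field_simp

set_option maxHeartbeats 1000000 in
lemma inner_pt (N : ℕ) (t α : ℝ) {r R : ℝ} (hr : 0 < r) (hrR : r ≤ R) :
    ∃ C : ℝ, 0 ≤ C ∧ ∀ x0 x h : EN N, ‖x-x0‖ < r → r ≤ ‖x‖ → ‖x‖ ≤ R → ‖h‖ ≤ (r^2-‖x-x0‖^2)/(8*r) →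
      |((r^2-‖x-x0‖^2)^α - (r^2-‖x+h-x0‖^2)^α) * ‖x+h‖^t + ((r^2-‖x-x0‖^2)^α - (r^2-‖x-h-x0‖^2)^α) * ‖x-h‖^t|
        ≤ C * (r^2-‖x-x0‖^2)^(α-2) * ‖h‖^2 := by
  obtain ⟨M1, hM1, h1⟩ := lip1 α
  obtain ⟨M2, hM2, h2⟩ := taylor1 α
  obtain ⟨M3, hM3, h3⟩ := D1_bound N t
  obtain ⟨_, G, _, hG, hGb⟩ := pow_bd t hr hrR
  obtain ⟨_, G', _, hG', hGb'⟩ := pow_bd (t-1) hr hrR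
  refine ⟨(2*|α| * r^2 + 18*M2*r^2)*G + 2*(3*M1*r*r^2)*(M3*G'), by positivity, fun x0 x h hx hxr hxR hh => ?_⟩
  set q := r^2-‖x-x0‖^2 with hq
  have hq0 : 0 < q := by have := norm_nonneg (x-x0); nlinarith
  have hqr : q ≤ r^2 := by nlinarith [sq_nonneg ‖x-x0‖]
  have hh' : ‖h‖ * (8*r) ≤ q := by rwa [le_div_iff₀ (by positivity)] at hh
  have hhr : ‖h‖ ≤ r/8 := by
    have : ‖h‖*(8*r) ≤ r*r := by linarith [hh', hqr, sq r]
    have : ‖h‖*8 ≤ r := by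
      by_contra hcon; push Not at hcon; nlinarith
    linarith
  have hn := norm_nonneg h
  have hx0 : 0 < ‖x‖ := hr.trans_le hxr
  have hxne : x ≠ 0 := norm_pos_iff.1 hx0
  set ip := inner ℝ (x-x0) h with hip
  have hipb : |ip| ≤ r*‖h‖ := (abs_real_inner_le_norm _ _).trans (by gcongr)
  have eplus : r^2-‖x+h-x0‖^2 = q*(1+(-2*ip-‖h‖^2)/q) := by
    rw [show x+h-x0 = (x-x0)+h by abel, norm_add_sq_real]; field_simp; rw [hq]; ring
  have eminus : r^2-‖x-h-x0‖^2 = q*(1+(2*ip-‖h‖^2)/q) := by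
    rw [show x-h-x0 = (x-x0)-h by abel, norm_sub_sq_real]; field_simp; rw [hq]; ring
  set ap := (-2*ip-‖h‖^2)/q with hap
  set am := (2*ip-‖h‖^2)/q with ham
  have bp : |ap| ≤ 3*r*‖h‖/q := by
    rw [hap, abs_div, abs_of_pos hq0]; gcongr
    have := abs_le.1 hipb
    rw [abs_le]; constructor <;> nlinarith [this.1, this.2]
  have bm : |am| ≤ 3*r*‖h‖/q := by
    rw [ham, abs_div, abs_of_pos hq0]; gcongr
    have := abs_le.1 hipb
    rw [abs_le]; constructor <;> nlinarith [this.1, this.2]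
  have hhalf : 3*r*‖h‖/q ≤ 1/2 := by rw [div_le_iff₀ hq0]; nlinarith
  have hp1 : 0 ≤ 1+ap := by have := (abs_le.1 (bp.trans hhalf)).1; linarith
  have hm1 : 0 ≤ 1+am := by have := (abs_le.1 (bm.trans hhalf)).1; linarith
  have hsum : ap + am = -2*‖h‖^2/q := by rw [hap, ham]; field_simp; ring
  rw [eplus, eminus, Real.mul_rpow hq0.le hp1, Real.mul_rpow hq0.le hm1]
  have l1 := h1 ap (bp.trans hhalf)
  have l2 := h1 am (bm.trans hhalf)
  have t1 := h2 ap (bp.trans hhalf)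
  have t2 := h2 am (bm.trans hhalf)
  have d1 := h3 x h hxne (by linarith)
  have d2 := h3 x (-h) hxne (by rw [norm_neg]; linarith)
  rw [norm_neg, ← sub_eq_add_neg] at d2
  set P := (1+ap)^α
  set Q := (1+am)^α
  have hqi : 1/q ≤ r^2/q^2 := by rw [div_le_div_iff₀ hq0 (by positivity), one_mul, sq q]; exact mul_le_mul_of_nonneg_right hqr hq0.le
  have sqb : ∀ a, |a| ≤ 3*r*‖h‖/q → a^2 ≤ 9*r^2*‖h‖^2/q^2 := fun a ha => by
    rw [← sq_abs]; calc |a|^2 ≤ (3*r*‖h‖/q)^2 := by gcongr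
      _ = _ := by ring
  have u : ‖h‖^2/q ≤ r^2*‖h‖^2/q^2 := by
    have := mul_le_mul_of_nonneg_right hqi (sq_nonneg ‖h‖)
    calc ‖h‖^2/q = 1/q*‖h‖^2 := by ring
      _ ≤ _ := this
      _ = _ := by ring
  have hPQ : |(1-P)+(1-Q)| ≤ (2*|α| * r^2 + 18*M2*r^2)*(‖h‖^2/q^2) := by
    have e : (1-P)+(1-Q) = -(P-1-α*ap) - (Q-1-α*am) + α*(2*‖h‖^2/q) := by
      have : α*(2*‖h‖^2/q) = -α*(ap+am) := by rw [hsum]; ring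
      rw [this]; ring
    rw [e]
    refine (abs_add_le _ _).trans ?_
    have a1 : |-(P-1-α*ap) - (Q-1-α*am)| ≤ M2*(9*r^2*‖h‖^2/q^2) + M2*(9*r^2*‖h‖^2/q^2) := by
      refine (abs_sub _ _).trans ?_
      rw [abs_neg]
      exact add_le_add (t1.trans (by gcongr; exact sqb _ bp)) (t2.trans (by gcongr; exact sqb _ bm))
    have a2 : |α*(2*‖h‖^2/q)| ≤ |α| * (2*(r^2*‖h‖^2/q^2)) := by
      rw [abs_mul, abs_of_nonneg (by positivity : 0 ≤ 2*‖h‖^2/q)]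
      gcongr
      rw [mul_div_assoc]; gcongr
    calc _ ≤ M2*(9*r^2*‖h‖^2/q^2) + M2*(9*r^2*‖h‖^2/q^2) + |α| * (2*(r^2*‖h‖^2/q^2)) := add_le_add a1 a2
      _ = _ := by ring
  have hP : |1-P| ≤ 3*M1*r*r^2*‖h‖/q^2 := by
    rw [abs_sub_comm]
    calc |P-1| ≤ M1*(3*r*‖h‖/q) := l1.trans (by gcongr)
      _ = 3*M1*r*‖h‖*(1/q) := by ring
      _ ≤ 3*M1*r*‖h‖*(r^2/q^2) := by gcongr
      _ = _ := by ring
  have hQ : |1-Q| ≤ 3*M1*r*r^2*‖h‖/q^2 := by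
    rw [abs_sub_comm]
    calc |Q-1| ≤ M1*(3*r*‖h‖/q) := l2.trans (by gcongr)
      _ = 3*M1*r*‖h‖*(1/q) := by ring
      _ ≤ 3*M1*r*‖h‖*(r^2/q^2) := by gcongr
      _ = _ := by ring
  have hG1 := (hGb ‖x‖ hxr hxR).2
  have hG1' := (hGb' ‖x‖ hxr hxR).2
  have e : (q^α - q^α*P)*‖x+h‖^t + (q^α - q^α*Q)*‖x-h‖^t
      = q^α*(((1-P)+(1-Q))*‖x‖^t + (1-P)*(‖x+h‖^t-‖x‖^t) + (1-Q)*(‖x-h‖^t-‖x‖^t)) := by ring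
  rw [e, abs_mul, abs_of_pos (by positivity : 0 < q^α), Real.rpow_sub hq0]
  have hm3 : M3*‖x‖^(t-1)*‖h‖ ≤ M3*G'*‖h‖ := by gcongr
  calc q^α*|((1-P)+(1-Q))*‖x‖^t + (1-P)*(‖x+h‖^t-‖x‖^t) + (1-Q)*(‖x-h‖^t-‖x‖^t)|
      ≤ q^α*((2*|α| * r^2 + 18*M2*r^2)*(‖h‖^2/q^2)*G + (3*M1*r*r^2*‖h‖/q^2)*(M3*G'*‖h‖) + (3*M1*r*r^2*‖h‖/q^2)*(M3*G'*‖h‖)) := by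
        gcongr
        refine (abs_add_three _ _ _).trans ?_
        rw [abs_mul, abs_mul, abs_mul]
        have : |‖x‖^t| ≤ G := by rw [abs_of_nonneg (by positivity)]; exact hG1
        gcongr
        · exact d1.trans hm3
        · exact d2.trans hm3
    _ = _ := by rw [show (q:ℝ)^(2:ℝ) = q^2 by exact_mod_cast Real.rpow_natCast q 2]; field_simp; ring

lemma kr_neg_symm {N : ℕ} (p ε : ℝ) (x h : EN N) : kr p ε (dist x (x+h)) = kr p ε ‖h‖ := by
  rw [dist_comm, dist_eq_norm, add_sub_cancel_left]

set_option maxHeartbeats 1000000 in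
lemma inner_est {N : ℕ} (hN : 2 ≤ N) {s t r R α : ℝ} (hs : s ∈ Ioo (0:ℝ) 1) (ht : -(N:ℝ) < t) (hts : t < 2*s) (hr : 0 < r) (hrR : r ≤ R) :
    ∃ C : ℝ, 0 ≤ C ∧ ∀ ε > 0, ∀ x0 x : EN N, ∀ θ > 0, θ ≤ 1/(8*r) → ‖x-x0‖ < r → r ≤ ‖x‖ → ‖x‖ ≤ R →
      Integrable (fun z => (ball x (θ*(r^2-‖x-x0‖^2))).indicator (fun z => ((r^2-‖x-x0‖^2)^α - (r^2-‖z-x0‖^2)^α) * wk ((N:ℝ)+2*s) ε t x z) z) ∧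
      -(C * (r^2-‖x-x0‖^2)^(α-2) * (θ*(r^2-‖x-x0‖^2))^(2-2*s)) ≤
        ∫ z, (ball x (θ*(r^2-‖x-x0‖^2))).indicator (fun z => ((r^2-‖x-x0‖^2)^α - (r^2-‖z-x0‖^2)^α) * wk ((N:ℝ)+2*s) ε t x z) z := by
  obtain ⟨C0, hC0, hpt⟩ := inner_pt N t α hr hrR
  have hN2 : (2:ℝ) ≤ N := by exact_mod_cast hN
  have hs0 := hs.1
  have hs1 := hs.2
  set p : ℝ := (N:ℝ)+2*s with hp
  set A := ∫ z in ball (0:EN N) 1, ‖z‖^(2-p) with hA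
  have hA0 : 0 ≤ A := integral_nonneg fun z => by positivity
  clear_value A p
  refine ⟨C0*A, by positivity, fun ε hε x0 x θ hθ hθr hx hxr hxR => ?_⟩
  set q := r^2-‖x-x0‖^2 with hq
  have hq0 : 0 < q := by have := norm_nonneg (x-x0); nlinarith
  have hqr : q ≤ r^2 := by nlinarith [sq_nonneg ‖x-x0‖]
  clear_value q
  set σ := θ*q with hσ
  have hσ0 : 0 < σ := by positivity
  clear_value σ
  have hσ8 : σ ≤ q/(8*r) := by
    calc σ ≤ 1/(8*r)*q := by rw [hσ]; gcongr
      _ = _ := by ring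
  have hσd : σ < r - ‖x-x0‖ := by
    refine hσ8.trans_lt ?_
    rw [div_lt_iff₀ (by positivity), hq]
    have := norm_nonneg (x-x0)
    nlinarith
  set φ : EN N → ℝ := fun z => (ball x σ).indicator (fun z => (q^α - (r^2-‖z-x0‖^2)^α) * wk p ε t x z) z with hφ
  -- boundedness on the small ball
  have hqz : ∀ z ∈ ball x σ, r^2 - (‖x-x0‖+σ)^2 ≤ r^2-‖z-x0‖^2 ∧ r^2-‖z-x0‖^2 ≤ r^2 := fun z hz => by
    rw [mem_ball, dist_eq_norm] at hz
    have h1 : ‖z-x0‖ ≤ ‖x-x0‖+σ := by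
      calc ‖z-x0‖ = ‖(z-x)+(x-x0)‖ := by congr 1; abel
        _ ≤ ‖z-x‖+‖x-x0‖ := norm_add_le _ _
        _ ≤ _ := by linarith
    have := norm_nonneg (z-x0)
    constructor
    · gcongr
    · nlinarith [sq_nonneg ‖z-x0‖]
  have hlow : 0 < r^2 - (‖x-x0‖+σ)^2 := by have := norm_nonneg (x-x0); nlinarith
  obtain ⟨_, G, _, hG, hGb⟩ := pow_bd α hlow (by nlinarith [sq_nonneg (‖x-x0‖+σ)] : r^2 - (‖x-x0‖+σ)^2 ≤ r^2)
  have hi : Integrable φ := by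
    have hw := wk_int (p := p) hN ht (by linarith) hε x
    refine (hw.const_mul (q^α+G)).mono' ?_ (Eventually.of_forall fun z => ?_)
    · exact (((by fun_prop : Measurable fun z : EN N => (q^α - (r^2-‖z-x0‖^2)^α)).mul (wk_meas' p ε t x)).indicator measurableSet_ball).aestronglyMeasurable
    · have hwn := wk_nonneg (p := p) (t := t) hε x z
      have hqa : 0 < q^α := by positivity
      rw [hφ]; by_cases hz : z ∈ ball x σ
      · simp only [indicator_of_mem hz]
        rw [norm_mul, Real.norm_of_nonneg hwn]
        refine mul_le_mul_of_nonneg_right ?_ hwn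
        have h1 := hqz z hz
        have h2 := (hGb _ h1.1 h1.2).2
        have h3 : 0 ≤ (r^2-‖z-x0‖^2)^α := Real.rpow_nonneg (hlow.le.trans h1.1) _
        rw [Real.norm_eq_abs, abs_le]; constructor <;> linarith
      · simp only [indicator_of_notMem hz, norm_zero]; positivity
  refine ⟨hi, ?_⟩
  have e1 : ∫ z, φ z = ∫ h, φ (x+h) := (integral_add_left_eq_self φ x).symm
  have e2 : ∫ z, φ z = ∫ h, φ (x-h) := (integral_sub_left_eq_self φ volume x).symm
  have i1 : Integrable fun h => φ (x+h) := hi.comp_add_left x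
  have i2 : Integrable fun h => φ (x-h) := hi.comp_sub_left x
  have e3 : 2 * ∫ z, φ z = ∫ h, (φ (x+h) + φ (x-h)) := by
    rw [integral_add i1 i2, ← e1, ← e2]; ring
  have e4 : -(∫ h in ball (0:EN N) σ, C0*q^(α-2)*‖h‖^(2-p)) ≤ ∫ h, (φ (x+h) + φ (x-h)) := by
    rw [← integral_neg, ← integral_indicator measurableSet_ball]
    have ib : IntegrableOn (fun h : EN N => -(C0*q^(α-2)*‖h‖^(2-p))) (ball 0 σ) := ((int_rpow_ball hN (by linarith) σ).const_mul _).neg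
    refine integral_mono_ae ((integrable_indicator_iff measurableSet_ball).2 ib) (i1.add i2) ?_
    filter_upwards [ae_ne_zero hN] with h hne
    have hh0 : 0 < ‖h‖ := norm_pos_iff.2 hne
    by_cases hh : h ∈ ball (0:EN N) σ
    · rw [indicator_of_mem hh]
      rw [mem_ball_zero_iff] at hh
      have m1 : x+h ∈ ball x σ := by rw [mem_ball, dist_eq_norm, add_sub_cancel_left]; exact hh
      have m2 : x-h ∈ ball x σ := by rw [mem_ball, dist_eq_norm, sub_sub_cancel_left, norm_neg]; exact hh
      simp only [hφ, indicator_of_mem m1, indicator_of_mem m2]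
      have k1 : wk p ε t x (x+h) = ‖x+h‖^t * kr p ε ‖h‖ := by rw [wk, kr_neg_symm]
      have k2 : wk p ε t x (x-h) = ‖x-h‖^t * kr p ε ‖h‖ := by
        rw [wk, sub_eq_add_neg, kr_neg_symm, norm_neg]
      rw [k1, k2]
      have hb0 := hpt x0 x h hx hxr hxR (by rw [← hq]; exact hh.le.trans hσ8)
      rw [← hq] at hb0
      have hb := (abs_le.1 hb0).1
      have hk0 := kr_nonneg (p := p) (r := ‖h‖) hε
      have hk1 : kr p ε ‖h‖ ≤ (‖h‖^p)⁻¹ := kr_le hh0.le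
      have h5 := mul_le_mul_of_nonneg_right hb hk0
      have h6 : C0*q^(α-2)*‖h‖^2*kr p ε ‖h‖ ≤ C0*q^(α-2)*‖h‖^2*(‖h‖^p)⁻¹ := by gcongr
      have h7 : ‖h‖^(2-p) = ‖h‖^2*(‖h‖^p)⁻¹ := by
        rw [Real.rpow_sub hh0, show (‖h‖:ℝ)^(2:ℝ) = ‖h‖^2 by exact_mod_cast Real.rpow_natCast ‖h‖ 2]; rfl
      rw [h7]
      linarith
    · rw [indicator_of_notMem hh]
      rw [mem_ball_zero_iff] at hh
      have m1 : x+h ∉ ball x σ := by rw [mem_ball, dist_eq_norm, add_sub_cancel_left]; exact hh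
      have m2 : x-h ∉ ball x σ := by rw [mem_ball, dist_eq_norm, sub_sub_cancel_left, norm_neg]; exact hh
      simp only [hφ, indicator_of_notMem m1, indicator_of_notMem m2]; simp
  rw [← e3, integral_const_mul, ball_scale _ hσ0] at e4
  have h8 : (N:ℝ)+(2-p) = 2-2*s := by rw [hp]; ring
  rw [h8, ← hA] at e4
  have h9 : 0 ≤ C0*q^(α-2)*(σ^(2-2*s)*A) := by positivity
  have : C0*A*q^(α-2)*σ^(2-2*s) = C0*q^(α-2)*(σ^(2-2*s)*A) := by ring
  rw [this]
  linarith

set_option maxHeartbeats 1000000 in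
lemma local_bound {N : ℕ} (hN : 2 ≤ N) {s t r R0 F L : ℝ} (hs : s ∈ Ioo (0:ℝ) 1) (ht : -(N:ℝ) < t) (hts : t < 2*s) (hR0 : 1 ≤ R0)
    (hr : 0 < r) (hr1 : r ≤ 1) (hF : 0 ≤ F) (hL : 0 ≤ L) :
    ∃ M e0 : ℝ, 0 ≤ M ∧ 0 < e0 ∧ ∀ ε > 0, ε ≤ e0 → ∀ Ω : Set (EN N), Ω ⊆ ball 0 R0 →
      ∀ (S : EN N → ℝ) (B : ℝ), Measurable S → (∀ x, 0 ≤ S x) → (∀ x, S x ≤ B) → (∀ x ∉ Ω, S x = 0) →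
        ∫ x, S x * ‖x‖^t ≤ L → (∀ x ∈ Ω, r ≤ ‖x‖ → Iop ((N:ℝ)+2*s) ε t S x ≤ F) →
        ∀ x, 2*r ≤ ‖x‖ → S x ≤ M := by
  classical
  have hN2 : (2:ℝ) ≤ N := by exact_mod_cast hN
  have hs0 := hs.1
  have hs1 := hs.2
  set p : ℝ := (N:ℝ)+2*s with hp
  have hp0 : 0 ≤ p := by linarith
  obtain ⟨C, hC, hin⟩ := inner_est (R := R0+r) (α := -(N:ℝ)) hN hs ht hts hr (by linarith)
  simp only [← hp] at hin
  clear_value p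
  obtain ⟨κ, hκ0, hκ⟩ := kappa hN (p := p) (t := t) hp0 ht (by linarith) hR0
  obtain ⟨γ, _, hγ, _, hγb⟩ := pow_bd t (by positivity : 0 < r/2) (by linarith : r/2 ≤ R0+2*r)
  set V := ∫ z in ann N (1/2), ‖z‖^(0:ℝ) with hV
  have hV0 : 0 < V := ann_integral_pos hN 0 (by norm_num)
  clear_value V
  set c := γ*((2:ℝ)^p)⁻¹*V with hc
  have hc0 : 0 < c := by positivity
  clear_value c
  obtain ⟨θ, hθ0, hθ1, hθ2⟩ : ∃ θ : ℝ, 0 < θ ∧ θ ≤ 1/(8*r) ∧ C*θ^2 ≤ c/2 := by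
    have h1 : Tendsto (fun θ : ℝ => C*θ^2) (𝓝[>] 0) (𝓝 0) := by
      have : Continuous fun θ : ℝ => C*θ^2 := by fun_prop
      have h := (this.tendsto 0).mono_left (nhdsWithin_le_nhds (s := Ioi 0))
      simpa using h
    have h2 : ∀ᶠ θ : ℝ in 𝓝[>] 0, θ < 1/(8*r) := by
      refine nhdsWithin_le_nhds (Iio_mem_nhds (by positivity))
    obtain ⟨θ, ha, hb, hc'⟩ := ((h1.eventually_lt_const (by positivity : 0 < c/2)).and (h2.and self_mem_nhdsWithin)).exists
    exact ⟨θ, hc', hb.le, ha.le⟩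
  set M0 := (F+L)*2/(c*θ^N) with hM0
  have hM00 : 0 ≤ M0 := by positivity
  clear_value M0
  refine ⟨M0*(r^2)^(-(N:ℝ)), r/8, by positivity, by positivity, fun ε hε hε0 Ω hΩ S B hSm hS0 hSB hSΩ hSL hSI x0 hx0 => ?_⟩
  have hε1 : ε ≤ 1 := by linarith
  by_cases hx0Ω : x0 ∈ Ω
  swap
  · rw [hSΩ x0 hx0Ω]; positivity
  have hx0R : ‖x0‖ ≤ R0 := by have := hΩ hx0Ω; rw [mem_ball_zero_iff] at this; exact this.le
  set ψ : EN N → ℝ := fun z => M0*(r^2-‖z-x0‖^2)^(-(N:ℝ)) with hψ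
  have hψm : Measurable ψ := by rw [hψ]; fun_prop
  have hψz : ∀ z, ψ z = M0*(r^2-‖z-x0‖^2)^(-(N:ℝ)) := fun _ => rfl
  clear_value ψ
  set b : EN N → ℝ := (ball x0 r).piecewise (fun z => min (ψ z) (S z)) S with hb
  have hbm : Measurable b := Measurable.piecewise measurableSet_ball (hψm.min hSm) hSm
  have hbin : ∀ z ∈ ball x0 r, b z = min (ψ z) (S z) := fun z hz => by rw [hb, piecewise_eq_of_mem _ _ _ hz]
  have hbout : ∀ z ∉ ball x0 r, b z = S z := fun z hz => by rw [hb, piecewise_eq_of_notMem _ _ _ hz]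
  clear_value b
  have hqpos : ∀ z ∈ ball x0 r, 0 < r^2-‖z-x0‖^2 := fun z hz => by
    rw [mem_ball, dist_eq_norm] at hz; have := norm_nonneg (z-x0); nlinarith
  have hψ0 : ∀ z ∈ ball x0 r, 0 ≤ ψ z := fun z hz => by rw [hψz]; exact mul_nonneg hM00 (Real.rpow_nonneg (hqpos z hz).le _)
  have hbS : ∀ z, b z ≤ S z := fun z => by
    by_cases hz : z ∈ ball x0 r
    · rw [hbin z hz]; exact min_le_right _ _
    · rw [hbout z hz]
  have hb0 : ∀ z, 0 ≤ b z := fun z => by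
    by_cases hz : z ∈ ball x0 r
    · rw [hbin z hz]; exact le_min (hψ0 z hz) (hS0 z)
    · rw [hbout z hz]; exact hS0 z
  have hbψ : ∀ z ∈ ball x0 r, b z ≤ ψ z := fun z hz => by
    rw [hbin z hz]; exact min_le_left _ _
  have hSa : ∀ x, |S x| ≤ B := fun x => by rw [abs_of_nonneg (hS0 x)]; exact hSB x
  have hba : ∀ x, |b x| ≤ B := fun x => by rw [abs_of_nonneg (hb0 x)]; exact (hbS x).trans (hSB x)
  have iS : Integrable fun x => S x * ‖x‖^t := by
    have h1 : Integrable ((ball (0:EN N) R0).indicator fun x => ‖x‖^t) := (integrable_indicator_iff measurableSet_ball).2 (int_rpow_ball hN ht R0)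
    refine (h1.bdd_mul hSm.aestronglyMeasurable (Eventually.of_forall hSa)).congr (Eventually.of_forall fun x => ?_)
    by_cases hx : x ∈ ball (0:EN N) R0
    · simp only [indicator_of_mem hx]
    · simp only [hSΩ x (fun h => hx (hΩ h)), zero_mul]
  have hwle : ∀ x, S x - b x ≤ 0 := by
    refine max_princ hN hp0 ht (by linarith : t - p < -(N:ℝ)) hε hΩ hR0 hκ0 (hκ ε hε hε1) (hSm.sub hbm) (B := B)
      (fun x => by rw [abs_le]; constructor <;> linarith [hS0 x, hb0 x, hbS x, hSB x]) (fun x hx => by linarith [hSΩ x hx, hb0 x]) (fun x hx => ?_)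
    rcases (hbS x).eq_or_lt with heq | hlt
    · unfold Iop
      refine integral_nonpos fun z => ?_
      have := wk_nonneg (p := p) (t := t) hε x z
      simp only [heq, sub_self, zero_sub, Pi.zero_apply]
      have h2 := hbS z
      nlinarith
    rw [Iop_sub hN ht (by linarith) hε x hSm hSa hbm hba]
    have hxb : x ∈ ball x0 r := by
      by_contra hcon
      rw [hbout x hcon] at hlt; exact lt_irrefl _ hlt
    have hbx : b x = ψ x := by
      rw [hbin x hxb] at hlt ⊢
      rcases min_lt_iff.1 hlt with h | h
      · exact min_eq_left h.le
      · exact absurd h (lt_irrefl _)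
    have hxx0 : ‖x-x0‖ < r := by rw [← dist_eq_norm]; exact hxb
    have hxr : r ≤ ‖x‖ := by
      have h := norm_sub_norm_le x0 x
      rw [norm_sub_rev] at h; linarith
    have hxR : ‖x‖ ≤ R0 := by have := hΩ hx; rw [mem_ball_zero_iff] at this; exact this.le
    have hSIx := hSI x hx hxr
    obtain ⟨hini, hinb⟩ := hin ε hε x0 x θ hθ0 hθ1 hxx0 hxr (by linarith)
    set q := r^2-‖x-x0‖^2 with hq
    have hq0 : 0 < q := hqpos x hxb
    have hqr : q ≤ r^2 := by nlinarith [sq_nonneg ‖x-x0‖]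
    clear_value q
    set σ := θ*q with hσ
    have hσ0 : 0 < σ := by positivity
    clear_value σ
    have hσ8 : σ ≤ q/(8*r) := by
      calc σ ≤ 1/(8*r)*q := by rw [hσ]; gcongr
        _ = _ := by ring
    have hσr : σ ≤ r/8 := by
      refine hσ8.trans ?_
      rw [div_le_div_iff₀ (by positivity) (by norm_num)]; nlinarith
    have hσd : σ < r - ‖x-x0‖ := by
      refine hσ8.trans_lt ?_
      rw [div_lt_iff₀ (by positivity), hq]
      have := norm_nonneg (x-x0)
      nlinarith
    set ρ := max ε σ with hρ
    have hρ0 : 0 < ρ := lt_max_of_lt_left hε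
    have hρr : ρ ≤ r/8 := max_le hε0 hσr
    have hρε : ε ≤ ρ := le_max_left _ _
    have hρσ' : σ ≤ ρ := le_max_right _ _
    have hρor : ∀ y, ε ≤ y → σ ≤ y → ρ ≤ y := fun y h1 h2 => max_le h1 h2
    clear_value ρ
    have hψx : ψ x = M0*q^(-(N:ℝ)) := by rw [hψz, hq]
    have hψx0 : 0 ≤ ψ x := hψ0 x hxb
    set T : Set (EN N) := (fun z => z - x) ⁻¹' ann N (ρ*(1/2)) with hT
    have hTm : MeasurableSet T := (ann_meas N _).preimage (by fun_prop)
    have hTi : Integrable (T.indicator fun _ => (1:ℝ)) := by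
      have h1 : Integrable ((ann N (ρ*(1/2))).indicator fun z => ‖z‖^(0:ℝ)) := (integrable_indicator_iff (ann_meas N _)).2 (ann_int _ 0 (by positivity))
      have h2 := h1.comp_sub_right x
      refine h2.congr (Eventually.of_forall fun z => ?_)
      simp only [Real.rpow_zero]; rfl
    have hTv : ∫ z, T.indicator (fun _ => (1:ℝ)) z = ρ^(N:ℝ)*V := by
      have h1 : ∫ z, T.indicator (fun _ => (1:ℝ)) z = ∫ z : EN N, (ann N (ρ*(1/2))).indicator (fun z => ‖z‖^(0:ℝ)) (z - x) := by
        congr 1; ext z; simp only [Real.rpow_zero]; rfl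
      rw [h1, integral_sub_right_eq_self ((ann N (ρ*(1/2))).indicator (fun z => ‖z‖^(0:ℝ))) x, integral_indicator (ann_meas N _), ann_scale 0 _ hρ0, add_zero, hV]
    have hT1 : ∀ z ∈ T, ρ ≤ dist x z ∧ ‖z-x‖ ≤ 3*(ρ*(1/2)) := fun z hz => by
      have h1 : 2*(ρ*(1/2)) ≤ ‖z-x‖ := hz.1
      refine ⟨?_, hz.2⟩
      rw [dist_comm, dist_eq_norm]; linarith
    clear_value T
    set φ : EN N → ℝ := fun z => (ball x σ).indicator (fun z => (q^(-(N:ℝ)) - (r^2-‖z-x0‖^2)^(-(N:ℝ))) * wk p ε t x z) z with hφ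
    have hφin : ∀ z ∈ ball x σ, φ z = (q^(-(N:ℝ)) - (r^2-‖z-x0‖^2)^(-(N:ℝ))) * wk p ε t x z := fun z hz => indicator_of_mem hz _
    have hφout : ∀ z ∉ ball x σ, φ z = 0 := fun z hz => indicator_of_notMem hz _
    have hini' : Integrable φ := hini
    have hinb' : -(C * q^(-(N:ℝ)-2) * σ^(2-2*s)) ≤ ∫ z, φ z := hinb
    clear hini hinb
    clear_value φ
    have hlb : ∫ z, (M0 * φ z + (ψ x * (γ*((2*ρ)^p)⁻¹)) * T.indicator (fun _ => (1:ℝ)) z - (ρ^p)⁻¹ * (S z * ‖z‖^t)) ≤ Iop p ε t b x := by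
      refine integral_mono (((hini'.const_mul _).add (hTi.const_mul _)).sub (iS.const_mul _)) (Iop_int hN ht (by linarith) hε x hbm hba) (fun z => ?_)
      have hw := wk_nonneg (p := p) (t := t) hε x z
      have hSz : 0 ≤ (ρ^p)⁻¹ * (S z * ‖z‖^t) := by have := hS0 z; positivity
      have hTn : z ∉ T ∨ ρ ≤ dist x z := by
        by_cases hz : z ∈ T
        · right
          exact (hT1 z hz).1
        · left; exact hz
      simp only
      rw [hbx]
      rcases lt_or_ge (dist x z) σ with hd | hd
      · have hzT : z ∉ T := by
          rcases hTn with h | h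
          · exact h
          · exact absurd (h.trans_lt hd) (not_lt.2 hρσ')
        have hzb : z ∈ ball x σ := by rw [mem_ball, dist_comm]; exact hd
        have hzb' : z ∈ ball x0 r := by
          rw [mem_ball]; rw [mem_ball] at hzb
          have := dist_triangle z x x0
          rw [dist_eq_norm x x0] at this; linarith
        rw [indicator_of_notMem hzT, hφin z hzb]
        have := mul_le_mul_of_nonneg_right (sub_le_sub_left (hbψ z hzb') (ψ x)) hw
        have e : (ψ x - ψ z) * wk p ε t x z = M0*((q^(-(N:ℝ)) - (r^2-‖z-x0‖^2)^(-(N:ℝ))) * wk p ε t x z) := by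
          rw [hψz, hψz, ← hq]; ring
        rw [e] at this
        linarith
      · have hzb : z ∉ ball x σ := by rw [mem_ball, dist_comm, not_lt]; exact hd
        have hφz : φ z = 0 := hφout z hzb
        rw [hφz]
        rcases lt_or_ge (dist x z) ε with he | he
        · have hzT : z ∉ T := by
            rcases hTn with h | h
            · exact h
            · exact absurd (h.trans_lt he) (not_lt.2 hρε)
          have hw0 : wk p ε t x z = 0 := by rw [wk, kr, if_neg (not_le.2 he), mul_zero]
          rw [indicator_of_notMem hzT, hw0]
          linarith
        · have hdρ : ρ ≤ dist x z := hρor _ he hd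
          have hwe : wk p ε t x z = ‖z‖^t*(dist x z^p)⁻¹ := by rw [wk, kr, if_pos he]
          have h1 : b z * wk p ε t x z ≤ (ρ^p)⁻¹ * (S z * ‖z‖^t) := by
            rw [hwe]
            have hkk : (dist x z^p)⁻¹ ≤ (ρ^p)⁻¹ := by gcongr
            calc b z * (‖z‖^t*(dist x z^p)⁻¹) ≤ S z * (‖z‖^t*(ρ^p)⁻¹) := by
                  have := hbS z
                  have := hS0 z
                  gcongr
              _ = _ := by ring
          have h2 : (ψ x * (γ*((2*ρ)^p)⁻¹)) * T.indicator (fun _ => (1:ℝ)) z ≤ ψ x * wk p ε t x z := by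
            by_cases hz : z ∈ T
            · rw [indicator_of_mem hz, mul_one]
              refine mul_le_mul_of_nonneg_left ?_ hψx0
              have hz2 : ‖z-x‖ ≤ 3*(ρ*(1/2)) := (hT1 z hz).2
              have hz3 : dist x z ≤ 2*ρ := by rw [dist_comm, dist_eq_norm]; linarith
              have hz4 := abs_le.1 ((abs_norm_sub_norm_le z x).trans hz2)
              have hz5 := (hγb ‖z‖ (by linarith [hz4.1]) (by linarith [hz4.2])).1
              have hdp : 0 < dist x z := hρ0.trans_le hdρ
              rw [hwe]
              gcongr
            · rw [indicator_of_notMem hz, mul_zero]; positivity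
          linarith
    have i12 : Integrable fun z => M0 * φ z + (ψ x * (γ*((2*ρ)^p)⁻¹)) * T.indicator (fun _ => (1:ℝ)) z := (hini'.const_mul _).add (hTi.const_mul _)
    rw [integral_sub i12 (iS.const_mul _), integral_add (hini'.const_mul _) (hTi.const_mul _), integral_const_mul, integral_const_mul, integral_const_mul, hTv] at hlb
    -- inner bound in terms of rho
    have hinner : -(c/2*(q^(-(N:ℝ))*ρ^(-(2*s)))) ≤ ∫ z, φ z := by
      rcases le_or_gt σ ε with h | h
      · have hz : ∀ z, φ z = 0 := fun z => by
          by_cases hz : z ∈ ball x σ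
          · have hd : dist x z < ε := by rw [mem_ball, dist_comm] at hz; linarith
            rw [hφin z hz, wk, kr, if_neg (not_le.2 hd), mul_zero, mul_zero]
          · exact hφout z hz
        simp only [hz, integral_zero]
        have : 0 ≤ c/2*(q^(-(N:ℝ))*ρ^(-(2*s))) := by positivity
        linarith
      · have hρσ : ρ = σ := le_antisymm (hρor _ h.le le_rfl) hρσ'
        refine le_trans ?_ hinb'
        rw [hρσ, neg_le_neg_iff]
        have e : C*q^(-(N:ℝ)-2)*σ^(2-2*s) = C*θ^2*(q^(-(N:ℝ))*σ^(-(2*s))) := by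
          rw [Real.rpow_sub hq0, show (2-2*s:ℝ) = 2 + -(2*s) by ring, Real.rpow_add hσ0 2,
            show (q:ℝ)^(2:ℝ) = q^2 by exact_mod_cast Real.rpow_natCast q 2, show (σ:ℝ)^(2:ℝ) = σ^2 by exact_mod_cast Real.rpow_natCast σ 2]
          have : σ^2 = θ^2*q^2 := by rw [hσ]; ring
          rw [this]; field_simp
        rw [e]
        gcongr
    have houter : ψ x * (γ*((2*ρ)^p)⁻¹) * (ρ^(N:ℝ)*V) = M0*(c*(q^(-(N:ℝ))*ρ^(-(2*s)))) := by
      have : ρ^p = ρ^(N:ℝ)*ρ^(2*s) := by rw [hp, Real.rpow_add hρ0]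
      rw [hψx, Real.mul_rpow (by norm_num) hρ0.le, this, Real.rpow_neg hρ0.le, hc]; field_simp
    rw [houter] at hlb
    have h1 := mul_le_mul_of_nonneg_left hinner hM00
    have h2 : (ρ^p)⁻¹ * ∫ z, S z * ‖z‖^t ≤ (ρ^p)⁻¹*L := by gcongr
    have h3 : θ^N*(ρ^p)⁻¹ ≤ q^(-(N:ℝ))*ρ^(-(2*s)) := by
      have : ρ^p = ρ^(N:ℝ)*ρ^(2*s) := by rw [hp, Real.rpow_add hρ0]
      rw [this, mul_inv, ← mul_assoc, Real.rpow_neg hρ0.le, Real.rpow_neg hq0.le, Real.rpow_natCast, Real.rpow_natCast]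
      refine mul_le_mul_of_nonneg_right ?_ (by positivity)
      rw [← div_eq_mul_inv, div_le_iff₀ (by positivity), inv_mul_eq_div, le_div_iff₀ (by positivity), ← mul_pow]
      gcongr
      rw [← hσ]; exact hρσ'
    have h4 : M0*(c/2)*(θ^N*(ρ^p)⁻¹) ≤ M0*(c/2)*(q^(-(N:ℝ))*ρ^(-(2*s))) := by gcongr
    have h5 : M0*(c/2)*(θ^N*(ρ^p)⁻¹) = (F+L)*(ρ^p)⁻¹ := by rw [hM0]; field_simp
    have h6 : 1 ≤ (ρ^p)⁻¹ := by
      rw [one_le_inv₀ (by positivity)]; exact Real.rpow_le_one hρ0.le (by linarith) hp0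
    have h7 : F ≤ F*(ρ^p)⁻¹ := le_mul_of_one_le_right hF h6
    linarith
  have hmem : x0 ∈ ball x0 r := mem_ball_self hr
  have h1 := hbψ x0 hmem
  have h2 := hwle x0
  have h3 : ψ x0 = M0*(r^2)^(-(N:ℝ)) := by rw [hψz]; simp
  linarith

lemma aa_scale {N : ℕ} (q t : ℝ) {ρ : ℝ} (hρ : 0 < ρ) (x : EN N) :
    aa q ρ t x = ρ^((N:ℝ)+t-q) * aa q 1 t (ρ⁻¹ • x) := by
  have h1 := Measure.integral_comp_smul (volume : Measure (EN N)) (fun z => wk q ρ t x z) ρ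
  have h2 : (fun z : EN N => wk q ρ t x (ρ • z)) = fun z => ρ^t * ρ^(-q) * wk q 1 t (ρ⁻¹ • x) z := by
    ext z
    unfold wk
    have hd : dist x (ρ • z) = ρ * dist (ρ⁻¹ • x) z := by
      have : x = ρ • (ρ⁻¹ • x) := by rw [smul_smul, mul_inv_cancel₀ hρ.ne', one_smul]
      conv_lhs => rw [this]
      rw [dist_smul₀, Real.norm_of_nonneg hρ.le]
    have hk := kr_smul (p := q) (a := 1) hρ (dist_nonneg (x := ρ⁻¹ • x) (y := z))
    rw [mul_one] at hk
    rw [hd, hk, norm_smul, Real.norm_of_nonneg hρ.le, Real.mul_rpow hρ.le (norm_nonneg _)]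
    ring
  rw [h2, integral_const_mul, finrank_euclideanSpace_fin, smul_eq_mul, abs_of_nonneg (by positivity)] at h1
  have h3 : ∫ z : EN N, wk q ρ t x z = ρ^N * (ρ^t * ρ^(-q) * ∫ z : EN N, wk q 1 t (ρ⁻¹ • x) z) := by
    rw [h1, ← mul_assoc, mul_inv_cancel₀ (by positivity), one_mul]
  rw [aa, h3, aa, sub_eq_add_neg, Real.rpow_add hρ, Real.rpow_add hρ, Real.rpow_natCast]; ring

lemma c2_bounds {N : ℕ} {ξ : EN N → ℝ} (h2 : ContDiff ℝ 2 ξ) (hc : HasCompactSupport ξ) :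
    ∃ K : ℝ, 0 ≤ K ∧ (∀ x, |ξ x| ≤ K) ∧ (∀ x y, |ξ x - ξ y| ≤ K * dist x y) ∧
      ∀ x h, |2*ξ x - ξ (x+h) - ξ (x-h)| ≤ K * ‖h‖^2 := by
  obtain ⟨B, hB⟩ := hc.exists_bound_of_continuous h2.continuous
  obtain ⟨K1, hK1⟩ := ContDiff.lipschitzWith_of_hasCompactSupport hc h2 (by norm_num)
  have h2' : ContDiff ℝ 1 (fderiv ℝ ξ) := h2.fderiv_right (by norm_num)
  obtain ⟨K2, hK2⟩ := ContDiff.lipschitzWith_of_hasCompactSupport (hc.fderiv (𝕜 := ℝ)) h2' (by norm_num)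
  have hB0 : 0 ≤ B := (norm_nonneg _).trans (hB 0)
  refine ⟨B + K1 + K2, by positivity, fun x => ?_, fun x y => ?_, fun x h => ?_⟩
  · have := hB x
    rw [Real.norm_eq_abs] at this
    have := K1.2
    have := K2.2
    linarith [K1.coe_nonneg, K2.coe_nonneg]
  · have := hK1.dist_le_mul x y
    rw [Real.dist_eq] at this
    refine this.trans (mul_le_mul_of_nonneg_right ?_ dist_nonneg)
    linarith [K1.coe_nonneg, K2.coe_nonneg]
  · have hd : Differentiable ℝ ξ := h2.differentiable (by norm_num)
    have hg : ∀ y, HasFDerivAt (fun y => ξ (y+h) - ξ y) (fderiv ℝ ξ (y+h) - fderiv ℝ ξ y) y := fun y => by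
      have h1 : HasFDerivAt (fun y => ξ (y+h)) (fderiv ℝ ξ (y+h)) y := by
        exact (hasFDerivAt_comp_add_right h).2 (hd (y+h)).hasFDerivAt
      exact h1.sub (hd y).hasFDerivAt
    have hb : ∀ y, ‖fderiv ℝ ξ (y+h) - fderiv ℝ ξ y‖ ≤ K2*‖h‖ := fun y => by
      have := hK2.dist_le_mul (y+h) y
      rwa [dist_eq_norm, dist_eq_norm, add_sub_cancel_left] at this
    have := Convex.norm_image_sub_le_of_norm_hasFDerivWithin_le (𝕜 := ℝ) (s := univ) (fun y _ => (hg y).hasFDerivWithinAt) (fun y _ => hb y) convex_univ (mem_univ x) (mem_univ (x-h))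
    simp only [sub_add_cancel, sub_sub_cancel_left, norm_neg] at this
    have e : 2*ξ x - ξ (x+h) - ξ (x-h) = ξ x - ξ (x-h) - (ξ (x+h) - ξ x) := by ring
    rw [e, ← Real.norm_eq_abs]
    refine this.trans ?_
    rw [mul_assoc, ← sq]
    refine mul_le_mul_of_nonneg_right ?_ (by positivity)
    linarith [K1.coe_nonneg, K2.coe_nonneg]

/-- inner part of the test function estimate -/
lemma test_inner {N : ℕ} (hN : 2 ≤ N) {s t R0 K M : ℝ} (hs : s ∈ Ioo (0:ℝ) 1)
    (hK : 0 ≤ K) (hM : 0 ≤ M) (hR0 : 0 ≤ R0)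
    {φ : EN N → ℝ} {ε : ℝ} (hε : 0 < ε) {ξ : EN N → ℝ} {x : EN N} (hx : x ≠ 0) (hxR : ‖x‖ ≤ R0)
    (hK1 : ∀ x y, |ξ x - ξ y| ≤ K * dist x y) (hK2 : ∀ x h, |2*ξ x - ξ (x+h) - ξ (x-h)| ≤ K * ‖h‖^2)
    (hM' : ∀ h : EN N, ‖h‖ ≤ ‖x‖/5 → |‖x+h‖^t - ‖x‖^t| ≤ M * ‖x‖^(t-1) * ‖h‖)
    (hφ : ∀ z, φ z = (ball x (‖x‖/5)).indicator (fun z => (ξ x - ξ z) * wk ((N:ℝ)+2*s) ε t x z) z) (hi : Integrable φ) :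
    |∫ z, φ z| ≤ K*(R0+2*M)*(∫ z in ball (0:EN N) 1, ‖z‖^(2-((N:ℝ)+2*s)))*(‖x‖^(t-1)*(‖x‖/5)^(2-2*s)) := by
  have hN2 : (2:ℝ) ≤ N := by exact_mod_cast hN
  have hs0 := hs.1
  have hs1 := hs.2
  have hx0 : 0 < ‖x‖ := norm_pos_iff.2 hx
  set p : ℝ := (N:ℝ)+2*s with hp
  have h8 : (N:ℝ)+(2-p) = 2-2*s := by rw [hp]; ring
  clear_value p
  set A := ∫ z in ball (0:EN N) 1, ‖z‖^(2-p) with hA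
  have hA0 : 0 ≤ A := integral_nonneg fun z => by positivity
  clear_value A
  set σ := ‖x‖/5 with hσ
  have hσ0 : 0 < σ := by positivity
  clear_value σ
  have e1 : ∫ z, φ z = ∫ h, φ (x+h) := (integral_add_left_eq_self φ x).symm
  have e2 : ∫ z, φ z = ∫ h, φ (x-h) := (integral_sub_left_eq_self φ volume x).symm
  have i1 : Integrable fun h => φ (x+h) := hi.comp_add_left x
  have i2 : Integrable fun h => φ (x-h) := hi.comp_sub_left x
  have e3 : 2 * ∫ z, φ z = ∫ h, (φ (x+h) + φ (x-h)) := by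
    rw [integral_add i1 i2, ← e1, ← e2]; ring
  set c := K*(R0+2*M)*‖x‖^(t-1) with hc
  have hc0 : 0 ≤ c := by positivity
  have ib : Integrable ((ball (0:EN N) σ).indicator (fun h : EN N => c*‖h‖^(2-p))) :=
    (integrable_indicator_iff measurableSet_ball).2 ((int_rpow_ball hN (by linarith) σ).const_mul _)
  have e4 : |∫ h, (φ (x+h) + φ (x-h))| ≤ ∫ h, (ball (0:EN N) σ).indicator (fun h : EN N => c*‖h‖^(2-p)) h := by
    rw [← Real.norm_eq_abs]
    refine norm_integral_le_of_norm_le ib ?_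
    filter_upwards [ae_ne_zero hN] with h hne
    have hh0 : 0 < ‖h‖ := norm_pos_iff.2 hne
    by_cases hh : h ∈ ball (0:EN N) σ
    · rw [indicator_of_mem hh]
      rw [mem_ball_zero_iff] at hh
      have m1 : x+h ∈ ball x σ := by rw [mem_ball, dist_eq_norm, add_sub_cancel_left]; exact hh
      have m2 : x-h ∈ ball x σ := by rw [mem_ball, dist_eq_norm, sub_sub_cancel_left, norm_neg]; exact hh
      rw [hφ, hφ, indicator_of_mem m1, indicator_of_mem m2]
      have k1 : wk p ε t x (x+h) = ‖x+h‖^t * kr p ε ‖h‖ := by rw [wk, kr_neg_symm]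
      have k2 : wk p ε t x (x-h) = ‖x-h‖^t * kr p ε ‖h‖ := by
        rw [wk, sub_eq_add_neg, kr_neg_symm, norm_neg]
      rw [k1, k2]
      have hk0 := kr_nonneg (p := p) (r := ‖h‖) hε
      have hk1 : kr p ε ‖h‖ ≤ (‖h‖^p)⁻¹ := kr_le hh0.le
      have h7 : ‖h‖^(2-p) = ‖h‖^2*(‖h‖^p)⁻¹ := by
        rw [Real.rpow_sub hh0, show (‖h‖:ℝ)^(2:ℝ) = ‖h‖^2 by exact_mod_cast Real.rpow_natCast ‖h‖ 2]; rfl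
      have g1 := hM' h hh.le
      have g2 := hM' (-h) (by rw [norm_neg]; exact hh.le)
      rw [norm_neg, ← sub_eq_add_neg] at g2
      have a1 := hK1 x (x+h)
      have a2 := hK1 x (x-h)
      rw [dist_comm, dist_eq_norm, add_sub_cancel_left] at a1
      rw [dist_comm, dist_eq_norm, sub_sub_cancel_left, norm_neg] at a2
      have a3 := hK2 x h
      have ht1 : ‖x‖^t = ‖x‖^(t-1)*‖x‖ := by
        rw [Real.rpow_sub hx0, Real.rpow_one]; field_simp
      have e : (ξ x - ξ (x+h))*(‖x+h‖^t*kr p ε ‖h‖) + (ξ x - ξ (x-h))*(‖x-h‖^t*kr p ε ‖h‖)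
        = ((2*ξ x - ξ (x+h) - ξ (x-h))*‖x‖^t + (ξ x - ξ (x+h))*(‖x+h‖^t-‖x‖^t) + (ξ x - ξ (x-h))*(‖x-h‖^t-‖x‖^t))*kr p ε ‖h‖ := by ring
      rw [e, norm_mul, Real.norm_of_nonneg hk0, Real.norm_eq_abs, h7]
      have hb1 : |(2*ξ x - ξ (x+h) - ξ (x-h))*‖x‖^t| ≤ K*‖h‖^2*(‖x‖^(t-1)*R0) := by
        rw [abs_mul, abs_of_nonneg (by positivity : 0 ≤ ‖x‖^t), ht1]
        gcongr
      have hb2 : |(ξ x - ξ (x+h))*(‖x+h‖^t-‖x‖^t)| ≤ K*‖h‖*(M*‖x‖^(t-1)*‖h‖) := by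
        rw [abs_mul]; gcongr
      have hb3 : |(ξ x - ξ (x-h))*(‖x-h‖^t-‖x‖^t)| ≤ K*‖h‖*(M*‖x‖^(t-1)*‖h‖) := by
        rw [abs_mul]; gcongr
      have hb : |(2*ξ x - ξ (x+h) - ξ (x-h))*‖x‖^t + (ξ x - ξ (x+h))*(‖x+h‖^t-‖x‖^t) + (ξ x - ξ (x-h))*(‖x-h‖^t-‖x‖^t)| ≤ c*‖h‖^2 := by
        refine (abs_add_three _ _ _).trans ?_
        have : c*‖h‖^2 = K*‖h‖^2*(‖x‖^(t-1)*R0) + K*‖h‖*(M*‖x‖^(t-1)*‖h‖) + K*‖h‖*(M*‖x‖^(t-1)*‖h‖) := by rw [hc]; ring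
        linarith
      rw [← mul_assoc]
      exact mul_le_mul hb hk1 hk0 (by positivity)
    · rw [indicator_of_notMem hh]
      rw [mem_ball_zero_iff] at hh
      have m1 : x+h ∉ ball x σ := by rw [mem_ball, dist_eq_norm, add_sub_cancel_left]; exact hh
      have m2 : x-h ∉ ball x σ := by rw [mem_ball, dist_eq_norm, sub_sub_cancel_left, norm_neg]; exact hh
      rw [hφ, hφ, indicator_of_notMem m1, indicator_of_notMem m2]; simp
  rw [← e3, integral_indicator measurableSet_ball, integral_const_mul, ball_scale _ hσ0, h8, ← hA, abs_mul, abs_two] at e4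
  have h9 : 0 ≤ |∫ z, φ z| := abs_nonneg _
  have : K*(R0+2*M)*A*(‖x‖^(t-1)*σ^(2-2*s)) = c*(σ^(2-2*s)*A) := by rw [hc]; ring
  rw [this]
  linarith

set_option maxHeartbeats 1000000 in
lemma test_bound {N : ℕ} (hN : 2 ≤ N) {s t δ R0 : ℝ} (hs : s ∈ Ioo (0:ℝ) 1) (ht : -(N:ℝ) < t) (hδ : 0 < δ) (hδ1 : δ ≤ 1) (hts : t + δ < 2*s)
    (hR0 : 1 ≤ R0) {ξ : EN N → ℝ} (h2 : ContDiff ℝ 2 ξ) (hc : HasCompactSupport ξ) :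
    ∃ C : ℝ, 0 ≤ C ∧ ∀ ε > 0, ∀ x : EN N, x ≠ 0 → ‖x‖ ≤ R0 →
      |Iop ((N:ℝ)+2*s) ε t ξ x| ≤ C * (max ‖x‖ ε)^(t+δ-2*s) := by
  have hN2 : (2:ℝ) ≤ N := by exact_mod_cast hN
  have hs0 := hs.1
  have hs1 := hs.2
  obtain ⟨K, hK, hKb, hK1, hK2⟩ := c2_bounds h2 hc
  obtain ⟨M, hM, hM'⟩ := D1_bound N t
  have hin := fun {φ : EN N → ℝ} {ε : ℝ} (hε : 0 < ε) {x : EN N} (hx : x ≠ 0) (hxR : ‖x‖ ≤ R0) => test_inner (φ := φ) (t := t) hN hs hK hM (by linarith) hε hx hxR hK1 hK2 (fun h hh => hM' x h hx hh)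
  set A := ∫ z in ball (0:EN N) 1, ‖z‖^(2-((N:ℝ)+2*s)) with hA
  have hA0 : 0 ≤ A := integral_nonneg fun z => by positivity
  clear_value A
  set p : ℝ := (N:ℝ)+2*s with hp
  clear_value p
  have hq0 : 0 ≤ p - δ := by linarith
  obtain ⟨Q, hQ⟩ := aa_le hN hq0 ht (by linarith : t - (p-δ) < -(N:ℝ)) one_pos 5
  have hQ0 : 0 ≤ Q := le_trans (integral_nonneg fun z => wk_nonneg one_pos _ z) (hQ 0 (by simp))
  set a := t+δ-2*s with ha
  have ha0 : a < 0 := by linarith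
  clear_value a
  refine ⟨(K*(R0+2*M)*A*R0^(1-δ) + 2*K*Q)*5^(-a), by positivity, fun ε hε x hx hxR => ?_⟩
  have hx0 : 0 < ‖x‖ := norm_pos_iff.2 hx
  set m := max ‖x‖ ε with hm
  have hm0 : 0 < m := lt_max_of_lt_left hx0
  have hmx : ‖x‖ ≤ m := le_max_left _ _
  have hmε : ε ≤ m := le_max_right _ _
  have hmor : ∀ y, ‖x‖ ≤ y → ε ≤ y → m ≤ y := fun y h1 h2 => max_le h1 h2
  clear_value m
  set w : EN N → ℝ := fun z => (ξ x - ξ z) * wk p ε t x z with hw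
  have hwi : Integrable w := Iop_int hN ht (by linarith) hε x h2.continuous.measurable hKb
  have hI : Iop p ε t ξ x = (∫ z, (ball x (‖x‖/5)).indicator w z) + ∫ z, (ball x (‖x‖/5))ᶜ.indicator w z := by
    rw [integral_indicator measurableSet_ball, integral_indicator measurableSet_ball.compl, integral_add_compl measurableSet_ball hwi]; rfl
  have hdm : (m/5)^a = m^a*5^(-a) := by
    rw [Real.div_rpow hm0.le (by norm_num), Real.rpow_neg (by norm_num)]; rfl
  have hin1 : |∫ z, (ball x (‖x‖/5)).indicator w z| ≤ K*(R0+2*M)*A*R0^(1-δ)*(m/5)^a := by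
    rcases le_or_gt (‖x‖/5) ε with h | h
    · have : ∀ z, (ball x (‖x‖/5)).indicator w z = 0 := fun z => by
        by_cases hz : z ∈ ball x (‖x‖/5)
        · rw [indicator_of_mem hz, hw]
          rw [mem_ball, dist_comm] at hz
          simp only [wk, kr, if_neg (not_le.2 (hz.trans_le h)), mul_zero]
        · rw [indicator_of_notMem hz]
      simp only [this, integral_zero, abs_zero]; positivity
    · refine (hin hε hx hxR (fun z => rfl) (hwi.indicator measurableSet_ball)).trans ?_
      have h1 : ‖x‖^(t-1)*(‖x‖/5)^(2-2*s) ≤ R0^(1-δ)*(m/5)^a := by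
        have h5 : m/5 ≤ ‖x‖ := by
          have := hmor (5*‖x‖) (by linarith) (by linarith)
          linarith
        calc ‖x‖^(t-1)*(‖x‖/5)^(2-2*s) ≤ ‖x‖^(t-1)*‖x‖^(2-2*s) := by
              refine mul_le_mul_of_nonneg_left (Real.rpow_le_rpow (by positivity) (by linarith) (by linarith)) (by positivity)
          _ = ‖x‖^(1-δ)*‖x‖^a := by
              rw [← Real.rpow_add hx0, ← Real.rpow_add hx0, ha]; congr 1; ring
          _ ≤ R0^(1-δ)*(m/5)^a := by
              refine mul_le_mul (Real.rpow_le_rpow hx0.le hxR (by linarith)) ?_ (by positivity) (by positivity)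
              exact Real.rpow_le_rpow_of_nonpos (by positivity) h5 ha0.le
      calc _ ≤ K*(R0+2*M)*A*(R0^(1-δ)*(m/5)^a) := by gcongr
        _ = _ := by ring
  have hout : |∫ z, (ball x (‖x‖/5))ᶜ.indicator w z| ≤ 2*K*Q*(m/5)^a := by
    set ρ := max ε (‖x‖/5) with hρ
    have hρ0 : 0 < ρ := lt_max_of_lt_left hε
    have hρm : m/5 ≤ ρ := by
      have h1 : ‖x‖/5 ≤ ρ := le_max_right _ _
      have h2 : ε ≤ ρ := le_max_left _ _
      have := hmor (5*ρ) (by linarith) (by linarith)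
      linarith
    have h1 : |∫ z, (ball x (‖x‖/5))ᶜ.indicator w z| ≤ ∫ z, 2*K*wk (p-δ) ρ t x z := by
      rw [← Real.norm_eq_abs]
      refine norm_integral_le_of_norm_le ((wk_int hN ht (by linarith) hρ0 x).const_mul _) (Eventually.of_forall fun z => ?_)
      have hwn := wk_nonneg (p := p-δ) (t := t) hρ0 x z
      by_cases hz : z ∈ ball x (‖x‖/5)
      · rw [indicator_of_notMem (by simpa using hz), norm_zero]; positivity
      · rw [indicator_of_mem (by simpa using hz), hw]
        rw [mem_ball, dist_comm, not_lt] at hz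
        rcases lt_or_ge (dist x z) ε with he | he
        · simp only [wk, kr, if_neg (not_le.2 he), mul_zero, norm_zero]
          exact mul_nonneg (by positivity) (mul_nonneg (by positivity) (kr_nonneg hρ0))
        · have hd : ρ ≤ dist x z := max_le he hz
          have hd0 : 0 < dist x z := hρ0.trans_le hd
          simp only [wk, kr, if_pos he, if_pos hd]
          have h3 : |ξ x - ξ z| ≤ 2*K*dist x z^δ := by
            rcases le_total (dist x z) 1 with hd1 | hd1
            · refine (hK1 x z).trans ?_
              have : dist x z ≤ dist x z^δ := by
                conv_lhs => rw [← Real.rpow_one (dist x z)]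
                exact Real.rpow_le_rpow_of_exponent_ge hd0 hd1 hδ1
              have h4 : K*dist x z ≤ K*dist x z^δ := by gcongr
              have h5 : 0 ≤ K*dist x z^δ := by positivity
              linarith
            · have h4 : |ξ x - ξ z| ≤ 2*K := by
                refine (abs_sub _ _).trans ?_
                linarith [hKb x, hKb z]
              have h5 : 1 ≤ dist x z^δ := Real.one_le_rpow hd1 hδ.le
              nlinarith
          have h6 : dist x z^p = dist x z^(p-δ)*dist x z^δ := by rw [← Real.rpow_add hd0]; congr 1; ring
          rw [norm_mul, Real.norm_eq_abs, Real.norm_of_nonneg (by positivity), h6, mul_inv]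
          calc |ξ x - ξ z| * (‖z‖^t*((dist x z^(p-δ))⁻¹*(dist x z^δ)⁻¹)) ≤ (2*K*dist x z^δ)*(‖z‖^t*((dist x z^(p-δ))⁻¹*(dist x z^δ)⁻¹)) := by gcongr
            _ = _ := by field_simp
    refine h1.trans ?_
    rw [integral_const_mul]
    have h4 : ∫ z, wk (p-δ) ρ t x z = ρ^a * aa (p-δ) 1 t (ρ⁻¹ • x) := by
      have := aa_scale (p-δ) t hρ0 x
      rw [aa] at this
      rw [this]; congr 2; rw [hp, ha]; ring
    have h5 : aa (p-δ) 1 t (ρ⁻¹ • x) ≤ Q := by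
      refine hQ _ ?_
      rw [norm_smul, Real.norm_of_nonneg (by positivity), inv_mul_le_iff₀ hρ0]
      have : ‖x‖/5 ≤ ρ := le_max_right _ _
      linarith
    rw [h4]
    have h6 : ρ^a ≤ (m/5)^a := Real.rpow_le_rpow_of_nonpos (by positivity) hρm ha0.le
    calc 2*K*(ρ^a*aa (p-δ) 1 t (ρ⁻¹ • x)) ≤ 2*K*((m/5)^a*Q) := by
          gcongr
          exact integral_nonneg fun z => wk_nonneg one_pos _ z
      _ = _ := by ring
  rw [hI]
  refine (abs_add_le _ _).trans ?_
  rw [hdm] at hin1 hout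
  linarith

lemma ball_int_pos {N : ℕ} (hN : 2 ≤ N) {t r : ℝ} (ht : -(N:ℝ) < t) (hr : 0 < r) : 0 < ∫ z in ball (0:EN N) r, ‖z‖^t := by
  have h := ann_integral_pos hN t (by positivity : 0 < r/4)
  refine h.trans_le (setIntegral_mono_set (int_rpow_ball hN ht r) (Eventually.of_forall fun z => by simp only [Pi.zero_apply]; positivity) (Eventually.of_forall fun z hz => ?_))
  have h2 : ‖z‖ ≤ 3*(r/4) := hz.2
  show z ∈ ball (0:EN N) r
  rw [mem_ball_zero_iff]; linarith

def fseq {N : ℕ} (f : EN N → ℝ) (κ t : ℝ) (n : ℕ) (x : EN N) : ℝ :=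
  min (f x) n + κ/(∫ z in ball (0:EN N) (1/((n:ℝ)+1)), ‖z‖^t) * (ball (0:EN N) (1/((n:ℝ)+1))).indicator (fun _ => (1:ℝ)) x

lemma fseq_meas {N : ℕ} {f : EN N → ℝ} (hf : Measurable f) (κ t : ℝ) (n : ℕ) : Measurable (fseq f κ t n) := by
  unfold fseq
  exact (hf.min measurable_const).add ((measurable_const.indicator measurableSet_ball).const_mul _)

lemma fseq_nonneg {N : ℕ} {f : EN N → ℝ} (hf : ∀ x, 0 ≤ f x) {κ : ℝ} (hκ : 0 ≤ κ) (t : ℝ) (n : ℕ) (x : EN N) : 0 ≤ fseq f κ t n x := by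
  unfold fseq
  have h1 : 0 ≤ min (f x) n := le_min (hf x) (by positivity)
  have h2 : 0 ≤ ∫ z in ball (0:EN N) (1/((n:ℝ)+1)), ‖z‖^t := integral_nonneg fun z => by positivity
  have h3 : 0 ≤ (ball (0:EN N) (1/((n:ℝ)+1))).indicator (fun _ => (1:ℝ)) x := indicator_nonneg (fun _ _ => by norm_num) x
  positivity

lemma fseq_bdd {N : ℕ} (f : EN N → ℝ) {κ : ℝ} (hκ : 0 ≤ κ) (t : ℝ) (n : ℕ) : ∃ F, ∀ x : EN N, fseq f κ t n x ≤ F := by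
  refine ⟨n + κ/(∫ z in ball (0:EN N) (1/((n:ℝ)+1)), ‖z‖^t), fun x => ?_⟩
  unfold fseq
  have h2 : 0 ≤ ∫ z in ball (0:EN N) (1/((n:ℝ)+1)), ‖z‖^t := integral_nonneg fun z => by positivity
  have h3 : (ball (0:EN N) (1/((n:ℝ)+1))).indicator (fun _ => (1:ℝ)) x ≤ 1 := indicator_le_self' (fun _ _ => by norm_num) x
  have h4 : 0 ≤ κ/(∫ z in ball (0:EN N) (1/((n:ℝ)+1)), ‖z‖^t) := by positivity
  have := min_le_right (f x) (n:ℝ)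
  nlinarith

lemma fseq_parts {N : ℕ} (hN : 2 ≤ N) {t : ℝ} (ht : -(N:ℝ) < t) {Ω : Set (EN N)}
    {f : EN N → ℝ} (hfm : Measurable f) (hf : ∀ x, 0 ≤ f x) (hfi : IntegrableOn (fun x => f x * ‖x‖^t) Ω) (κ : ℝ) (n : ℕ) :
    IntegrableOn (fun x => min (f x) n * ‖x‖^t) Ω ∧
    Integrable (fun x : EN N => κ/(∫ z in ball (0:EN N) (1/((n:ℝ)+1)), ‖z‖^t) * (ball (0:EN N) (1/((n:ℝ)+1))).indicator (fun x => ‖x‖^t) x) := by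
  constructor
  · refine hfi.mono' ((hfm.min measurable_const).mul (by fun_prop)).aestronglyMeasurable (Eventually.of_forall fun x => ?_)
    have h1 : 0 ≤ min (f x) n := le_min (hf x) (by positivity)
    rw [Real.norm_of_nonneg (by positivity)]
    gcongr; exact min_le_left _ _
  · exact ((integrable_indicator_iff measurableSet_ball).2 (int_rpow_ball hN ht _)).const_mul _

lemma fseq_eq {N : ℕ} (f : EN N → ℝ) (κ t : ℝ) (n : ℕ) (x : EN N) : fseq f κ t n x * ‖x‖^t = min (f x) n * ‖x‖^t +
    κ/(∫ z in ball (0:EN N) (1/((n:ℝ)+1)), ‖z‖^t) * (ball (0:EN N) (1/((n:ℝ)+1))).indicator (fun x => ‖x‖^t) x := by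
  unfold fseq
  by_cases hx : x ∈ ball (0:EN N) (1/((n:ℝ)+1))
  · rw [indicator_of_mem hx, indicator_of_mem hx]; ring
  · rw [indicator_of_notMem hx, indicator_of_notMem hx]; ring

lemma fseq_int {N : ℕ} (hN : 2 ≤ N) {t : ℝ} (ht : -(N:ℝ) < t) {Ω : Set (EN N)}
    {f : EN N → ℝ} (hfm : Measurable f) (hf : ∀ x, 0 ≤ f x) (hfi : IntegrableOn (fun x => f x * ‖x‖^t) Ω) {κ : ℝ} (hκ : 0 ≤ κ) (n : ℕ) :
    IntegrableOn (fun x => fseq f κ t n x * ‖x‖^t) Ω ∧ ∫ x in Ω, fseq f κ t n x * ‖x‖^t ≤ (∫ x in Ω, f x * ‖x‖^t) + κ := by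
  obtain ⟨h1, h2⟩ := fseq_parts hN ht hfm hf hfi κ n
  have hv := ball_int_pos hN ht (by positivity : 0 < 1/((n:ℝ)+1))
  simp only [fseq_eq]
  refine ⟨h1.add h2.integrableOn, ?_⟩
  rw [integral_add h1 h2.integrableOn]
  refine add_le_add ?_ ?_
  · refine integral_mono h1 hfi fun x => ?_
    simp only
    gcongr; exact min_le_left _ _
  · refine (setIntegral_le_integral h2 (Eventually.of_forall fun x => ?_)).trans_eq ?_
    · simp only [Pi.zero_apply]
      exact mul_nonneg (by positivity) (indicator_nonneg (fun _ _ => by positivity) x)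
    · rw [integral_const_mul, integral_indicator measurableSet_ball]; field_simp

lemma fseq_tendsto {N : ℕ} (hN : 2 ≤ N) {t : ℝ} (ht : -(N:ℝ) < t) {Ω : Set (EN N)}
    {f : EN N → ℝ} (hfm : Measurable f) (hf : ∀ x, 0 ≤ f x) (hfi : IntegrableOn (fun x => f x * ‖x‖^t) Ω) {κ : ℝ} (hκ : 0 ≤ κ)
    {ξ : EN N → ℝ} (hc2 : ContDiff ℝ 2 ξ) (hc : HasCompactSupport ξ) (hξ : ∀ x ∉ Ω, ξ x = 0) :
    Tendsto (fun n => ∫ x in Ω, fseq f κ t n x * ξ x * ‖x‖^t) atTop (𝓝 ((∫ x in Ω, f x * ξ x * ‖x‖^t) + κ * ξ 0)) := by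
  obtain ⟨K, hK, hKb, hK1, -⟩ := c2_bounds hc2 hc
  have hξm : Measurable ξ := hc2.continuous.measurable
  have hp := fun n => fseq_parts hN ht hfm hf hfi κ n
  have i1 : ∀ n : ℕ, IntegrableOn (fun x => ξ x * (min (f x) n * ‖x‖^t)) Ω := fun n =>
    (hp n).1.bdd_mul hξm.aestronglyMeasurable (Eventually.of_forall hKb)
  have i2 : ∀ n : ℕ, Integrable (fun x : EN N => ξ x * (κ/(∫ z in ball (0:EN N) (1/((n:ℝ)+1)), ‖z‖^t) * (ball (0:EN N) (1/((n:ℝ)+1))).indicator (fun x => ‖x‖^t) x)) := fun n =>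
    (hp n).2.bdd_mul hξm.aestronglyMeasurable (Eventually.of_forall hKb)
  have e : ∀ n : ℕ, ∫ x in Ω, fseq f κ t n x * ξ x * ‖x‖^t = (∫ x in Ω, ξ x * (min (f x) n * ‖x‖^t)) +
      ∫ x : EN N, ξ x * (κ/(∫ z in ball (0:EN N) (1/((n:ℝ)+1)), ‖z‖^t) * (ball (0:EN N) (1/((n:ℝ)+1))).indicator (fun x => ‖x‖^t) x) := fun n => by
    have h3 := setIntegral_eq_integral_of_forall_compl_eq_zero (μ := volume) (s := Ω) (f := fun x : EN N => ξ x * (κ/(∫ z in ball (0:EN N) (1/((n:ℝ)+1)), ‖z‖^t) * (ball (0:EN N) (1/((n:ℝ)+1))).indicator (fun x => ‖x‖^t) x)) (fun x hx => by rw [hξ x hx, zero_mul])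
    rw [← h3, ← integral_add (i1 n) (i2 n).integrableOn]
    congr 1; ext x
    rw [← mul_add, ← fseq_eq]; ring
  simp only [e]
  refine Tendsto.add ?_ ?_
  · refine tendsto_integral_of_dominated_convergence (fun x => K * (f x * ‖x‖^t)) (fun n => (i1 n).aestronglyMeasurable) (hfi.const_mul K) (fun n => Eventually.of_forall fun x => ?_) (Eventually.of_forall fun x => ?_)
    · have h1 : 0 ≤ min (f x) n := le_min (hf x) (by positivity)
      rw [norm_mul, Real.norm_of_nonneg (by positivity : 0 ≤ min (f x) n * ‖x‖^t)]
      have := hKb x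
      rw [Real.norm_eq_abs]
      gcongr; exact min_le_left _ _
    · refine tendsto_const_nhds.congr' ?_
      filter_upwards [eventually_ge_atTop (Nat.ceil (f x))] with n hn
      have : f x ≤ n := (Nat.le_ceil _).trans (by exact_mod_cast hn)
      rw [min_eq_left this]; ring
  · have hb : ∀ n : ℕ, |(∫ x : EN N, ξ x * (κ/(∫ z in ball (0:EN N) (1/((n:ℝ)+1)), ‖z‖^t) * (ball (0:EN N) (1/((n:ℝ)+1))).indicator (fun x => ‖x‖^t) x)) - κ * ξ 0| ≤ κ*K*(1/((n:ℝ)+1)) := fun n => by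
      have hv := ball_int_pos hN ht (by positivity : 0 < 1/((n:ℝ)+1))
      have e1 : ∫ x : EN N, (κ/(∫ z in ball (0:EN N) (1/((n:ℝ)+1)), ‖z‖^t) * (ball (0:EN N) (1/((n:ℝ)+1))).indicator (fun x => ‖x‖^t) x) = κ := by
        rw [integral_const_mul, integral_indicator measurableSet_ball]; field_simp
      have i3 := (hp n).2
      set w : EN N → ℝ := fun x => κ/(∫ z in ball (0:EN N) (1/((n:ℝ)+1)), ‖z‖^t) * (ball (0:EN N) (1/((n:ℝ)+1))).indicator (fun x => ‖x‖^t) x with hw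
      have i2n : Integrable fun x => ξ x * w x := i2 n
      change |(∫ x, ξ x * w x) - κ * ξ 0| ≤ _
      have hw0 : ∀ x, 0 ≤ w x := fun x => mul_nonneg (by positivity) (indicator_nonneg (fun _ _ => by positivity) x)
      have hwo : ∀ x ∉ ball (0:EN N) (1/((n:ℝ)+1)), w x = 0 := fun x hx => by rw [hw]; simp only [indicator_of_notMem hx, mul_zero]
      clear_value w
      have e2 : (∫ x, ξ x * w x) - κ * ξ 0 = ∫ x, (ξ x - ξ 0) * w x := by
        have : κ * ξ 0 = ∫ x, ξ 0 * w x := by rw [integral_const_mul, e1]; ring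
        rw [this, ← integral_sub i2n (i3.const_mul _)]
        congr 1; ext x; ring
      rw [e2, ← Real.norm_eq_abs]
      have e3 : κ*K*(1/((n:ℝ)+1)) = ∫ x, K*(1/((n:ℝ)+1)) * w x := by rw [integral_const_mul, e1]; ring
      rw [e3]
      refine norm_integral_le_of_norm_le (i3.const_mul _) (Eventually.of_forall fun x => ?_)
      rw [norm_mul, Real.norm_of_nonneg (hw0 x), Real.norm_eq_abs]
      by_cases hx : x ∈ ball (0:EN N) (1/((n:ℝ)+1))
      · refine mul_le_mul_of_nonneg_right ((hK1 x 0).trans ?_) (hw0 x)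
        rw [mem_ball] at hx
        gcongr
      · rw [hwo x hx, mul_zero, mul_zero]
    rw [tendsto_iff_dist_tendsto_zero]
    refine squeeze_zero (fun n => dist_nonneg) hb ?_
    have := (tendsto_one_div_add_atTop_nhds_zero_nat (𝕜 := ℝ)).const_mul (κ*K)
    simpa using this

/-- weak limits of sequences bounded between zero and one -/
lemma weak_lim {X : Type*} [MeasurableSpace X] (ν : Measure X) [IsFiniteMeasure ν] (h : ℕ → X → ℝ)
    (hm : ∀ n, Measurable (h n)) (h0 : ∀ n x, 0 ≤ h n x) (h1 : ∀ n x, h n x ≤ 1) :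
    ∃ w : X → ℝ, Measurable w ∧ (∀ x, 0 ≤ w x) ∧ (∀ x, w x ≤ 1) ∧
      ∀ g : X → ℝ, Measurable g → (∃ B, ∀ x, |g x| ≤ B) →
        Tendsto (fun n => ∫ x, h n x * g x ∂ν) (hyperfilter ℕ : Filter ℕ) (𝓝 (∫ x, w x * g x ∂ν)) := by
  have hb : ∀ {g : X → ℝ}, Measurable g → (∃ B, ∀ x, |g x| ≤ B) → MemLp g 2 ν := fun {g} hg ⟨B, hB⟩ =>
    MemLp.of_bound hg.aestronglyMeasurable B (Eventually.of_forall hB)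
  have hab : ∀ n x, |h n x| ≤ 1 := fun n x => by rw [abs_of_nonneg (h0 n x)]; exact h1 n x
  have hL : ∀ n, MemLp (h n) 2 ν := fun n => hb (hm n) ⟨1, hab n⟩
  set v : ℕ → Lp ℝ 2 ν := fun n => (hL n).toLp with hv
  obtain ⟨B, hB⟩ : ∃ B : ℝ, ∀ n, ‖v n‖ ≤ B := by
    refine ⟨(measureUnivNNReal ν : ℝ)^((2:ENNReal).toReal)⁻¹ * 1, fun n => ?_⟩
    refine Lp.norm_le_of_ae_bound zero_le_one ?_
    filter_upwards [(hL n).coeFn_toLp] with x hx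
    rw [hx]; exact hab n x
  have hcpt := WeakDual.isCompact_closedBall (𝕜 := ℝ) (E := Lp ℝ 2 ν) 0 B
  set Fn : ℕ → WeakDual ℝ (Lp ℝ 2 ν) := fun n => StrongDual.toWeakDual (InnerProductSpace.toDual ℝ (Lp ℝ 2 ν) (v n)) with hFn
  have hmem : ∀ n, Fn n ∈ WeakDual.toStrongDual ⁻¹' closedBall (0 : StrongDual ℝ (Lp ℝ 2 ν)) B := fun n => by
    show InnerProductSpace.toDual ℝ (Lp ℝ 2 ν) (v n) ∈ closedBall (0 : StrongDual ℝ (Lp ℝ 2 ν)) B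
    rw [mem_closedBall_zero_iff, LinearIsometryEquiv.norm_map]; exact hB n
  obtain ⟨ℓ, -, hℓ⟩ := hcpt.ultrafilter_le_nhds ((hyperfilter ℕ).map Fn) (by
    rw [le_principal_iff]; exact Ultrafilter.mem_map.2 (Filter.mem_of_superset univ_mem fun n _ => hmem n))
  have hℓ' : Tendsto Fn (hyperfilter ℕ : Filter ℕ) (𝓝 ℓ) := hℓ
  set w0 : Lp ℝ 2 ν := (InnerProductSpace.toDual ℝ (Lp ℝ 2 ν)).symm (WeakDual.toStrongDual ℓ) with hw0
  have hlim : ∀ g : X → ℝ, Measurable g → (∃ B, ∀ x, |g x| ≤ B) →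
      Tendsto (fun n => ∫ x, h n x * g x ∂ν) (hyperfilter ℕ : Filter ℕ) (𝓝 (∫ x, w0 x * g x ∂ν)) := fun g hg hgB => by
    have hgL := hb hg hgB
    have h2 := ((WeakDual.eval_continuous (𝕜 := ℝ) (hgL.toLp)).tendsto ℓ).comp hℓ'
    have e1 : ∀ n, (Fn n) hgL.toLp = ∫ x, h n x * g x ∂ν := fun n => by
      have : (Fn n) hgL.toLp = inner ℝ (v n) hgL.toLp := by
        exact InnerProductSpace.toDual_apply_apply
      rw [this, L2.inner_def]
      refine integral_congr_ae ?_
      filter_upwards [(hL n).coeFn_toLp, hgL.coeFn_toLp] with x hx hx2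
      rw [hx, hx2]; simp [mul_comm]
    have e2 : ℓ hgL.toLp = ∫ x, w0 x * g x ∂ν := by
      have : ℓ hgL.toLp = inner ℝ w0 hgL.toLp := by
        rw [hw0, InnerProductSpace.toDual_symm_apply]; rfl
      rw [this, L2.inner_def]
      refine integral_congr_ae ?_
      filter_upwards [hgL.coeFn_toLp] with x hx2
      rw [hx2]; simp [mul_comm]
    rw [← e2]
    refine h2.congr fun n => ?_
    simp only [Function.comp]
    exact e1 n
  have hw0i : Integrable w0 ν := (Lp.memLp w0).integrable (by norm_num)
  have hset : ∀ s, MeasurableSet s → Tendsto (fun n => ∫ x in s, h n x ∂ν) (hyperfilter ℕ : Filter ℕ) (𝓝 (∫ x in s, w0 x ∂ν)) := fun s hs => by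
    have := hlim (s.indicator fun _ => 1) (measurable_const.indicator hs) ⟨1, fun x => by
      by_cases hx : x ∈ s <;> simp [hx]⟩
    have e : ∀ f : X → ℝ, ∫ x, f x * s.indicator (fun _ => 1) x ∂ν = ∫ x in s, f x ∂ν := fun f => by
      rw [← integral_indicator hs]; congr 1; ext x
      by_cases hx : x ∈ s <;> simp [hx]
    simpa only [e] using this
  have hn0 : 0 ≤ᵐ[ν] w0 := by
    refine ae_nonneg_of_forall_setIntegral_nonneg hw0i fun s hs _ => ?_
    exact ge_of_tendsto (hset s hs) (Eventually.of_forall fun n => integral_nonneg fun x => h0 n x)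
  have hn1 : w0 ≤ᵐ[ν] fun _ => 1 := by
    refine ae_le_of_forall_setIntegral_le hw0i (integrable_const _) fun s hs _ => ?_
    refine le_of_tendsto (hset s hs) (Eventually.of_forall fun n => ?_)
    exact integral_mono ((hL n).integrable (by norm_num)).integrableOn (integrable_const _) fun x => h1 n x
  have hw0m := (Lp.stronglyMeasurable w0).measurable
  refine ⟨fun x => max 0 (min 1 (w0 x)), measurable_const.max (measurable_const.min hw0m), fun x => le_max_left _ _, fun x => max_le zero_le_one (min_le_left _ _), fun g hg hgB => ?_⟩
  have : ∫ x, max 0 (min 1 (w0 x)) * g x ∂ν = ∫ x, w0 x * g x ∂ν := by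
    refine integral_congr_ae ?_
    filter_upwards [hn0, hn1] with x hx0 hx1
    have hx0' : 0 ≤ w0 x := hx0
    rw [min_eq_right hx1, max_eq_right hx0']
  rw [this]
  exact hlim g hg hgB

set_option maxHeartbeats 1000000 in
lemma seq_exists {N : ℕ} (hN : 2 ≤ N) {s t δ R0 : ℝ} (hs : s ∈ Ioo (0:ℝ) 1) (ht : (2*s-N)/2 ≤ t) (hδ : 0 < δ) (hts : t + δ < 2*s) (hR0 : 1 ≤ R0)
    {Ω : Set (EN N)} (hΩm : MeasurableSet Ω) (hΩ : Ω ⊆ ball 0 R0)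
    {f : EN N → ℝ} (hfm : Measurable f) (hf : ∀ x, 0 ≤ f x) (hfi : IntegrableOn (fun x => f x * ‖x‖^t) Ω)
    (hfb : ∀ r > 0, ∃ F, ∀ x ∈ Ω, r ≤ ‖x‖ → f x ≤ F) {κ : ℝ} (hκ : 0 ≤ κ) :
    ∃ (ε : ℕ → ℝ) (S : ℕ → EN N → ℝ) (R A : ℝ), 1 ≤ R ∧ 0 ≤ A ∧ (∀ n, 0 < ε n) ∧ Tendsto ε atTop (𝓝 0) ∧
      (∀ n, Measurable (S n)) ∧ (∀ n x, 0 ≤ S n x) ∧ (∀ n, ∃ B, ∀ x, S n x ≤ B) ∧ (∀ n, ∀ x ∉ Ω, S n x = 0) ∧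
      (∀ n, ∀ x ∈ Ω, Iop ((N:ℝ)+2*s) (ε n) t (S n) x = fseq f κ t n x) ∧
      (∀ n, Integrable (fun x => S n x * ‖x‖^t * (max ‖x‖ (R*ε n))^(t+δ-2*s))) ∧
      (∀ n, ∫ x, S n x * ‖x‖^t * (max ‖x‖ (R*ε n))^(t+δ-2*s) ≤ A) ∧
      ∀ r > 0, ∃ M, 0 ≤ M ∧ ∀ n x, r ≤ ‖x‖ → S n x ≤ M := by
  have hN2 : (2:ℝ) ≤ N := by exact_mod_cast hN
  have hs0 := hs.1
  have hs1 := hs.2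
  have ht' : -(N:ℝ) < t := by linarith
  obtain ⟨R, C, hR, hC, hen⟩ := energy1 hN hs ht hδ hts hR0
  have hlb := fun {r F L : ℝ} => local_bound (r := r) (F := F) (L := L) hN hs ht' (by linarith) hR0
  set p : ℝ := (N:ℝ)+2*s with hp
  clear_value p
  have hp0 : 0 ≤ p := by linarith
  obtain ⟨k, hk0, hk⟩ := kappa hN (p := p) (t := t) hp0 ht' (by linarith) hR0
  set ε : ℕ → ℝ := fun n => 1/((n:ℝ)+1)*R⁻¹ with hε
  have hε0 : ∀ n, 0 < ε n := fun n => by rw [hε]; positivity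
  have hRε : ∀ n, R*ε n = 1/((n:ℝ)+1) := fun n => by simp only [hε]; field_simp
  have h1n : ∀ n : ℕ, 1/((n:ℝ)+1) ≤ 1 := fun n => by
    rw [div_le_one (by positivity)]; have : (0:ℝ) ≤ n := n.cast_nonneg
    linarith
  have hεR : ∀ n, ε n ≤ 1/((n:ℝ)+1) := fun n => by
    rw [← hRε]; have := hε0 n; nlinarith
  have hε1 : ∀ n, ε n ≤ 1 := fun n => (hεR n).trans (h1n n)
  have ht0 : Tendsto (fun n : ℕ => 1/((n:ℝ)+1)) atTop (𝓝 0) := tendsto_one_div_add_atTop_nhds_zero_nat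
  have hεt : Tendsto ε atTop (𝓝 0) := squeeze_zero (fun n => (hε0 n).le) hεR ht0
  clear_value ε
  have hex : ∀ n, ∃ S : EN N → ℝ, Measurable S ∧ (∀ x, 0 ≤ S x) ∧ (∃ B, ∀ x, S x ≤ B) ∧ (∀ x ∉ Ω, S x = 0) ∧ ∀ x ∈ Ω, Iop p (ε n) t S x = fseq f κ t n x := fun n => by
    obtain ⟨F, hF⟩ := fseq_bdd f hκ t n
    obtain ⟨S, h1, h2, h3, h4, h5⟩ := exist_discrete hN ht' (by linarith : t - p < -(N:ℝ)) (hε0 n) hΩm hΩ hR0 hk0 (hk (ε n) (hε0 n) (hε1 n)) (fseq_meas hfm κ t n) (fseq_nonneg hf hκ t n) hF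
    exact ⟨S, h1, h2, ⟨_, h3⟩, h4, h5⟩
  choose S hSm hS0 hSB hSΩ hSI using hex
  choose B hB using hSB
  set A0 := (∫ x in Ω, f x * ‖x‖^t) + κ with hA0
  have hA00 : 0 ≤ A0 := add_nonneg (integral_nonneg fun x => by have := hf x; positivity) hκ
  have hE : ∀ n, Integrable (fun x => S n x * ‖x‖^t * (max ‖x‖ (R*ε n))^(t+δ-2*s)) ∧ ∫ x, S n x * ‖x‖^t * (max ‖x‖ (R*ε n))^(t+δ-2*s) ≤ C*A0 := fun n => by
    obtain ⟨hi, hle⟩ := fseq_int hN ht' hfm hf hfi hκ n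
    obtain ⟨h1, h2⟩ := hen (ε n) (hε0 n) (hε1 n) (by rw [hRε]; exact h1n n) Ω hΩm hΩ (S n) (fseq f κ t n) (B n) (hSm n) (hS0 n) (hB n) (hSΩ n) (fseq_nonneg hf hκ t n) hi (hSI n)
    exact ⟨h1, h2.trans (by gcongr)⟩
  refine ⟨ε, S, R, C*A0, hR, by positivity, hε0, hεt, hSm, hS0, fun n => ⟨B n, hB n⟩, hSΩ, hSI, fun n => (hE n).1, fun n => (hE n).2, fun r hr => ?_⟩
  set L := R0^(-(t+δ-2*s))*(C*A0) with hL
  have hL0 : 0 ≤ L := by positivity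
  have hLn : ∀ n, ∫ x, S n x * ‖x‖^t ≤ L := fun n => by
    have hle : ∀ x, S n x * ‖x‖^t ≤ R0^(-(t+δ-2*s)) * (S n x * ‖x‖^t * (max ‖x‖ (R*ε n))^(t+δ-2*s)) := fun x => by
      by_cases hx : x ∈ Ω
      · have hxR : ‖x‖ ≤ R0 := by have := hΩ hx; rw [mem_ball_zero_iff] at this; exact this.le
        have hm : max ‖x‖ (R*ε n) ≤ R0 := max_le hxR (by rw [hRε]; exact (h1n n).trans hR0)
        have hm0 : 0 < max ‖x‖ (R*ε n) := lt_max_of_lt_right (mul_pos (by linarith) (hε0 n))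
        have h1 : R0^(t+δ-2*s) ≤ (max ‖x‖ (R*ε n))^(t+δ-2*s) := Real.rpow_le_rpow_of_nonpos hm0 hm (by linarith)
        have h2 : 1 ≤ R0^(-(t+δ-2*s)) * (max ‖x‖ (R*ε n))^(t+δ-2*s) := by
          rw [Real.rpow_neg (by linarith), inv_mul_eq_div, one_le_div (by positivity)]; exact h1
        have h3 : 0 ≤ S n x * ‖x‖^t := mul_nonneg (hS0 n x) (by positivity)
        nlinarith
      · rw [hSΩ n x hx]; simp
    refine (integral_mono_of_nonneg (Eventually.of_forall fun x => ?_) ((hE n).1.const_mul _) (Eventually.of_forall hle)).trans ?_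
    · exact mul_nonneg (hS0 n x) (by positivity)
    · rw [integral_const_mul]; exact mul_le_mul_of_nonneg_left (hE n).2 (by positivity)
  set r' := min (r/2) 1 with hr'
  have hr'0 : 0 < r' := lt_min (by positivity) one_pos
  have hr'1 : r' ≤ 1 := min_le_right _ _
  have hr'2 : 2*r' ≤ r := by have : r' ≤ r/2 := min_le_left _ _; linarith
  clear_value r'
  obtain ⟨F, hF⟩ := hfb r' hr'0
  obtain ⟨M, e0, hM, he0, hloc⟩ := hlb (r := r') (F := max F 0) (L := L) hr'0 hr'1 (le_max_right _ _) hL0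
  obtain ⟨n0, hn0⟩ := eventually_atTop.1 ((hεt.eventually_lt_const he0).and (ht0.eventually_lt_const hr'0))
  have hsum : ∀ n, n < n0 → B n ≤ ∑ i ∈ Finset.range n0, |B i| := fun n hn =>
    (le_abs_self _).trans (Finset.single_le_sum (f := fun i => |B i|) (fun i _ => abs_nonneg _) (Finset.mem_range.2 hn))
  have hsum0 : 0 ≤ ∑ i ∈ Finset.range n0, |B i| := Finset.sum_nonneg fun i _ => abs_nonneg _
  refine ⟨M + ∑ i ∈ Finset.range n0, |B i|, by positivity, fun n x hx => ?_⟩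
  rcases lt_or_ge n n0 with hn | hn
  · have := hsum n hn
    have := hB n x
    linarith
  · obtain ⟨h1, h2⟩ := hn0 n hn
    have := hloc (ε n) (hε0 n) h1.le Ω hΩ (S n) (B n) (hSm n) (hS0 n) (hB n) (hSΩ n) (hLn n) (fun y hy hyr => ?_) x (hr'2.trans hx)
    · linarith
    · rw [hSI n y hy, fseq]
      have hyb : y ∉ ball (0:EN N) (1/((n:ℝ)+1)) := by rw [mem_ball_zero_iff]; linarith
      rw [indicator_of_notMem hyb, mul_zero, add_zero]
      exact (min_le_left _ _).trans ((hF y hy hyr).trans (le_max_left _ _))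

lemma bdd_supp_int {N : ℕ} {R0 B : ℝ} {Ω : Set (EN N)} (hΩ : Ω ⊆ ball 0 R0) {v : EN N → ℝ} (hv : Measurable v)
    (hB : ∀ x, |v x| ≤ B) (h0 : ∀ x ∉ Ω, v x = 0) : Integrable v := by
  have hB0 : 0 ≤ B := (abs_nonneg _).trans (hB 0)
  have h1 : Integrable ((ball (0:EN N) R0).indicator fun _ => B) :=
    (integrable_indicator_iff measurableSet_ball).2 (integrableOn_const measure_ball_lt_top.ne)
  refine h1.mono' hv.aestronglyMeasurable (Eventually.of_forall fun x => ?_)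
  by_cases hx : x ∈ ball (0:EN N) R0
  · rw [indicator_of_mem hx]; exact hB x
  · rw [h0 x fun h => hx (hΩ h), norm_zero, indicator_of_notMem hx]

set_option maxHeartbeats 1000000 in
lemma weak_u {N : ℕ} {t a R0 R A : ℝ} (ha : a < 0) (hR : 1 ≤ R)
    {Ω : Set (EN N)} (hΩm : MeasurableSet Ω) (hΩ : Ω ⊆ ball 0 R0) {ε : ℕ → ℝ} (hεt : Tendsto ε atTop (𝓝 0))
    {S : ℕ → EN N → ℝ} (hSm : ∀ n, Measurable (S n)) (hS0 : ∀ n x, 0 ≤ S n x) (hSΩ : ∀ n, ∀ x ∉ Ω, S n x = 0)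
    (hSi : ∀ n, Integrable (fun x => S n x * ‖x‖^t * (max ‖x‖ (R*ε n))^a))
    (hSA : ∀ n, ∫ x, S n x * ‖x‖^t * (max ‖x‖ (R*ε n))^a ≤ A)
    (hSM : ∀ r > 0, ∃ M, 0 ≤ M ∧ ∀ n x, r ≤ ‖x‖ → S n x ≤ M) :
    ∃ u : EN N → ℝ, Measurable u ∧ (∀ x, 0 ≤ u x) ∧ (∀ x ∉ Ω, u x = 0) ∧ (∀ r > 0, ∃ M, 0 ≤ M ∧ ∀ x, r ≤ ‖x‖ → u x ≤ M) ∧ u 0 = 0 ∧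
      Integrable (fun x => u x * ‖x‖^a) ∧
      ∀ r > 0, ∀ g : EN N → ℝ, Measurable g → (∃ B, ∀ x, |g x| ≤ B) → (∀ x, ‖x‖ < r → g x = 0) →
        Tendsto (fun n => ∫ x, S n x * ‖x‖^t * g x) (hyperfilter ℕ : Filter ℕ) (𝓝 (∫ x, u x * g x)) := by
  classical
  have hfin : IsFiniteMeasure (volume.restrict Ω) := ⟨by
    rw [Measure.restrict_apply_univ]; exact (measure_mono hΩ).trans_lt measure_ball_lt_top⟩
  set D : EN N → ℝ := fun x => 1 + ⨆ n, S n x with hD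
  have hDm : Measurable D := by rw [hD]; exact measurable_const.add (Measurable.iSup hSm)
  have hD1 : ∀ x, 1 ≤ D x := fun x => by
    have : 0 ≤ ⨆ n, S n x := Real.iSup_nonneg fun n => hS0 n x
    simp only [hD]; linarith
  have hSD : ∀ x, x ≠ 0 → ∀ n, S n x ≤ D x := fun x hx n => by
    obtain ⟨M, hM0, hM⟩ := hSM ‖x‖ (norm_pos_iff.2 hx)
    have : S n x ≤ ⨆ n, S n x := le_ciSup (f := fun n => S n x) ⟨M, by rintro _ ⟨m, rfl⟩; exact hM m x le_rfl⟩ n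
    simp only [hD]; linarith
  have hDM : ∀ r > 0, ∃ M, 0 ≤ M ∧ ∀ x, r ≤ ‖x‖ → D x ≤ M := fun r hr => by
    obtain ⟨M, hM0, hM⟩ := hSM r hr
    refine ⟨1+M, by linarith, fun x hx => ?_⟩
    have : ⨆ n, S n x ≤ M := ciSup_le fun n => hM n x hx
    simp only [hD]; linarith
  clear_value D
  obtain ⟨w, hwm, hw0, hw1, hwl⟩ := weak_lim (volume.restrict Ω) (fun n x => min (S n x / D x) 1)
    (fun n => ((hSm n).div hDm).min measurable_const)
    (fun n x => le_min (div_nonneg (hS0 n x) (by linarith [hD1 x])) zero_le_one) (fun n x => min_le_right _ _)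
  set u : EN N → ℝ := (Ω ∩ {0}ᶜ).indicator fun x => ‖x‖^t * D x * w x with hu
  have hum : Measurable u := (((by fun_prop : Measurable fun x : EN N => ‖x‖^t).mul hDm).mul hwm).indicator (hΩm.inter (measurableSet_singleton 0).compl)
  have huΩ : ∀ x ∉ Ω, u x = 0 := fun x hx => indicator_of_notMem (fun h => hx h.1) _
  have huz : u 0 = 0 := indicator_of_notMem (fun h => h.2 rfl) _
  have huin : ∀ x ∈ Ω, x ≠ 0 → u x = ‖x‖^t * D x * w x := fun x hx h0 => indicator_of_mem (show x ∈ Ω ∩ {0}ᶜ from ⟨hx, h0⟩) _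
  have hu0 : ∀ x, 0 ≤ u x := fun x => indicator_nonneg (fun x _ => mul_nonneg (mul_nonneg (by positivity) (by linarith [hD1 x])) (hw0 x)) x
  clear_value u
  have hxR : ∀ x ∈ Ω, ‖x‖ ≤ R0 := fun x hx => by have := hΩ hx; rw [mem_ball_zero_iff] at this; exact this.le
  have hDG : ∀ r > 0, ∃ M, 0 ≤ M ∧ ∀ x ∈ Ω, r ≤ ‖x‖ → ‖x‖^t * D x ≤ M := fun r hr => by
    obtain ⟨M, hM0, hM⟩ := hDM r hr
    rcases le_or_gt r R0 with h | h
    · obtain ⟨_, hi, _, hi0, hib⟩ := pow_bd t hr h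
      refine ⟨hi*M, by positivity, fun x hx hxr => ?_⟩
      have h1 := (hib ‖x‖ hxr (hxR x hx)).2
      have h2 := hM x hxr
      have h3 := hD1 x
      gcongr
    · exact ⟨0, le_rfl, fun x hx hxr => absurd (hxr.trans (hxR x hx)) (not_le.2 h)⟩
  have huM : ∀ r > 0, ∃ M, 0 ≤ M ∧ ∀ x, r ≤ ‖x‖ → u x ≤ M := fun r hr => by
    obtain ⟨M, hM0, hM⟩ := hDG r hr
    refine ⟨M, hM0, fun x hxr => ?_⟩
    by_cases hx : x ∈ Ω
    · have hx0 : x ≠ 0 := norm_pos_iff.1 (hr.trans_le hxr)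
      rw [huin x hx hx0]
      have h1 := hM x hx hxr
      have h2 : 0 ≤ ‖x‖^t * D x := mul_nonneg (by positivity) (by linarith [hD1 x])
      exact (mul_le_of_le_one_right h2 (hw1 x)).trans h1
    · rw [huΩ x hx]; exact hM0
  have key : ∀ r > 0, ∀ g : EN N → ℝ, Measurable g → (∃ B, ∀ x, |g x| ≤ B) → (∀ x, ‖x‖ < r → g x = 0) →
        Tendsto (fun n => ∫ x, S n x * ‖x‖^t * g x) (hyperfilter ℕ : Filter ℕ) (𝓝 (∫ x, u x * g x)) := by
    rintro r hr g hg ⟨B, hB⟩ hgr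
    obtain ⟨M, hM0, hM⟩ := hDG r hr
    have hB0 : 0 ≤ B := (abs_nonneg _).trans (hB 0)
    have h1 := hwl (Ω.indicator fun x => ‖x‖^t * D x * g x) ((((by fun_prop : Measurable fun x : EN N => ‖x‖^t).mul hDm).mul hg).indicator hΩm) ⟨M*B, fun x => by
      by_cases hx : x ∈ Ω
      · rw [indicator_of_mem hx]
        rcases lt_or_ge ‖x‖ r with h | h
        · rw [hgr x h, mul_zero, abs_zero]; positivity
        · rw [abs_mul, abs_of_nonneg (mul_nonneg (by positivity) (by linarith [hD1 x]) : 0 ≤ ‖x‖^t * D x)]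
          exact mul_le_mul (hM x hx h) (hB x) (abs_nonneg _) hM0
      · rw [indicator_of_notMem hx, abs_zero]; positivity⟩
    have e1 : ∀ n, ∫ x in Ω, min (S n x / D x) 1 * Ω.indicator (fun x => ‖x‖^t * D x * g x) x = ∫ x, S n x * ‖x‖^t * g x := fun n => by
      rw [← integral_indicator hΩm]
      congr 1; ext x
      by_cases hx : x ∈ Ω
      · simp only [indicator_of_mem hx]
        rcases lt_or_ge ‖x‖ r with h | h
        · rw [hgr x h]; ring
        · have hx0 : x ≠ 0 := norm_pos_iff.1 (hr.trans_le h)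
          have hDx : 0 < D x := by linarith [hD1 x]
          rw [min_eq_left ((div_le_one hDx).2 (hSD x hx0 n))]
          field_simp
      · rw [indicator_of_notMem hx, hSΩ n x hx]; ring
    have e2 : ∫ x in Ω, w x * Ω.indicator (fun x => ‖x‖^t * D x * g x) x = ∫ x, u x * g x := by
      rw [← integral_indicator hΩm]
      congr 1; ext x
      by_cases hx : x ∈ Ω
      · simp only [indicator_of_mem hx]
        rcases lt_or_ge ‖x‖ r with h | h
        · rw [hgr x h]; ring
        · have hx0 : x ≠ 0 := norm_pos_iff.1 (hr.trans_le h)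
          rw [huin x hx hx0]; ring
      · rw [indicator_of_notMem hx, huΩ x hx]; ring
    rw [e2] at h1
    exact h1.congr e1
  refine ⟨u, hum, hu0, huΩ, huM, huz, ?_, key⟩
  have hmeasE : ∀ r : ℝ, MeasurableSet {x : EN N | r ≤ ‖x‖} := fun r => measurableSet_le measurable_const measurable_norm
  have hcov : AECover (volume : Measure (EN N)) atTop (fun n : ℕ => {x : EN N | 1/((n:ℝ)+1) ≤ ‖x‖} ∪ {0}) := by
    refine ⟨Eventually.of_forall fun x => ?_, fun n => (hmeasE _).union (measurableSet_singleton 0)⟩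
    by_cases hx : x = 0
    · exact Eventually.of_forall fun n => Or.inr hx
    · filter_upwards [(tendsto_one_div_add_atTop_nhds_zero_nat (𝕜 := ℝ)).eventually_lt_const (norm_pos_iff.2 hx)] with n hn
      exact Or.inl hn.le
  have hr : ∀ n : ℕ, 0 < 1/((n:ℝ)+1) := fun n => by positivity
  have huam : Measurable fun x => u x * ‖x‖^a := hum.mul (by fun_prop)
  have hgb : ∀ r > 0, ∀ x : EN N, |({x : EN N | r ≤ ‖x‖}.indicator (fun x => ‖x‖^a) x)| ≤ r^a := fun r hr x => by
    by_cases hx : r ≤ ‖x‖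
    · rw [indicator_of_mem (show x ∈ {x : EN N | r ≤ ‖x‖} from hx), abs_of_nonneg (by positivity)]
      exact Real.rpow_le_rpow_of_nonpos hr hx ha.le
    · rw [indicator_of_notMem (show x ∉ {x : EN N | r ≤ ‖x‖} from hx), abs_zero]; positivity
  have hind : ∀ n : ℕ, (fun x => ({x : EN N | 1/((n:ℝ)+1) ≤ ‖x‖} ∪ {0}).indicator (fun x => u x * ‖x‖^a) x) = fun x => u x * {x : EN N | 1/((n:ℝ)+1) ≤ ‖x‖}.indicator (fun x => ‖x‖^a) x := fun n => by
    ext x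
    by_cases hx : 1/((n:ℝ)+1) ≤ ‖x‖
    · rw [indicator_of_mem (show x ∈ {x : EN N | 1/((n:ℝ)+1) ≤ ‖x‖} from hx), indicator_of_mem (show x ∈ {x : EN N | 1/((n:ℝ)+1) ≤ ‖x‖} ∪ ({0} : Set (EN N)) from Or.inl hx)]
    · rw [indicator_of_notMem (show x ∉ {x : EN N | 1/((n:ℝ)+1) ≤ ‖x‖} from hx), mul_zero]
      by_cases hx0 : x = 0
      · rw [indicator_of_mem (show x ∈ {x : EN N | 1/((n:ℝ)+1) ≤ ‖x‖} ∪ ({0} : Set (EN N)) from Or.inr hx0), hx0, huz, zero_mul]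
      · exact indicator_of_notMem (show x ∉ {x : EN N | 1/((n:ℝ)+1) ≤ ‖x‖} ∪ ({0} : Set (EN N)) from fun h => h.elim hx hx0) _
  refine hcov.integrable_of_integral_bounded_of_nonneg_ae A (fun n => ?_) (Eventually.of_forall fun x => mul_nonneg (hu0 x) (by positivity)) (Eventually.of_forall fun n => ?_)
  · rw [← integrable_indicator_iff ((hmeasE _).union (measurableSet_singleton 0))]
    change Integrable (fun x => ({x : EN N | 1/((n:ℝ)+1) ≤ ‖x‖} ∪ {0}).indicator (fun x => u x * ‖x‖^a) x)
    rw [hind n]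
    obtain ⟨M, hM0, hM⟩ := huM _ (hr n)
    refine bdd_supp_int (B := M*(1/((n:ℝ)+1))^a) hΩ (hum.mul ((by fun_prop : Measurable fun x : EN N => ‖x‖^a).indicator (hmeasE _))) (fun x => ?_) (fun x hx => by rw [huΩ x hx, zero_mul])
    rw [abs_mul, abs_of_nonneg (hu0 x)]
    by_cases hx : 1/((n:ℝ)+1) ≤ ‖x‖
    · exact mul_le_mul (hM x hx) (hgb _ (hr n) x) (abs_nonneg _) hM0
    · rw [indicator_of_notMem (show x ∉ {x : EN N | 1/((n:ℝ)+1) ≤ ‖x‖} from hx), abs_zero, mul_zero]; positivity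
  · rw [← integral_indicator ((hmeasE _).union (measurableSet_singleton 0))]
    change ∫ x, ({x : EN N | 1/((n:ℝ)+1) ≤ ‖x‖} ∪ {0}).indicator (fun x => u x * ‖x‖^a) x ≤ A
    rw [hind n]
    have h1 := key _ (hr n) ({x : EN N | 1/((n:ℝ)+1) ≤ ‖x‖}.indicator (fun x => ‖x‖^a)) ((by fun_prop : Measurable fun x : EN N => ‖x‖^a).indicator (hmeasE _)) ⟨_, hgb _ (hr n)⟩ (fun x hx => indicator_of_notMem (show x ∉ {x : EN N | 1/((n:ℝ)+1) ≤ ‖x‖} from not_le.2 hx) _)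
    refine le_of_tendsto h1 (Nat.hyperfilter_le_atTop ?_)
    have h2 : Tendsto (fun m => R*ε m) atTop (𝓝 0) := by simpa using hεt.const_mul R
    filter_upwards [h2.eventually_lt_const (hr n)] with m hm
    refine (integral_mono_of_nonneg (Eventually.of_forall fun x => ?_) (hSi m) (Eventually.of_forall fun x => ?_)).trans (hSA m)
    · exact mul_nonneg (mul_nonneg (hS0 m x) (by positivity)) (indicator_nonneg (fun _ _ => by positivity) x)
    · simp only
      refine mul_le_mul_of_nonneg_left ?_ (mul_nonneg (hS0 m x) (by positivity))
      by_cases hx : 1/((n:ℝ)+1) ≤ ‖x‖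
      · rw [indicator_of_mem (show x ∈ {x : EN N | 1/((n:ℝ)+1) ≤ ‖x‖} from hx), max_eq_left (hm.le.trans hx)]
      · rw [indicator_of_notMem (show x ∉ {x : EN N | 1/((n:ℝ)+1) ≤ ‖x‖} from hx)]; positivity


set_option maxHeartbeats 1000000 in
lemma pass_limit {N : ℕ} (hN : 2 ≤ N) {t a a' R0 R A C1 L : ℝ} (haa : a < a') (ha : a' < 0) (hR : 1 ≤ R) (hR0 : 1 ≤ R0)
    (hC1 : 0 ≤ C1)
    {Ω : Set (EN N)} (hΩm : MeasurableSet Ω) (hΩ : Ω ⊆ ball 0 R0) {ε : ℕ → ℝ} (hε : ∀ n, 0 < ε n) (hεt : Tendsto ε atTop (𝓝 0))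
    {S : ℕ → EN N → ℝ} (hSm : ∀ n, Measurable (S n)) (hS0 : ∀ n x, 0 ≤ S n x) (hSΩ : ∀ n, ∀ x ∉ Ω, S n x = 0)
    (hSi : ∀ n, Integrable (fun x => S n x * ‖x‖^t * (max ‖x‖ (R*ε n))^a))
    (hSA : ∀ n, ∫ x, S n x * ‖x‖^t * (max ‖x‖ (R*ε n))^a ≤ A)
    (hSM : ∀ r > 0, ∃ M, 0 ≤ M ∧ ∀ n x, r ≤ ‖x‖ → S n x ≤ M)
    {u : EN N → ℝ} (hum : Measurable u) (hu0 : ∀ x, 0 ≤ u x) (huΩ : ∀ x ∉ Ω, u x = 0) (huz : u 0 = 0)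
    (hui : Integrable (fun x => u x * ‖x‖^a))
    (key : ∀ r > 0, ∀ g : EN N → ℝ, Measurable g → (∃ B, ∀ x, |g x| ≤ B) → (∀ x, ‖x‖ < r → g x = 0) →
        Tendsto (fun n => ∫ x, S n x * ‖x‖^t * g x) (hyperfilter ℕ : Filter ℕ) (𝓝 (∫ x, u x * g x)))
    {J : ℕ → EN N → ℝ} (hJm : ∀ n, Measurable (J n)) {G : EN N → ℝ} (hG : ∀ x, x ≠ 0 → Tendsto (fun n => J n x) atTop (𝓝 (G x)))
    (hJ : ∀ n x, x ≠ 0 → ‖x‖ ≤ R0 → |J n x| ≤ C1 * (max ‖x‖ (ε n))^a')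
    (hL : Tendsto (fun n => ∫ x, S n x * ‖x‖^t * J n x) atTop (𝓝 L)) :
    Integrable (fun x => u x * G x) ∧ ∫ x, u x * G x = L := by
  have hγ : 0 < a' - a := sub_pos.2 haa
  have hxR : ∀ x ∈ Ω, ‖x‖ ≤ R0 := fun x hx => (mem_ball_zero_iff.1 (hΩ hx)).le
  have hsplit : ∀ y : ℝ, 0 < y → y^a' = y^(a'-a) * y^a := fun y hy => by rw [← Real.rpow_add hy]; congr 1; ring
  -- the limit function
  set G' : EN N → ℝ := ({0}ᶜ : Set (EN N)).indicator G with hG'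
  have h0m : MeasurableSet ({0}ᶜ : Set (EN N)) := (measurableSet_singleton 0).compl
  have hG'in : ∀ x, x ≠ 0 → G' x = G x := fun x hx => indicator_of_mem (show x ∈ ({0}ᶜ : Set (EN N)) from hx) _
  have hG'0 : G' 0 = 0 := indicator_of_notMem (by simp) _
  have hG'm : Measurable G' := by
    refine measurable_of_tendsto_metrizable (f := fun n => ({0}ᶜ : Set (EN N)).indicator (J n)) (fun n => (hJm n).indicator h0m) ?_
    rw [tendsto_pi_nhds]
    intro x
    by_cases hx : x = 0
    · subst hx; rw [hG'0]; simp
    · rw [hG'in x hx]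
      refine (hG x hx).congr fun n => ?_
      rw [indicator_of_mem (show x ∈ ({0}ᶜ : Set (EN N)) from hx)]
  clear_value G'
  have hJ1 : ∀ n x, x ≠ 0 → ‖x‖ ≤ R0 → |J n x| ≤ C1 * ‖x‖^a' := fun n x hx hxR =>
    (hJ n x hx hxR).trans (mul_le_mul_of_nonneg_left (Real.rpow_le_rpow_of_nonpos (norm_pos_iff.2 hx) (le_max_left _ _) ha.le) hC1)
  have hG1 : ∀ x, x ≠ 0 → ‖x‖ ≤ R0 → |G' x| ≤ C1 * ‖x‖^a' := fun x hx hxR => by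
    rw [hG'in x hx]
    exact le_of_tendsto (hG x hx).abs (Eventually.of_forall fun n => hJ1 n x hx hxR)
  set C2 : ℝ := C1 * (R⁻¹)^a' with hC2
  have hC20 : 0 ≤ C2 := mul_nonneg hC1 (by positivity)
  have hJ2 : ∀ n x, x ≠ 0 → ‖x‖ ≤ R0 → |J n x| ≤ C2 * ((max ‖x‖ (R*ε n))^(a'-a) * (max ‖x‖ (R*ε n))^a) := fun n x hx hxR => by
    have hx0 := norm_pos_iff.2 hx
    have hm : 0 < max ‖x‖ (R*ε n) := lt_max_of_lt_left hx0
    rw [← hsplit _ hm, hC2, mul_assoc, ← Real.mul_rpow (by positivity) hm.le]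
    refine (hJ n x hx hxR).trans (mul_le_mul_of_nonneg_left (Real.rpow_le_rpow_of_nonpos (by positivity) ?_ ha.le) hC1)
    rw [inv_mul_le_iff₀ (by positivity)]
    refine max_le ?_ (mul_le_mul_of_nonneg_left (le_max_right _ _) (by positivity))
    exact (le_mul_of_one_le_left hx0.le hR).trans (mul_le_mul_of_nonneg_left (le_max_left _ _) (by positivity))
  clear_value C2
  have hGam : Measurable fun x : EN N => ‖x‖^t := by fun_prop
  have hSG0 : ∀ n x, 0 ≤ S n x * ‖x‖^t := fun n x => mul_nonneg (hS0 n x) (by positivity)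
  have hne := ae_ne_zero (N := N) hN
  -- integrability of the discrete integrands
  have iJ : ∀ n, Integrable (fun x => S n x * ‖x‖^t * J n x) := fun n => by
    refine ((hSi n).const_mul (C2 * (R0 + R*ε n)^(a'-a))).mono' (((hSm n).mul hGam).mul (hJm n)).aestronglyMeasurable ?_
    filter_upwards [hne] with x hx
    by_cases hxΩ : x ∈ Ω
    · rw [Real.norm_eq_abs, abs_mul, abs_of_nonneg (hSG0 n x)]
      have hm : 0 < max ‖x‖ (R*ε n) := lt_max_of_lt_left (norm_pos_iff.2 hx)
      have h1 : (max ‖x‖ (R*ε n))^(a'-a) ≤ (R0 + R*ε n)^(a'-a) := by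
        refine Real.rpow_le_rpow hm.le (max_le ?_ ?_) hγ.le
        · have := hxR x hxΩ; have := mul_pos (zero_lt_one.trans_le hR) (hε n); linarith
        · linarith
      calc S n x * ‖x‖^t * |J n x| ≤ S n x * ‖x‖^t * (C2 * ((R0 + R*ε n)^(a'-a) * (max ‖x‖ (R*ε n))^a)) := by
            refine mul_le_mul_of_nonneg_left ((hJ2 n x hx (hxR x hxΩ)).trans ?_) (hSG0 n x)
            exact mul_le_mul_of_nonneg_left (mul_le_mul_of_nonneg_right h1 (by positivity)) hC20
        _ = _ := by ring
    · rw [hSΩ n x hxΩ]; simp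
  have iG : Integrable (fun x => u x * G' x) := by
    refine (hui.const_mul (C1 * R0^(a'-a))).mono' (hum.mul hG'm).aestronglyMeasurable ?_
    filter_upwards [hne] with x hx
    by_cases hxΩ : x ∈ Ω
    · rw [Real.norm_eq_abs, abs_mul, abs_of_nonneg (hu0 x)]
      have hm := norm_pos_iff.2 hx
      have h1 : ‖x‖^(a'-a) ≤ R0^(a'-a) := Real.rpow_le_rpow hm.le (hxR x hxΩ) hγ.le
      calc u x * |G' x| ≤ u x * (C1 * (R0^(a'-a) * ‖x‖^a)) := by
            refine mul_le_mul_of_nonneg_left ((hG1 x hx (hxR x hxΩ)).trans ?_) (hu0 x)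
            rw [hsplit _ hm]
            exact mul_le_mul_of_nonneg_left (mul_le_mul_of_nonneg_right h1 (by positivity)) hC1
        _ = _ := by ring
    · rw [huΩ x hxΩ]; simp
  have huG : (fun x => u x * G x) = fun x => u x * G' x := by
    ext x
    by_cases hx : x = 0
    · rw [hx, huz]; ring
    · rw [hG'in x hx]
  rw [huG]
  refine ⟨iG, ?_⟩
  set B : ℝ := ∫ x, u x * ‖x‖^a with hB
  have main : ∀ r > 0, |L - ∫ x, u x * G' x| ≤ (C2 * A + C1 * B) * r^(a'-a) := by
    intro r hr
    set E : Set (EN N) := Ω ∩ {x | r ≤ ‖x‖} with hE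
    have hEm : MeasurableSet E := hΩm.inter (measurableSet_le measurable_const measurable_norm)
    have hEp : ∀ x ∈ E, x ≠ 0 ∧ ‖x‖ ≤ R0 ∧ r ≤ ‖x‖ := fun x hx => ⟨norm_pos_iff.1 (hr.trans_le hx.2), hxR x hx.1, hx.2⟩
    have hEc : ∀ x ∉ E, x ∈ Ω → ‖x‖ < r := fun x hx hxΩ => not_le.1 fun h => hx ⟨hxΩ, h⟩
    clear_value E
    have hra : ∀ x ∈ E, ‖x‖^a' ≤ r^a' := fun x hx => Real.rpow_le_rpow_of_nonpos hr (hEp x hx).2.2 ha.le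
    obtain ⟨M, hM0, hM⟩ := hSM r hr
    -- convergence of the outer part
    have hgb : ∀ x, |E.indicator G' x| ≤ C1 * r^a' := fun x => by
      by_cases hx : x ∈ E
      · rw [indicator_of_mem hx]
        exact (hG1 x (hEp x hx).1 (hEp x hx).2.1).trans (mul_le_mul_of_nonneg_left (hra x hx) hC1)
      · rw [indicator_of_notMem hx, abs_zero]; positivity
    have hk := key r hr (E.indicator G') (hG'm.indicator hEm) ⟨_, hgb⟩ (fun x hx => indicator_of_notMem (fun h => absurd (hEp x h).2.2 (not_le.2 hx)) _)
    obtain ⟨lo, hi, -, hhi, hlh⟩ := pow_bd t hr (le_max_left r R0)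
    have hSb : ∀ n, ∀ x ∈ E, S n x * ‖x‖^t ≤ M * hi := fun n x hx =>
      mul_le_mul (hM n x (hEp x hx).2.2) (hlh _ (hEp x hx).2.2 ((hEp x hx).2.1.trans (le_max_right _ _))).2 (by positivity) hM0
    have hdif : Tendsto (fun n => ∫ x, S n x * ‖x‖^t * E.indicator (fun x => J n x - G' x) x) atTop (𝓝 0) := by
      have hz : (0:ℝ) = ∫ x : EN N, (0:ℝ) := by simp
      rw [hz]
      refine tendsto_integral_of_dominated_convergence ((ball (0:EN N) (R0+1)).indicator fun _ => M*hi*(2*C1*r^a')) (fun n => ?_) ?_ (fun n => Eventually.of_forall fun x => ?_) (Eventually.of_forall fun x => ?_)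
      · exact (((hSm n).mul hGam).mul (((hJm n).sub hG'm).indicator hEm)).aestronglyMeasurable
      · exact (integrable_indicator_iff measurableSet_ball).2 (integrableOn_const measure_ball_lt_top.ne)
      · by_cases hx : x ∈ E
        · have hxb : x ∈ ball (0:EN N) (R0+1) := mem_ball_zero_iff.2 (by linarith [(hEp x hx).2.1])
          rw [indicator_of_mem hx, indicator_of_mem hxb, Real.norm_eq_abs, abs_mul, abs_of_nonneg (hSG0 n x)]
          refine mul_le_mul (hSb n x hx) ?_ (abs_nonneg _) (by positivity)
          have h1 := hJ1 n x (hEp x hx).1 (hEp x hx).2.1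
          have h2 := hG1 x (hEp x hx).1 (hEp x hx).2.1
          have h3 := mul_le_mul_of_nonneg_left (hra x hx) hC1
          calc |J n x - G' x| ≤ |J n x| + |G' x| := abs_sub _ _
            _ ≤ 2*C1*r^a' := by linarith
        · rw [indicator_of_notMem hx, mul_zero, norm_zero]
          exact indicator_nonneg (fun _ _ => by positivity) x
      · by_cases hx : x ∈ E
        · simp only [indicator_of_mem hx]
          have h1 : Tendsto (fun n => J n x - G' x) atTop (𝓝 0) := by
            have := (hG x (hEp x hx).1).sub_const (G' x)
            rwa [hG'in x (hEp x hx).1, sub_self, ← hG'in x (hEp x hx).1] at this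
          refine squeeze_zero_norm (a := fun n => M*hi*‖J n x - G' x‖) (fun n => ?_) ?_
          · rw [norm_mul, Real.norm_of_nonneg (hSG0 n x)]
            exact mul_le_mul_of_nonneg_right (hSb n x hx) (norm_nonneg _)
          · simpa using h1.norm.const_mul (M*hi)
        · simp only [indicator_of_notMem hx, mul_zero]; exact tendsto_const_nhds
    have iE : ∀ n, Integrable (fun x => S n x * ‖x‖^t * E.indicator (J n) x) := fun n => by
      refine ((iJ n).indicator hEm).congr (Eventually.of_forall fun x => ?_)
      by_cases hx : x ∈ E
      · simp only [indicator_of_mem hx]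
      · simp only [indicator_of_notMem hx, mul_zero]
    have iEG : ∀ n, Integrable (fun x => S n x * ‖x‖^t * E.indicator G' x) := fun n => by
      refine bdd_supp_int (B := M*hi*(C1*r^a')) hΩ (((hSm n).mul hGam).mul (hG'm.indicator hEm)) (fun x => ?_) (fun x hx => by rw [hSΩ n x hx]; simp)
      by_cases hx : x ∈ E
      · rw [abs_mul, abs_of_nonneg (hSG0 n x)]
        exact mul_le_mul (hSb n x hx) (hgb x) (abs_nonneg _) (by positivity)
      · rw [indicator_of_notMem hx, mul_zero, abs_zero]; positivity
    have hQ : Tendsto (fun n => ∫ x, S n x * ‖x‖^t * E.indicator (J n) x) (hyperfilter ℕ : Filter ℕ) (𝓝 (∫ x, u x * E.indicator G' x)) := by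
      have h1 := (hdif.mono_left Nat.hyperfilter_le_atTop).add hk
      rw [zero_add] at h1
      refine h1.congr fun n => ?_
      have e : (fun x => S n x * ‖x‖^t * E.indicator (fun x => J n x - G' x) x) = fun x => S n x * ‖x‖^t * E.indicator (J n) x - S n x * ‖x‖^t * E.indicator G' x := by
        ext x
        by_cases hx : x ∈ E
        · simp only [indicator_of_mem hx]; ring
        · simp only [indicator_of_notMem hx]; ring
      rw [e, integral_sub (iE n) (iEG n)]; ring
    -- inner part, discrete
    have hin : ∀ᶠ n in (hyperfilter ℕ : Filter ℕ), |(∫ x, S n x * ‖x‖^t * J n x) - ∫ x, S n x * ‖x‖^t * E.indicator (J n) x| ≤ C2 * A * r^(a'-a) := by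
      refine Nat.hyperfilter_le_atTop ?_
      have h2 : Tendsto (fun m => R*ε m) atTop (𝓝 0) := by simpa using hεt.const_mul R
      filter_upwards [h2.eventually_lt_const hr] with n hn
      rw [← integral_sub (iJ n) (iE n)]
      have hb : ‖∫ x, (S n x * ‖x‖^t * J n x - S n x * ‖x‖^t * E.indicator (J n) x)‖ ≤ ∫ x, C2 * r^(a'-a) * (S n x * ‖x‖^t * (max ‖x‖ (R*ε n))^a) := by
        refine norm_integral_le_of_norm_le ((hSi n).const_mul _) ?_
        filter_upwards [hne] with x hx
        have hm : 0 < max ‖x‖ (R*ε n) := lt_max_of_lt_left (norm_pos_iff.2 hx)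
        by_cases hxE : x ∈ E
        · rw [indicator_of_mem hxE, sub_self, norm_zero]
          exact mul_nonneg (by positivity) (mul_nonneg (hSG0 n x) (by positivity))
        · rw [indicator_of_notMem hxE, mul_zero, sub_zero]
          by_cases hxΩ : x ∈ Ω
          · have hxr := hEc x hxE hxΩ
            rw [Real.norm_eq_abs, abs_mul, abs_of_nonneg (hSG0 n x)]
            have h1 : (max ‖x‖ (R*ε n))^(a'-a) ≤ r^(a'-a) := Real.rpow_le_rpow hm.le (max_le hxr.le hn.le) hγ.le
            calc S n x * ‖x‖^t * |J n x| ≤ S n x * ‖x‖^t * (C2 * (r^(a'-a) * (max ‖x‖ (R*ε n))^a)) := by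
                  refine mul_le_mul_of_nonneg_left ((hJ2 n x hx (hxR x hxΩ)).trans ?_) (hSG0 n x)
                  exact mul_le_mul_of_nonneg_left (mul_le_mul_of_nonneg_right h1 (by positivity)) hC20
              _ = _ := by ring
          · rw [hSΩ n x hxΩ]; simp
      rw [Real.norm_eq_abs, integral_const_mul] at hb
      refine hb.trans ?_
      calc _ ≤ C2 * r^(a'-a) * A := mul_le_mul_of_nonneg_left (hSA n) (by positivity)
        _ = _ := by ring
    have hlim1 : |L - ∫ x, u x * E.indicator G' x| ≤ C2 * A * r^(a'-a) :=
      le_of_tendsto ((hL.mono_left Nat.hyperfilter_le_atTop).sub hQ).abs hin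
    have iuE : Integrable (fun x => u x * E.indicator G' x) := by
      refine (iG.indicator hEm).congr (Eventually.of_forall fun x => ?_)
      by_cases hx : x ∈ E
      · simp only [indicator_of_mem hx]
      · simp only [indicator_of_notMem hx, mul_zero]
    have hlim2 : |(∫ x, u x * E.indicator G' x) - ∫ x, u x * G' x| ≤ C1 * B * r^(a'-a) := by
      rw [← integral_sub iuE iG]
      have hb : ‖∫ x, (u x * E.indicator G' x - u x * G' x)‖ ≤ ∫ x, C1 * r^(a'-a) * (u x * ‖x‖^a) := by
        refine norm_integral_le_of_norm_le (hui.const_mul _) ?_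
        filter_upwards [hne] with x hx
        have hm := norm_pos_iff.2 hx
        by_cases hxE : x ∈ E
        · rw [indicator_of_mem hxE, sub_self, norm_zero]
          exact mul_nonneg (by positivity) (mul_nonneg (hu0 x) (by positivity))
        · rw [indicator_of_notMem hxE, mul_zero, zero_sub, norm_neg]
          by_cases hxΩ : x ∈ Ω
          · have hxr := hEc x hxE hxΩ
            rw [Real.norm_eq_abs, abs_mul, abs_of_nonneg (hu0 x)]
            have h1 : ‖x‖^(a'-a) ≤ r^(a'-a) := Real.rpow_le_rpow hm.le hxr.le hγ.le
            calc u x * |G' x| ≤ u x * (C1 * (r^(a'-a) * ‖x‖^a)) := by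
                  refine mul_le_mul_of_nonneg_left ((hG1 x hx (hxR x hxΩ)).trans ?_) (hu0 x)
                  rw [hsplit _ hm]
                  exact mul_le_mul_of_nonneg_left (mul_le_mul_of_nonneg_right h1 (by positivity)) hC1
              _ = _ := by ring
          · rw [huΩ x hxΩ]; simp
      rw [Real.norm_eq_abs, integral_const_mul] at hb
      refine hb.trans (le_of_eq ?_)
      rw [hB]; ring
    calc |L - ∫ x, u x * G' x| ≤ |L - ∫ x, u x * E.indicator G' x| + |(∫ x, u x * E.indicator G' x) - ∫ x, u x * G' x| := abs_sub_le _ _ _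
      _ ≤ _ := by linarith
  have hz : Tendsto (fun r : ℝ => (C2 * A + C1 * B) * r^(a'-a)) (𝓝[>] 0) (𝓝 0) := by
    have h1 : Tendsto (fun r : ℝ => r^(a'-a)) (𝓝[>] 0) (𝓝 0) := by
      have := (Real.continuousAt_rpow_const 0 (a'-a) (Or.inr hγ.le)).tendsto
      rw [Real.zero_rpow hγ.ne'] at this
      exact this.mono_left nhdsWithin_le_nhds
    simpa using h1.const_mul (C2 * A + C1 * B)
  have h0 : |L - ∫ x, u x * G' x| ≤ 0 := ge_of_tendsto hz (by
    filter_upwards [self_mem_nhdsWithin] with r hr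
    exact main r hr)
  have := abs_nonpos_iff.1 h0
  linarith


lemma Iop_meas {N : ℕ} (hN : 2 ≤ N) {p ε t : ℝ} (ht : -(N:ℝ) < t) (htp : t - p < -(N:ℝ)) (hε : 0 < ε)
    {b : EN N → ℝ} (hb : Measurable b) {B : ℝ} (hB : ∀ x, |b x| ≤ B) : Measurable (fun x => Iop p ε t b x) := by
  have e : (fun x => Iop p ε t b x) = fun x => b x * aa p ε t x - ∫ z, b z * wk p ε t x z := by
    ext x; exact Iop_eq hN ht htp hε x hb hB
  rw [e]
  exact (hb.mul (aa_meas p ε t)).sub (wk_integral_meas p ε t hb)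

set_option maxHeartbeats 1000000 in
lemma core {N : ℕ} (hN : 2 ≤ N) {s t δ δ' R0 : ℝ} (hs : s ∈ Ioo (0:ℝ) 1) (ht : (2*s-N)/2 ≤ t) (hδ : 0 < δ) (hδδ : δ < δ') (hδ1 : δ' ≤ 1)
    (hts : t + δ' < 2*s) (hR0 : 1 ≤ R0)
    {Ω : Set (EN N)} (hΩm : MeasurableSet Ω) (hΩ : Ω ⊆ ball 0 R0)
    {f : EN N → ℝ} (hfm : Measurable f) (hf : ∀ x, 0 ≤ f x) (hfi : IntegrableOn (fun x => f x * ‖x‖^t) Ω)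
    (hfb : ∀ r > 0, ∃ F, ∀ x ∈ Ω, r ≤ ‖x‖ → f x ≤ F) {κ : ℝ} (hκ : 0 ≤ κ) :
    ∃ u : EN N → ℝ, Measurable u ∧ (∀ x, 0 ≤ u x) ∧ (∀ x ∉ Ω, u x = 0) ∧ (∀ r > 0, ∃ M, 0 ≤ M ∧ ∀ x, r ≤ ‖x‖ → u x ≤ M) ∧
      Integrable (fun x => u x * ‖x‖^(t+δ-2*s)) ∧
      ∀ ξ : EN N → ℝ, ContDiff ℝ 2 ξ → HasCompactSupport ξ → (∀ x ∉ Ω, ξ x = 0) → ∀ G : EN N → ℝ,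
        (∀ x, x ≠ 0 → Tendsto (fun ε => Iop ((N:ℝ)+2*s) ε t ξ x) (𝓝[>] 0) (𝓝 (G x))) →
        Integrable (fun x => u x * G x) ∧ ∫ x, u x * G x = (∫ x in Ω, f x * ξ x * ‖x‖^t) + κ * ξ 0 := by
  have hN2 : (2:ℝ) ≤ N := by exact_mod_cast hN
  have hs0 := hs.1
  have hs1 := hs.2
  have ht' : -(N:ℝ) < t := by linarith
  obtain ⟨ε, S, R, A, hR, hA, hε, hεt, hSm, hS0, hSB, hSΩ, hSe, hSi, hSA, hSM⟩ :=
    seq_exists hN hs ht hδ (by linarith) hR0 hΩm hΩ hfm hf hfi hfb hκ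
  obtain ⟨u, hum, hu0, huΩ, huM, huz, hui, key⟩ := weak_u (a := t+δ-2*s) (by linarith) hR hΩm hΩ hεt hSm hS0 hSΩ hSi hSA hSM
  refine ⟨u, hum, hu0, huΩ, huM, hui, fun ξ hξ hc hξΩ G hG => ?_⟩
  obtain ⟨C1, hC1, hC⟩ := test_bound hN hs ht' (hδ.trans hδδ) hδ1 hts hR0 hξ hc
  obtain ⟨K, hK, hKb, -, -⟩ := c2_bounds hξ hc
  have hξm := hξ.continuous.measurable
  have hεt' : Tendsto ε atTop (𝓝[>] 0) := tendsto_nhdsWithin_iff.2 ⟨hεt, Eventually.of_forall hε⟩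
  refine pass_limit (a' := t+δ'-2*s) (J := fun n x => Iop ((N:ℝ)+2*s) (ε n) t ξ x) hN (by linarith) (by linarith) hR hR0 hC1 hΩm hΩ hε hεt hSm hS0 hSΩ hSi hSA hSM hum hu0 huΩ huz hui key
    (fun n => Iop_meas hN ht' (by linarith) (hε n) hξm hKb) (fun x hx => (hG x hx).comp hεt') (fun n x hx hxR => hC _ (hε n) x hx hxR) ?_
  refine (fseq_tendsto hN ht' hfm hf hfi hκ hξ hc hξΩ).congr fun n => ?_
  obtain ⟨B, hB⟩ := hSB n
  have h := symm_discrete (p := (N:ℝ)+2*s) (ε := ε n) (t := t) (R := R0) hN (by linarith) ht' (by linarith) (hε n) (by linarith) hΩ (hSm n) (fun x => (abs_of_nonneg (hS0 n x)).trans_le (hB x)) hξm hKb (hSΩ n) hξΩ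
  have e1 : ∫ x, S n x * ‖x‖^t * Iop ((N:ℝ)+2*s) (ε n) t ξ x = ∫ x, S n x * Iop ((N:ℝ)+2*s) (ε n) t ξ x * ‖x‖^t := by
    congr 1; ext x; ring
  rw [e1, ← h, ← integral_indicator hΩm]
  congr 1; ext x
  by_cases hx : x ∈ Ω
  · rw [indicator_of_mem hx, hSe n x hx]
  · rw [indicator_of_notMem hx, hξΩ x hx]; ring

lemma setint_kr {N : ℕ} (p : ℝ) {ε : ℝ} (v : EN N → ℝ) (x : EN N) :
    ∫ z in {z : EN N | ε ≤ dist x z}, v z / dist x z ^ p = ∫ z, v z * kr p ε (dist x z) := by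
  rw [← integral_indicator (measurableSet_le measurable_const (by fun_prop))]
  congr 1; ext z
  by_cases hz : ε ≤ dist x z
  · rw [indicator_of_mem (show z ∈ {z : EN N | ε ≤ dist x z} from hz), kr, if_pos hz, div_eq_mul_inv]
  · rw [indicator_of_notMem (show z ∉ {z : EN N | ε ≤ dist x z} from hz), kr, if_neg hz, mul_zero]

lemma wfrac_iff {N : ℕ} {s t : ℝ} (v : EN N → ℝ) (x : EN N) (L : ℝ) :
    HasWFracLap N s t v x L ↔ Tendsto (fun ε => CNs N s * Iop ((N:ℝ)+2*s) ε t v x) (𝓝[>] 0) (𝓝 L) := by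
  unfold HasWFracLap
  have e : (fun ε : ℝ => CNs N s * ∫ z in {z : EN N | ε ≤ dist x z}, (v x - v z) * ‖z‖ ^ t / dist x z ^ ((N:ℝ) + 2*s)) = fun ε => CNs N s * Iop ((N:ℝ)+2*s) ε t v x := by
    ext ε
    rw [setint_kr, Iop]
    congr 2; ext z; rw [wk]; ring
  rw [e]

lemma JJ_tendsto {N : ℕ} (hN : 2 ≤ N) {s t : ℝ} (hs : s ∈ Ioo (0:ℝ) 1) (ht : (2*s-N)/2 ≤ t) (hts : t < 2*s) {x : EN N} (hx : x ≠ 0) :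
    Tendsto (fun ε => CNs N s * JJ N ((N:ℝ)+2*s) ε t x) (𝓝[>] 0) (𝓝 (csFun N s t * ‖x‖^(t-2*s))) := by
  have hN2 : (2:ℝ) ≤ N := by exact_mod_cast hN
  have hs0 := hs.1
  have hs1 := hs.2
  obtain ⟨e, he⟩ := exists_unit (N := N) hN
  have h1 := ((trunc_tendsto hN hs (by linarith : -(N:ℝ) < t) hts hx).const_mul (2:ℝ)⁻¹).const_mul (CNs N s)
  rw [KJ_homog hN t s hx he] at h1
  have e1 : CNs N s * (2⁻¹ * (‖x‖^(t-2*s) * ∫ h, D2 t e h / ‖h‖^((N:ℝ)+2*s))) = csFun N s t * ‖x‖^(t-2*s) := by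
    rw [← KJ_value hN hs (by linarith : 2*s-N < t) hts he]; ring
  rw [e1] at h1
  refine h1.congr' ?_
  filter_upwards [self_mem_nhdsWithin] with ε hε
  rw [JJ_eq hN (by linarith) (by linarith) (by linarith) x hε]

lemma frac_to_w {N : ℕ} (hN : 2 ≤ N) {s t μ : ℝ} (hs : s ∈ Ioo (0:ℝ) 1) (ht : (2*s-N)/2 ≤ t) (hts : t < 2*s) (hc : csFun N s t = -μ)
    {φ ξ : EN N → ℝ} (hξm : Measurable ξ) {B : ℝ} (hB : ∀ x, |ξ x| ≤ B) (hφ : ∀ᵐ x, φ x = ξ x * ‖x‖^t)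
    {x : EN N} (hx : x ≠ 0) (hφx : φ x = ξ x * ‖x‖^t) {L : ℝ} (h : HasFracLap N s φ x L) :
    HasWFracLap N s t ξ x (L + μ * φ x / ‖x‖^(2*s)) := by
  have hN2 : (2:ℝ) ≤ N := by exact_mod_cast hN
  have hs0 := hs.1
  have hs1 := hs.2
  rw [wfrac_iff]
  have hJ := (JJ_tendsto hN hs ht hts hx).const_mul (ξ x)
  have e1 : L + μ * φ x / ‖x‖^(2*s) = L - ξ x * (csFun N s t * ‖x‖^(t-2*s)) := by
    rw [hc, hφx, Real.rpow_sub (norm_pos_iff.2 hx)]; ring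
  rw [e1]
  refine (h.sub hJ).congr' ?_
  filter_upwards [self_mem_nhdsWithin] with ε hε
  rw [setint_kr]
  have ht' : -(N:ℝ) < t := by linarith
  have htp : t - ((N:ℝ)+2*s) < -(N:ℝ) := by linarith
  have i1 : Integrable (fun z => (‖x‖^t - ‖z‖^t) * kr ((N:ℝ)+2*s) ε (dist x z)) := by
    have := ((kr_int hN (a := 0) (by linarith) (by linarith : 0 - ((N:ℝ)+2*s) < -(N:ℝ)) x hε).const_mul (‖x‖^t)).sub (kr_int hN ht' htp x hε)
    refine this.congr (Eventually.of_forall fun z => ?_)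
    simp only [Pi.sub_apply, Real.rpow_zero]; ring
  have i2 := Iop_int hN ht' htp hε x hξm hB
  have e2 : ∫ z, (φ x - φ z) * kr ((N:ℝ)+2*s) ε (dist x z) = ξ x * JJ N ((N:ℝ)+2*s) ε t x + Iop ((N:ℝ)+2*s) ε t ξ x := by
    rw [JJ, Iop, ← integral_const_mul, ← integral_add (i1.const_mul _) i2]
    refine integral_congr_ae ?_
    filter_upwards [hφ] with z hz
    rw [hz, hφx, wk]; ring
  rw [e2]; ring


set_option maxHeartbeats 1000000 in
lemma core_signed {N : ℕ} (hN : 2 ≤ N) {s t δ δ' R0 : ℝ} (hs : s ∈ Ioo (0:ℝ) 1) (ht : (2*s-N)/2 ≤ t) (hδ : 0 < δ) (hδδ : δ < δ') (hδ1 : δ' ≤ 1)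
    (hts : t + δ' < 2*s) (hR0 : 1 ≤ R0)
    {Ω : Set (EN N)} (hΩm : MeasurableSet Ω) (hΩ : Ω ⊆ ball 0 R0)
    {f : EN N → ℝ} (hfm : Measurable f) (hfi : IntegrableOn (fun x => f x * ‖x‖^t) Ω)
    (hfb : ∀ r > 0, ∃ F, ∀ x ∈ Ω, r ≤ ‖x‖ → |f x| ≤ F) (κ : ℝ) :
    ∃ u : EN N → ℝ, Measurable u ∧ (∀ x ∉ Ω, u x = 0) ∧ (∀ r > 0, ∃ M, 0 ≤ M ∧ ∀ x, r ≤ ‖x‖ → |u x| ≤ M) ∧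
      Integrable (fun x => u x * ‖x‖^(t+δ-2*s)) ∧
      ∀ ξ : EN N → ℝ, ContDiff ℝ 2 ξ → HasCompactSupport ξ → (∀ x ∉ Ω, ξ x = 0) → ∀ g : EN N → ℝ,
        (∀ x, x ≠ 0 → HasWFracLap N s t ξ x (g x)) →
        Integrable (fun x => u x * g x) ∧ ∫ x, u x * g x = (∫ x in Ω, f x * ξ x * ‖x‖^t) + κ * ξ 0 := by
  have hC : 0 < CNs N s := CNs_pos hs
  have hGam : Measurable fun x : EN N => ‖x‖^t := by fun_prop
  have hpart : ∀ h : EN N → ℝ, Measurable h → (∀ x, |h x| = |f x|) → 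
      IntegrableOn (fun x => max (h x) 0 * ‖x‖^t) Ω ∧ (∀ r > 0, ∃ F, ∀ x ∈ Ω, r ≤ ‖x‖ → max (h x) 0 ≤ F) := by
    intro h hm hh
    have hb : ∀ x, max (h x) 0 ≤ |f x| := fun x => by rw [← hh x]; exact max_le (le_abs_self _) (abs_nonneg _)
    refine ⟨hfi.norm.mono' ((hm.max measurable_const).mul hGam).aestronglyMeasurable (Eventually.of_forall fun x => ?_), fun r hr => ?_⟩
    · rw [norm_mul, norm_mul]
      refine mul_le_mul_of_nonneg_right ?_ (norm_nonneg _)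
      rw [Real.norm_of_nonneg (le_max_right _ _)]; exact hb x
    · obtain ⟨F, hF⟩ := hfb r hr
      exact ⟨F, fun x hx hxr => (hb x).trans (hF x hx hxr)⟩
  obtain ⟨ip, bp⟩ := hpart f hfm (fun _ => rfl)
  obtain ⟨im, bm⟩ := hpart (fun x => - f x) hfm.neg (fun _ => abs_neg _)
  obtain ⟨u, hum, hu0, huΩ, huM, hui, hu⟩ := core hN hs ht hδ hδδ hδ1 hts hR0 hΩm hΩ (hfm.max measurable_const) (fun x => le_max_right _ _) ip bp (le_max_right κ 0)
  obtain ⟨v, hvm, hv0, hvΩ, hvM, hvi, hv⟩ := core hN hs ht hδ hδδ hδ1 hts hR0 hΩm hΩ (hfm.neg.max measurable_const) (fun x => le_max_right _ _) im bm (le_max_right (-κ) 0)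
  refine ⟨fun x => (CNs N s)⁻¹ * (u x - v x), (hum.sub hvm).const_mul _, fun x hx => by simp only [huΩ x hx, hvΩ x hx]; ring, fun r hr => ?_, ?_, fun ξ hξ hc hξΩ g hg => ?_⟩
  · obtain ⟨M, hM0, hM⟩ := huM r hr
    obtain ⟨M', hM0', hM'⟩ := hvM r hr
    refine ⟨(CNs N s)⁻¹ * (M + M'), by positivity, fun x hx => ?_⟩
    rw [abs_mul, abs_of_pos (inv_pos.2 hC)]
    refine mul_le_mul_of_nonneg_left ?_ (by positivity)
    rw [abs_le]
    have := hM x hx; have := hM' x hx; have := hu0 x; have := hv0 x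
    constructor <;> linarith
  · refine ((hui.sub hvi).const_mul (CNs N s)⁻¹).congr (Eventually.of_forall fun x => ?_)
    simp only [Pi.sub_apply]; ring
  · have hG : ∀ x, x ≠ 0 → Tendsto (fun ε => Iop ((N:ℝ)+2*s) ε t ξ x) (𝓝[>] 0) (𝓝 ((CNs N s)⁻¹ * g x)) := fun x hx => by
      refine (((wfrac_iff ξ x (g x)).1 (hg x hx)).const_mul (CNs N s)⁻¹).congr fun ε => ?_
      rw [inv_mul_cancel_left₀ hC.ne']
    obtain ⟨iu, eu⟩ := hu ξ hξ hc hξΩ _ hG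
    obtain ⟨iv, ev⟩ := hv ξ hξ hc hξΩ _ hG
    have e : (fun x => (CNs N s)⁻¹ * (u x - v x) * g x) = fun x => u x * ((CNs N s)⁻¹ * g x) - v x * ((CNs N s)⁻¹ * g x) := by
      ext x; ring
    rw [e]
    refine ⟨iu.sub iv, ?_⟩
    rw [integral_sub iu iv, eu, ev]
    obtain ⟨K, hK, hKb, -, -⟩ := c2_bounds hξ hc
    have hξm := hξ.continuous.measurable
    have j : ∀ h : EN N → ℝ, IntegrableOn (fun x => h x * ‖x‖^t) Ω → IntegrableOn (fun x => h x * ξ x * ‖x‖^t) Ω := fun h hi => by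
      refine (hi.bdd_mul hξm.aestronglyMeasurable (Eventually.of_forall hKb)).congr (Eventually.of_forall fun x => ?_)
      simp only; ring
    have e2 : ∫ x in Ω, f x * ξ x * ‖x‖^t = (∫ x in Ω, max (f x) 0 * ξ x * ‖x‖^t) - ∫ x in Ω, max (- f x) 0 * ξ x * ‖x‖^t := by
      rw [← integral_sub (j _ ip) (j _ im)]
      congr 1; ext x
      have : f x = max (f x) 0 - max (- f x) 0 := by
        rcases le_total (f x) 0 with h | h
        · rw [max_eq_right h, max_eq_left (by linarith)]; ring
        · rw [max_eq_left h, max_eq_right (by linarith)]; ring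
      calc f x * ξ x * ‖x‖^t = (max (f x) 0 - max (- f x) 0) * ξ x * ‖x‖^t := by rw [← this]
        _ = _ := by ring
    have e3 : κ = max κ 0 - max (-κ) 0 := by
      rcases le_total κ 0 with h | h
      · rw [max_eq_right h, max_eq_left (by linarith)]; ring
      · rw [max_eq_left h, max_eq_right (by linarith)]; ring
    rw [e2]
    simp only [Pi.neg_apply]
    linear_combination (-ξ 0) * e3

lemma holder_facts {N : ℕ} {θ R0 : ℝ} (hθ : θ ∈ Ioo (0:ℝ) 1) {Ω : Set (EN N)} (hΩo : IsOpen Ω) (hΩ : Ω ⊆ ball 0 R0)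
    {f : EN N → ℝ} (hf : HolderLocOn N θ f (closure Ω \ {0})) :
    Measurable ((Ω \ {0}).indicator f) ∧ ∀ r > 0, ∃ F, ∀ x ∈ Ω, r ≤ ‖x‖ → |(Ω \ {0}).indicator f x| ≤ F := by
  classical
  have ho : IsOpen (Ω \ {0}) := hΩo.sdiff isClosed_singleton
  constructor
  · have hcont : ContinuousOn f (Ω \ {0}) := by
      intro x hx
      refine ContinuousAt.continuousWithinAt ?_
      obtain ⟨r, hr, hb⟩ := nhds_basis_closedBall.mem_iff.1 (ho.mem_nhds hx)
      obtain ⟨C, hC⟩ := hf (closedBall x r) (hb.trans (sdiff_subset_sdiff_left subset_closure)) (isCompact_closedBall x r)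
      rw [ContinuousAt, tendsto_iff_norm_sub_tendsto_zero]
      have h1 : Tendsto (fun y => C * dist y x ^ θ) (𝓝 x) (𝓝 0) := by
        have hc : Continuous fun y => C * dist y x ^ θ := continuous_const.mul ((continuous_id.dist continuous_const).rpow_const fun _ => Or.inr hθ.1.le)
        have := hc.tendsto x
        simpa [Real.zero_rpow hθ.1.ne'] using this
      refine squeeze_zero' (Eventually.of_forall fun _ => norm_nonneg _) ?_ h1
      filter_upwards [closedBall_mem_nhds x hr] with y hy
      exact hC y hy x (mem_closedBall_self hr.le)
    rw [← piecewise_eq_indicator]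
    exact hcont.measurable_piecewise continuousOn_const ho.measurableSet
  · intro r hr
    have hcl : closure Ω ⊆ closedBall 0 R0 := closure_minimal (hΩ.trans ball_subset_closedBall) isClosed_closedBall
    have hK : IsCompact (closure Ω ∩ {x : EN N | r ≤ ‖x‖}) :=
      ((isCompact_closedBall (0:EN N) R0).of_isClosed_subset isClosed_closure hcl).inter_right (isClosed_le continuous_const continuous_norm)
    obtain ⟨C, hC⟩ := hf _ (fun x hx => ⟨hx.1, fun h => by
      have h2 : r ≤ ‖x‖ := hx.2
      rw [mem_singleton_iff.1 h, norm_zero] at h2; linarith⟩) hK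
    rcases (closure Ω ∩ {x : EN N | r ≤ ‖x‖}).eq_empty_or_nonempty with h | ⟨y, hy⟩
    · exact ⟨0, fun x hx hxr => absurd (show x ∈ closure Ω ∩ {x : EN N | r ≤ ‖x‖} from ⟨subset_closure hx, hxr⟩) (by rw [h]; exact notMem_empty x)⟩
    · refine ⟨|C| * (2*R0)^θ + |f y|, fun x hx hxr => ?_⟩
      have h1 := hC x ⟨subset_closure hx, hxr⟩ y hy
      have hx0 : x ≠ 0 := norm_pos_iff.1 (hr.trans_le hxr)
      rw [indicator_of_mem (show x ∈ Ω \ {0} from ⟨hx, hx0⟩)]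
      have hd : dist x y ≤ 2*R0 := by
        have a1 := mem_closedBall_zero_iff.1 (hcl (subset_closure hx))
        have a2 := mem_closedBall_zero_iff.1 (hcl hy.1)
        rw [dist_eq_norm]
        linarith [norm_sub_le x y]
      have h2 : C * dist x y ^ θ ≤ |C| * (2*R0)^θ :=
        mul_le_mul (le_abs_self C) (Real.rpow_le_rpow dist_nonneg hd hθ.1.le) (by positivity) (abs_nonneg C)
      have h3 := abs_sub_abs_le_abs_sub (f x) (f y)
      linarith

lemma Lam_bound {N : ℕ} {s t δ R0 : ℝ} (hδ : 0 < δ) (hδ1 : δ < 1) (hts : t + δ < 2*s) (hR0 : 1 ≤ R0) :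
    ∃ C, ∀ x : EN N, x ≠ 0 → ‖x‖ ≤ R0 → |Lam N s t x| ≤ C * ‖x‖^(t+δ-2*s) := by
  have hbase : ∀ {y : ℝ}, 0 < y → y ≤ R0 → 1 ≤ (R0^(t+δ-2*s))⁻¹ * y^(t+δ-2*s) := fun {y} hy hyR => by
    rw [le_inv_mul_iff₀ (by positivity), mul_one]
    exact Real.rpow_le_rpow_of_nonpos hy hyR (by linarith)
  by_cases h1 : 2*s - 1 < t
  · refine ⟨(R0^(t+δ-2*s))⁻¹, fun x hx hxR => ?_⟩
    rw [Lam, if_pos h1, abs_one]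
    exact hbase (norm_pos_iff.2 hx) hxR
  by_cases h2 : t < 2*s - 1
  · refine ⟨R0^(1-δ), fun x hx hxR => ?_⟩
    have hx0 := norm_pos_iff.2 hx
    rw [Lam, if_neg h1, if_pos h2, abs_of_nonneg (by positivity)]
    have : ‖x‖^(1-2*s+t) = ‖x‖^(1-δ) * ‖x‖^(t+δ-2*s) := by rw [← Real.rpow_add hx0]; congr 1; ring
    rw [this]
    exact mul_le_mul_of_nonneg_right (Real.rpow_le_rpow hx0.le hxR (by linarith)) (by positivity)
  · have ht : t = 2*s - 1 := le_antisymm (not_lt.1 h1) (not_lt.1 h2)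
    refine ⟨(R0^(t+δ-2*s))⁻¹ + (1-δ)⁻¹, fun x hx hxR => ?_⟩
    have hx0 := norm_pos_iff.2 hx
    rw [Lam, if_neg h1, if_neg h2, abs_of_nonneg (by positivity), add_mul]
    refine add_le_add (hbase hx0 hxR) (max_le ?_ (mul_nonneg (inv_nonneg.2 (by linarith)) (by positivity)))
    have h3 := Real.log_le_rpow_div (inv_nonneg.2 hx0.le) (by linarith : 0 < 1 - δ)
    rw [Real.log_inv, Real.inv_rpow hx0.le, ← Real.rpow_neg hx0.le] at h3
    have e : t + δ - 2*s = -(1-δ) := by rw [ht]; ring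
    rw [e]
    calc -Real.log ‖x‖ ≤ _ := h3
      _ = _ := by ring


/-- Theorem C(i): for `f ∈ C^θ_loc(cl Ω \ {0}) ∩ L¹(Ω, Γ_μ dx)` and every
`k ∈ ℝ` there exists a distributional solution `u_k ∈ L¹(Ω, Λ_μ dx)` of the singular
Dirichlet problem satisfying the distributional identity with `c_{s,μ} k ξ(0)`. -/
theorem existence_singular_solutions
    (N : ℕ) (hN : 2 ≤ N) (s : ℝ) (hs : s ∈ Ioo (0:ℝ) 1)
    (μ τm τp : ℝ) (hμ : mu0 N s ≤ μ)
    (hτm : τm ∈ Ioc (-(N:ℝ)) ((2*s - N)/2)) (hτmc : csFun N s τm = -μ)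
    (hτp : τp ∈ Ico ((2*s - N)/2) (2*s)) (hτpc : csFun N s τp = -μ)
    (Ω : Set (EN N)) (hΩ : IsBoundedC2Domain N Ω) (h0 : (0:EN N) ∈ Ω)
    (θ : ℝ) (hθ : θ ∈ Ioo (0:ℝ) 1)
    (f : EN N → ℝ) (hf : HolderLocOn N θ f (closure Ω \ {0}))
    (hfInt : IntegrableOn (fun x : EN N => f x * ‖x‖ ^ τp) Ω)
    (k : ℝ) :
    ∃ u : EN N → ℝ,
      IntegrableOn (fun x : EN N => u x * Lam N s τp x) Ω ∧
      IsDistrSol N s μ Ω f u ∧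
      ∀ ξ : EN N → ℝ, ContDiff ℝ 2 ξ → HasCompactSupport ξ → tsupport ξ ⊆ Ω →
        ∀ g : EN N → ℝ, (∀ x : EN N, x ≠ 0 → HasWFracLap N s τp ξ x (g x)) →
          (∫ x in Ω, u x * g x) =
            (∫ x in Ω, f x * ξ x * ‖x‖ ^ τp) + csmu N s μ τm τp * k * ξ 0 := by
  have hN2 : (2:ℝ) ≤ N := by exact_mod_cast hN
  have hs0 := hs.1
  have hs1 := hs.2
  have ht := hτp.1
  have hts := hτp.2
  obtain ⟨R0, hR0, hΩR⟩ := hΩ.isBounded.subset_ball_lt 1 0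
  have hΩm := hΩ.isOpen.measurableSet
  obtain ⟨δ', hδ'0, hδ'1, hδ't⟩ : ∃ δ' : ℝ, 0 < δ' ∧ δ' ≤ 1 ∧ τp + δ' < 2*s :=
    ⟨min 1 ((2*s-τp)/2), lt_min one_pos (by linarith), min_le_left _ _, by
      have := min_le_right 1 ((2*s-τp)/2); linarith⟩
  have hxR : ∀ x ∈ Ω, ‖x‖ ≤ R0 := fun x hx => (mem_ball_zero_iff.1 (hΩR hx)).le
  obtain ⟨hFm, hFb⟩ := holder_facts hθ hΩ.isOpen hΩR hf
  have hne := ae_ne_zero (N := N) hN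
  set F : EN N → ℝ := (Ω \ {0}).indicator f with hF
  have hFin : ∀ x ∈ Ω, x ≠ 0 → F x = f x := fun x hx hx0 => indicator_of_mem (show x ∈ Ω \ {0} from ⟨hx, hx0⟩) f
  clear_value F
  have hFae : ∀ᵐ x ∂(volume.restrict Ω), F x = f x := by
    filter_upwards [ae_restrict_mem hΩm, ae_restrict_of_ae hne] with x hx hx0
    exact hFin x hx hx0
  have hFi : IntegrableOn (fun x => F x * ‖x‖^τp) Ω := hfInt.congr (by
    filter_upwards [hFae] with x hx; rw [hx])
  obtain ⟨u, hum, huΩ, huM, hui, hu⟩ := core_signed (δ := δ'/2) hN hs ht (by linarith) (by linarith) hδ'1 hδ't hR0.le hΩm hΩR hFm hFi hFb (csmu N s μ τm τp * k)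
  have hu' : ∀ ξ : EN N → ℝ, ContDiff ℝ 2 ξ → HasCompactSupport ξ → tsupport ξ ⊆ Ω →
        ∀ g : EN N → ℝ, (∀ x : EN N, x ≠ 0 → HasWFracLap N s τp ξ x (g x)) →
          Integrable (fun x => u x * g x) ∧ ∫ x, u x * g x =
            (∫ x in Ω, f x * ξ x * ‖x‖ ^ τp) + csmu N s μ τm τp * k * ξ 0 := by
    intro ξ hξ hc hsup g hg
    obtain ⟨h1, h2⟩ := hu ξ hξ hc (fun x hx => image_eq_zero_of_notMem_tsupport fun h => hx (hsup h)) g hg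
    refine ⟨h1, h2.trans ?_⟩
    congr 1
    refine integral_congr_ae ?_
    filter_upwards [hFae] with x hx; rw [hx]
  have hoff : ∀ v : EN N → ℝ, ∫ x in Ω, u x * v x = ∫ x, u x * v x := fun v =>
    setIntegral_eq_integral_of_forall_compl_eq_zero fun x hx => by rw [huΩ x hx, zero_mul]
  have huInt : Integrable u := by
    obtain ⟨C, hC⟩ : ∃ C, ∀ x : EN N, x ≠ 0 → ‖x‖ ≤ R0 → 1 ≤ C * ‖x‖^(τp+δ'/2-2*s) :=
      ⟨(R0^(τp+δ'/2-2*s))⁻¹, fun x hx hxR => by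
        rw [le_inv_mul_iff₀ (by positivity), mul_one]
        exact Real.rpow_le_rpow_of_nonpos (norm_pos_iff.2 hx) hxR (by linarith)⟩
    refine (hui.norm.const_mul C).mono' hum.aestronglyMeasurable ?_
    filter_upwards [hne] with x hx
    by_cases hxΩ : x ∈ Ω
    · rw [norm_mul, Real.norm_of_nonneg (by positivity : 0 ≤ ‖x‖^(τp+δ'/2-2*s))]
      have := mul_le_mul_of_nonneg_right (hC x hx (hxR x hxΩ)) (norm_nonneg (u x))
      linarith
    · rw [huΩ x hxΩ]; simp
  refine ⟨u, ?_, ⟨?_, ?_, huΩ, ?_⟩, ?_⟩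
  · obtain ⟨C, hC⟩ := Lam_bound (N := N) (s := s) (t := τp) (δ := δ'/2) (by linarith) (by linarith) (by linarith) hR0.le
    have hLm : Measurable (fun x : EN N => Lam N s τp x) := by
      unfold Lam
      split_ifs <;> fun_prop
    refine Integrable.integrableOn ?_
    refine (hui.norm.const_mul C).mono' (hum.mul hLm).aestronglyMeasurable ?_
    filter_upwards [hne] with x hx
    by_cases hxΩ : x ∈ Ω
    · rw [norm_mul, norm_mul, Real.norm_of_nonneg (by positivity : 0 ≤ ‖x‖^(τp+δ'/2-2*s))]
      have := mul_le_mul_of_nonneg_left (hC x hx (hxR x hxΩ)) (norm_nonneg (u x))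
      rw [Real.norm_eq_abs (Lam N s τp x)]
      linarith
    · rw [huΩ x hxΩ]; simp
  · intro K hK h0K
    obtain ⟨r, hr, hb⟩ := Metric.nhds_basis_ball.mem_iff.1 (hK.isClosed.isOpen_compl.mem_nhds h0K)
    obtain ⟨M, -, hM⟩ := huM r hr
    exact ⟨M, fun x hx => hM x (not_lt.1 fun h => hb (mem_ball_zero_iff.2 h) hx)⟩
  · refine huInt.norm.mono' (hum.div (by fun_prop)).aestronglyMeasurable (Eventually.of_forall fun x => ?_)
    have h1 : (1:ℝ) ≤ 1 + ‖x‖^((N:ℝ)+2*s) := by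
      have : 0 ≤ ‖x‖^((N:ℝ)+2*s) := by positivity
      linarith
    rw [norm_div, Real.norm_of_nonneg (by linarith : 0 ≤ 1 + ‖x‖^((N:ℝ)+2*s))]
    exact div_le_self (norm_nonneg _) h1
  · intro φ hφ hφc hφs g hg
    set ξ : EN N → ℝ := fun x => φ x * ‖x‖^(-τp) with hξ
    have hsub : tsupport ξ ⊆ tsupport φ := tsupport_mul_subset_left
    have hξ2 : ContDiff ℝ 2 ξ := by
      refine contDiff_iff_contDiffAt.2 fun x => ?_
      by_cases hx : x ∈ tsupport ξ
      swap
      · exact contDiffAt_const.congr_of_eventuallyEq (notMem_tsupport_iff_eventuallyEq.1 hx)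
      have hx0 : x ≠ 0 := (hφs (hsub hx)).2
      refine ContDiffAt.mul (hφ.contDiffAt.of_le (WithTop.coe_le_coe.2 (le_top : (2:ℕ∞) ≤ ⊤))) ?_
      exact (contDiffAt_norm ℝ hx0).rpow_const_of_ne (norm_ne_zero_iff.2 hx0)
    have hξc : HasCompactSupport ξ := hφc.mono' (subset_closure.trans hsub)
    have hξs : tsupport ξ ⊆ Ω := fun x hx => (hφs (hsub hx)).1
    have hφ0 : φ 0 = 0 := image_eq_zero_of_notMem_tsupport fun h => (hφs h).2 rfl
    have hξ0 : ξ 0 = 0 := by simp only [hξ, hφ0, zero_mul]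
    have hφξ : ∀ x, x ≠ 0 → φ x = ξ x * ‖x‖^τp := fun x hx => by
      simp only [hξ]
      rw [mul_assoc, ← Real.rpow_add (norm_pos_iff.2 hx), neg_add_cancel, Real.rpow_zero, mul_one]
    clear_value ξ
    obtain ⟨K, hK, hKb, -, -⟩ := c2_bounds hξ2 hξc
    have hw : ∀ x : EN N, x ≠ 0 → HasWFracLap N s τp ξ x (g x + μ * φ x / ‖x‖^(2*s)) := fun x hx =>
      frac_to_w hN hs ht hts hτpc hξ2.continuous.measurable hKb (by filter_upwards [hne] with z hz; exact hφξ z hz) hx (hφξ x hx) (hg x)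
    obtain ⟨i1, e1⟩ := hu' ξ hξ2 hξc hξs _ hw
    have i2 : Integrable (fun x => u x * φ x / ‖x‖^(2*s)) := by
      have h0t : (0:EN N) ∉ tsupport φ := fun h => (hφs h).2 rfl
      obtain ⟨r, hr, hb⟩ := Metric.nhds_basis_ball.mem_iff.1 ((isClosed_tsupport φ).isOpen_compl.mem_nhds h0t)
      obtain ⟨M, hM0, hM⟩ := huM r hr
      obtain ⟨B, hB⟩ := hφ.continuous.bounded_above_of_compact_support hφc
      have hB0 : 0 ≤ B := (norm_nonneg _).trans (hB 0)
      have hφm := hφ.continuous.measurable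
      refine bdd_supp_int (B := M * B / r^(2*s)) hΩR ((hum.mul hφm).div (by fun_prop)) (fun x => ?_) (fun x hx => by rw [huΩ x hx]; simp)
      by_cases hx : r ≤ ‖x‖
      · rw [abs_div, abs_mul, abs_of_nonneg (by positivity : 0 ≤ ‖x‖^(2*s))]
        exact div_le_div₀ (by positivity) (mul_le_mul (hM x hx) (hB x) (abs_nonneg _) hM0) (by positivity) (Real.rpow_le_rpow hr.le hx (by linarith))
      · have : φ x = 0 := image_eq_zero_of_notMem_tsupport fun h => hb (mem_ball_zero_iff.2 (not_le.1 hx)) h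
        rw [this]; simp; positivity
    have i3 : Integrable (fun x => u x * g x) := by
      refine (i1.sub (i2.const_mul μ)).congr (Eventually.of_forall fun x => ?_)
      simp only [Pi.sub_apply]; ring
    rw [← integral_const_mul, ← integral_add i3 (i2.const_mul μ)]
    rw [hξ0, mul_zero, add_zero] at e1
    have e2 : ∫ x, (u x * g x + μ * (u x * φ x / ‖x‖^(2*s))) = ∫ x, u x * (g x + μ * φ x / ‖x‖^(2*s)) := by
      congr 1; ext x; ring
    rw [e2, e1]
    refine integral_congr_ae (ae_restrict_of_ae ?_)
    filter_upwards [hne] with x hx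
    rw [hφξ x hx]; ring
  · intro ξ hξ hc hsup g hg
    rw [hoff]
    exact (hu' ξ hξ hc hsup g hg).2
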